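/- Let √(2x) < Q ≤ x be large and let 𝒜 = (a_n)_{n ≤ x} be a complex sequence satisfying the Progressions Condition (parameter K_prog) and the Non-concentration on Multiples condition (parameters K_conc[H]). Suppose further that for some parameters 3 ≤ P ≤ R ≤ x^{1/10}, some K_int^{(1)}, K_int^{(2)} > 0 and some K_int^{(3)} ≥ 1 the following hold: (Resembles the Integers I) for every h ∈ ℕ and every interval I ⊆ [1, x/h], | Σ_{n ∈ I, every prime factor of n is > P} a_{nh} − ((Σ_{n ≤ x} a_n)/x) · #{n ∈ I : every prime factor of n is > P} | ≤ (|I|/K_int^{(1)}) · (Σ_{n ≤ x} |a_n|)/x + (Σ_{n ≤ x} |a_n|)/K_int^{(2)}; and (Resembles the Integers II) for every h ∈ ℕ and every interval I ⊆ [1, x/h], Σ_{n ∈ I} |a_{nh}| τ(n) ≤ K_int^{(3)} |I| (Σ_{n ≤ x} |a_n|)/x + (Σ_{n ≤ x} |a_n|)/K_int^{(2)}. Then V(𝒜,x,Q) = (Q/2) Σ_{n ≤ x} |a_n|² − (Q/2) |Σ_{n ≤ x} a_n|²/x + |Σ_{n ≤ x} a_n|² ∫_{x/Q}^{2x/Q}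 {v}(1−{v}) dv/v³ + O( Σ_{n ≤ x} |a_n|² τ(n) ) + O( (Σ_{n ≤ x} |a_n|)² ( 1/K_prog + (log x)/(P (log P) K_conc[1]) + (log P / K_int^{(1)}) · √( Q/(x K_conc[2x/Q]) ) ) ) + O( (Σ_{n ≤ x} |a_n|) log⁶(Px/Q) ( (Q/(x K_int^{(1)})) Σ_{n ≤ x} |a_n| τ₃^{Px/Q}(n) + (log³ x) ( RP/K_int^{(2)} + Q K_int^{(3)}/(x R^{1/log P}) ) Σ_{n ≤ x} |a_n| τ₃(n) ) ), where {·} denotes the fractional part, and all implied constants are absolute. -/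

import Mathlib

open scoped Classical

/-- `τ(n)`: the number of divisors of `n`. -/
def tau (n : ℕ) : ℕ := n.divisors.card

/-- `τ₃(n) := #{(u,v,w) ∈ ℕ³ : uvw = n}`, the threefold divisor function. -/
noncomputable def tau3 (n : ℕ) : ℕ := Nat.card {t : ℕ × ℕ × ℕ // t.1 * t.2.1 * t.2.2 = n}

/-- `𝒜(z;q,b) := Σ_{n ≤ z, n ≡ b (mod q)} a_n`, for a complex sequence `a`. -/
noncomputable def seqSum (a : ℕ → ℂ) (z : ℝ) (q b : ℕ) : ℂ :=
  ∑ n ∈ (Finset.Icc 1 ⌊z⌋₊).filter (fun n => n % q = b % q), a n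

/-- `Aver(𝒜,z;q,h) := (1/φ(q/h)) Σ_{1 ≤ b ≤ q, (b,q)=h} 𝒜(z;q,b)`, for `h ∣ q`. -/
noncomputable def seqAver (a : ℕ → ℂ) (z : ℝ) (q h : ℕ) : ℂ :=
  (1 / (Nat.totient (q / h) : ℂ)) *
    ∑ b ∈ (Finset.Icc 1 q).filter (fun b => Nat.gcd b q = h), seqSum a z q b

/-- The Barban–Davenport–Halberstam type variance
`V(𝒜,x,Q) := Σ_{Q/2 < q ≤ Q} Σ_{1 ≤ b ≤ q} |𝒜(x;q,b) − Aver(𝒜,x;q,(b,q))|²`. -/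
noncomputable def varV (a : ℕ → ℂ) (x Q : ℝ) : ℝ :=
  ∑ q ∈ Finset.Ioc ⌊Q / 2⌋₊ ⌊Q⌋₊, ∑ b ∈ Finset.Icc 1 q,
    ‖seqSum a x q b - seqAver a x q (Nat.gcd b q)‖ ^ 2

/-- The left-hand side of the Progressions Condition: `Σ_{1 ≤ r ≤ 2x/Q} Σ_{1 ≤ b ≤ r}
(Σ_{n ≤ x, n ≡ b (mod r)} |a_n|) · max_{z ≤ x} |𝒜(z;r,b) − Aver(𝒜,z;r,(b,r))|`. -/
noncomputable def progLHS (a : ℕ → ℂ) (x Q : ℝ) : ℝ :=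
  ∑ r ∈ Finset.Icc 1 ⌊2 * x / Q⌋₊, ∑ b ∈ Finset.Icc 1 r,
    (∑ n ∈ (Finset.Icc 1 ⌊x⌋₊).filter (fun n => n % r = b % r), ‖a n‖) *
      (⨆ z ∈ Set.Icc (0 : ℝ) x, ‖seqSum a z r b - seqAver a z r (Nat.gcd b r)‖)

/-- The left-hand side of the Non-concentration on Multiples condition:
`Σ_{H ≤ h ≤ Q} (Σ_{n ≤ x, h ∣ n} |a_n|)²`. -/
noncomputable def concLHS (a : ℕ → ℂ) (x Q H : ℝ) : ℝ :=
  ∑ h ∈ (Finset.Icc 1 ⌊Q⌋₊).filter (fun h : ℕ => H ≤ (h : ℝ)),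
    (∑ n ∈ (Finset.Icc 1 ⌊x⌋₊).filter (fun n => h ∣ n), ‖a n‖) ^ 2

/-- The largest `y`-smooth divisor of `n`. -/
noncomputable def smoothPart (y : ℝ) (n : ℕ) : ℕ :=
  ∏ p ∈ n.primeFactors.filter (fun p : ℕ => (p : ℝ) ≤ y), p ^ n.factorization p

/-- `τ₃^y(n)`: the multiplicative function agreeing with `τ₃` on powers of primes `≤ y`
and identically `1` on powers of larger primes; equivalently, `τ₃` of the largest
`y`-smooth divisor of `n`. -/
noncomputable def tau3P (y : ℝ) (n : ℕ) : ℕ := tau3 (smoothPart y n)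

section

open Finset ComplexConjugate

theorem tau_mul_le (d e : ℕ) : tau (d * e) ≤ tau d * tau e := by
  unfold tau
  rw [Nat.divisors_mul]
  exact Finset.card_mul_le

theorem tau_pos {n : ℕ} (hn : n ≠ 0) : 1 ≤ tau n :=
  Finset.card_pos.mpr ⟨1, Nat.one_mem_divisors.mpr hn⟩

theorem tau_le_of_dvd {m n : ℕ} (hn : n ≠ 0) (h : m ∣ n) : tau m ≤ tau n :=
  Finset.card_le_card (Nat.divisors_subset_of_dvd hn h)

/-- Dirichlet's rearrangement of a sum over the pairs `(d, l)` with `d l ≤ n`. -/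
theorem sum_Icc_sum_divisors {M : Type*} [AddCommMonoid M] (n : ℕ) (F : ℕ → ℕ → M) :
    ∑ k ∈ Icc 1 n, ∑ d ∈ k.divisors, F d (k / d) =
      ∑ d ∈ Icc 1 n, ∑ l ∈ Icc 1 (n / d), F d l := by
  rw [Finset.sum_sigma', Finset.sum_sigma']
  refine Finset.sum_nbij' (fun s => ⟨s.2, s.1 / s.2⟩) (fun s => ⟨s.1 * s.2, s.1⟩) ?_ ?_ ?_ ?_ ?_
  · rintro ⟨k, d⟩ h
    simp only [mem_sigma, mem_Icc, Nat.mem_divisors] at h ⊢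
    obtain ⟨⟨h1, h2⟩, h3, h4⟩ := h
    have hd : 0 < d := Nat.pos_of_dvd_of_pos h3 (by omega)
    exact ⟨⟨hd, (Nat.le_of_dvd (by omega) h3).trans h2⟩,
      Nat.div_pos (Nat.le_of_dvd (by omega) h3) hd, Nat.div_le_div_right h2⟩
  · rintro ⟨d, l⟩ h
    simp only [mem_sigma, mem_Icc, Nat.mem_divisors] at h ⊢
    obtain ⟨⟨h1, h2⟩, h3, h4⟩ := h
    have : 0 < d * l := Nat.mul_pos (by omega) (by omega)
    refine ⟨⟨this, ?_⟩, Dvd.intro _ rfl, by omega⟩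
    rw [mul_comm]
    exact (Nat.le_div_iff_mul_le (by omega)).mp h4
  · rintro ⟨k, d⟩ h
    simp only [mem_sigma, mem_Icc, Nat.mem_divisors] at h ⊢
    simp [Nat.mul_div_cancel' h.2.1]
  · rintro ⟨d, l⟩ h
    simp only [mem_sigma, mem_Icc] at h ⊢
    simp [Nat.mul_div_cancel_left l (show 0 < d by omega)]
  · rintro ⟨k, d⟩ h
    rfl

theorem sum_Icc_mul_sum_divisors (n : ℕ) (f g : ℕ → ℝ) :
    ∑ k ∈ Icc 1 n, f k * ∑ d ∈ k.divisors, g d =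
      ∑ d ∈ Icc 1 n, g d * ∑ l ∈ Icc 1 (n / d), f (d * l) := by
  simp_rw [Finset.mul_sum]
  rw [← sum_Icc_sum_divisors n (fun d l => g d * f (d * l))]
  refine Finset.sum_congr rfl fun k hk => ?_
  refine Finset.sum_congr rfl fun d hd => ?_
  rw [Nat.mul_div_cancel' (Nat.dvd_of_mem_divisors hd), mul_comm]

theorem sum_Icc_inv_le (n : ℕ) : ∑ k ∈ Icc 1 n, 1 / (k : ℝ) ≤ 1 + Real.log n := by
  have h := harmonic_le_one_add_log n
  rw [harmonic_eq_sum_Icc] at h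
  push_cast at h
  simpa [one_div] using h

theorem sum_Icc_inv_sq_tail_le (Z : ℕ) {y : ℝ} (hy : 0 < y) :
    ∑ l ∈ (Icc 1 Z).filter (fun l : ℕ => y < l), 1 / (l : ℝ) ^ 2 ≤ 2 / y := by
  calc _ ≤ ∑ l ∈ Ioo ⌊y⌋₊ (Z + 1), ((l : ℝ) ^ 2)⁻¹ := by
        simp_rw [one_div]
        refine Finset.sum_le_sum_of_subset_of_nonneg ?_ (fun _ _ _ => by positivity)
        intro l hl
        simp only [mem_filter, mem_Icc, mem_Ioo] at hl ⊢
        exact ⟨(Nat.floor_lt hy.le).mpr hl.2, by omega⟩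
    _ ≤ 2 / (⌊y⌋₊ + 1) := sum_Ioo_inv_sq_le _ _
    _ ≤ 2 / y := by
        gcongr
        exact (Nat.lt_floor_add_one y).le

/-- The sum `∑ 1/l` over `z/2 < l ≤ z`. -/
noncomputable def dyadicHarmonic (z : ℝ) : ℝ :=
  ∑ l ∈ (Icc 1 ⌊z⌋₊).filter (fun l : ℕ => z < 2 * l), 1 / (l : ℝ)

theorem dyadicHarmonic_nonneg (z : ℝ) : 0 ≤ dyadicHarmonic z :=
  Finset.sum_nonneg fun _ _ => by positivity

theorem dyadicHarmonic_of_lt_one {z : ℝ} (hz : z < 1) : dyadicHarmonic z = 0 := by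
  unfold dyadicHarmonic
  rw [Nat.floor_eq_zero.mpr hz]; simp

theorem dyadicHarmonic_le (z : ℝ) : dyadicHarmonic z ≤ 2 := by
  rcases lt_or_ge z 1 with h | h
  · rw [dyadicHarmonic_of_lt_one h]; norm_num
  have h0 : 0 < z := by linarith
  calc dyadicHarmonic z ≤ ∑ l ∈ (Icc 1 ⌊z⌋₊).filter (fun l : ℕ => z < 2 * l), 2 / z := by
        refine Finset.sum_le_sum fun l hl => ?_
        simp only [mem_filter, mem_Icc] at hl
        have : (1 : ℝ) ≤ l := by exact_mod_cast hl.1.1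
        rw [div_le_div_iff₀ (by linarith) h0]; linarith [hl.2]
    _ ≤ ∑ l ∈ Icc 1 ⌊z⌋₊, 2 / z :=
        Finset.sum_le_sum_of_subset_of_nonneg (filter_subset _ _) (fun _ _ _ => by positivity)
    _ = ⌊z⌋₊ * (2 / z) := by simp
    _ ≤ z * (2 / z) := by gcongr; exact Nat.floor_le h0.le
    _ = 2 := by field_simp

theorem dyadicHarmonic_eq {z : ℝ} (hz : 0 ≤ z) :
    dyadicHarmonic z = (harmonic ⌊z⌋₊ : ℝ) - harmonic ⌊z / 2⌋₊ := by
  have hle : ⌊z / 2⌋₊ ≤ ⌊z⌋₊ := Nat.floor_le_floor (by linarith)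
  rw [harmonic_eq_sum_Icc, harmonic_eq_sum_Icc]
  push_cast
  rw [eq_sub_iff_add_eq]
  unfold dyadicHarmonic
  have : Icc 1 ⌊z / 2⌋₊ = (Icc 1 ⌊z⌋₊).filter (fun l : ℕ => ¬ z < 2 * l) := by
    ext l
    simp only [mem_Icc, mem_filter, not_lt]
    rw [Nat.le_floor_iff (by linarith), Nat.le_floor_iff hz]
    constructor
    · rintro ⟨h1, h2⟩; exact ⟨⟨h1, by linarith⟩, by linarith⟩
    · rintro ⟨⟨h1, h2⟩, h3⟩; exact ⟨h1, by linarith⟩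
  rw [this]
  simp_rw [one_div]
  exact Finset.sum_filter_add_sum_filter_not _ _ _

theorem abs_dyadicHarmonic_sub_log_two_le {z : ℝ} (hz : 0 < z) :
    |dyadicHarmonic z - Real.log 2| ≤ 4 / z := by
  have hlog2 : Real.log 2 ≤ 0.7 := by have := Real.log_two_lt_d9; linarith
  have hlog2' : 0 < Real.log 2 := Real.log_pos (by norm_num)
  rw [abs_le]
  constructor
  · have hle : ⌊z / 2⌋₊ ≤ ⌊z⌋₊ := Nat.floor_le_floor (by linarith)
    have h := Real.strictMono_eulerMascheroniSeq.monotone hle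
    unfold Real.eulerMascheroniSeq at h
    rw [dyadicHarmonic_eq hz.le]
    have h1 : Real.log z ≤ Real.log (⌊z⌋₊ + 1) :=
      Real.log_le_log hz (Nat.lt_floor_add_one z).le
    have h2 : Real.log (⌊z / 2⌋₊ + 1) ≤ Real.log (z / 2 + 1) := by
      apply Real.log_le_log (by positivity)
      linarith [Nat.floor_le (show 0 ≤ z / 2 by linarith)]
    have h3 : Real.log (z / 2 + 1) = Real.log z - Real.log 2 + Real.log (1 + 2 / z) := by
      rw [← Real.log_div (by positivity) (by norm_num), ← Real.log_mul (by positivity) (by positivity)]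
      congr 1; field_simp
    have h4 : Real.log (1 + 2 / z) ≤ 2 / z := by
      have := Real.log_le_sub_one_of_pos (show 0 < 1 + 2 / z by positivity); linarith
    have h5 : 2 / z ≤ 4 / z := by gcongr; norm_num
    linarith
  · rcases lt_or_ge z 4 with h4 | h4
    · have := dyadicHarmonic_le z
      rcases lt_or_ge z 2 with h2 | h2
      · have : 2 ≤ 4 / z := by rw [le_div_iff₀ hz]; linarith
        linarith
      · have : dyadicHarmonic z ≤ 1 := by
          unfold dyadicHarmonic
          have hsub : (Icc 1 ⌊z⌋₊).filter (fun l : ℕ => z < 2 * l) ⊆ {2, 3} := by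
            intro l hl
            simp only [mem_filter, mem_Icc, mem_insert, mem_singleton] at hl ⊢
            have h5 : ⌊z⌋₊ < 4 := (Nat.floor_lt hz.le).mpr (by exact_mod_cast h4)
            have h6 : (1 : ℝ) < l := by linarith [hl.2]
            have h7 : 1 < l := by exact_mod_cast h6
            omega
          refine (Finset.sum_le_sum_of_subset_of_nonneg hsub (fun _ _ _ => by positivity)).trans ?_
          norm_num
        have : 1 ≤ 4 / z := by rw [le_div_iff₀ hz]; linarith
        linarith
    · have hle : ⌊z / 2⌋₊ ≤ ⌊z⌋₊ := Nat.floor_le_floor (by linarith)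
      have h := Real.strictAnti_eulerMascheroniSeq'.antitone hle
      have hp : 1 ≤ ⌊z / 2⌋₊ := Nat.le_floor (by push_cast; linarith)
      have hp' : ⌊z⌋₊ ≠ 0 := by omega
      unfold Real.eulerMascheroniSeq' at h
      rw [if_neg hp', if_neg (by omega)] at h
      rw [dyadicHarmonic_eq hz.le]
      have h1 : Real.log ⌊z⌋₊ ≤ Real.log z :=
        Real.log_le_log (by exact_mod_cast Nat.pos_of_ne_zero hp') (Nat.floor_le hz.le)
      have h2 : Real.log (z / 2 - 1) ≤ Real.log ⌊z / 2⌋₊ := by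
        apply Real.log_le_log (by linarith)
        linarith [Nat.lt_floor_add_one (z / 2)]
      have h3 : Real.log z = Real.log (z / 2 - 1) + Real.log 2 + Real.log (1 + 2 / (z - 2)) := by
        have : 0 < z - 2 := by linarith
        have h6 : 0 < z / 2 - 1 := by linarith
        rw [← Real.log_mul (by positivity) (by norm_num), ← Real.log_mul (by positivity) (by positivity)]
        congr 1; field_simp; ring
      have h5 : Real.log (1 + 2 / (z - 2)) ≤ 2 / (z - 2) := by
        have h7 : 0 < z - 2 := by linarith
        have := Real.log_le_sub_one_of_pos (show 0 < 1 + 2 / (z - 2) by positivity); linarith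
      have h6 : 2 / (z - 2) ≤ 4 / z := by
        rw [div_le_div_iff₀ (by linarith) hz]; linarith
      linarith

theorem sum_squarefree_divisors_prod {k : ℕ} (hk : k ≠ 0) (f : ℕ → ℝ) :
    ∑ d ∈ k.divisors.filter Squarefree, ∏ p ∈ d.primeFactors, f p =
      ∏ p ∈ k.primeFactors, (1 + f p) := by
  have := Nat.sum_divisors_filter_squarefree hk (f := fun d => ∏ p ∈ d.primeFactors, f p)
  rw [Finset.prod_one_add]
  convert this using 1
  have hS : (UniqueFactorizationMonoid.normalizedFactors k).toFinset = k.primeFactors := by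
    ext p
    rw [Multiset.mem_toFinset, Nat.factors_eq, Multiset.mem_coe, Nat.mem_primeFactors_iff_mem_primeFactorsList]
  rw [hS]
  refine Finset.sum_congr rfl fun t ht => ?_
  have h : t.val.prod = ∏ p ∈ t, p := Finset.prod_val t
  rw [h, Nat.primeFactors_prod]
  intro p hp
  exact Nat.prime_of_mem_primeFactors (mem_powerset.mp ht hp)

/-- The multiplicative function supported on squarefree integers, with value `-1` at the primes
dividing `D` and `1/(p-1)` at the other primes `p`. -/
noncomputable def copWeight (D d : ℕ) : ℝ :=
  if Squarefree d then ∏ p ∈ d.primeFactors, (if p ∣ D then -1 else 1 / ((p : ℝ) - 1)) else 0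

theorem div_totient_eq_prod {k : ℕ} (hk : k ≠ 0) :
    (k : ℝ) / k.totient = ∏ p ∈ k.primeFactors, (1 + 1 / ((p : ℝ) - 1)) := by
  have h := Nat.totient_eq_mul_prod_factors k
  have h' : (k.totient : ℝ) = k * ∏ p ∈ k.primeFactors, (1 - (p : ℝ)⁻¹) := by
    have := congrArg (fun q : ℚ => (q : ℝ)) h
    push_cast at this
    exact this
  have hk' : (k : ℝ) ≠ 0 := by exact_mod_cast hk
  rw [h', div_mul_eq_div_div, div_self hk', one_div, ← Finset.prod_inv_distrib]
  refine Finset.prod_congr rfl fun p hp => ?_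
  have hp2 : (2 : ℝ) ≤ p := by exact_mod_cast (Nat.prime_of_mem_primeFactors hp).two_le
  have h1 : (p : ℝ) - 1 ≠ 0 := by linarith
  have h2 : (p : ℝ) ≠ 0 := by linarith
  have h3 : 1 - (p : ℝ)⁻¹ ≠ 0 := by
    have : (p : ℝ)⁻¹ < 1 := inv_lt_one_of_one_lt₀ (by linarith)
    linarith
  field_simp
  ring_nf

theorem sum_divisors_copWeight {k : ℕ} (hk : k ≠ 0) (D : ℕ) :
    ∑ d ∈ k.divisors, copWeight D d = if Nat.Coprime k D then (k : ℝ) / k.totient else 0 := by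
  unfold copWeight
  rw [← Finset.sum_filter, sum_squarefree_divisors_prod hk]
  split_ifs with h
  · rw [div_totient_eq_prod hk]
    refine Finset.prod_congr rfl fun p hp => ?_
    rw [if_neg]
    intro hpD
    have hpp := Nat.prime_of_mem_primeFactors hp
    have := Nat.dvd_gcd (Nat.dvd_of_mem_primeFactors hp) hpD
    rw [h] at this
    exact hpp.one_lt.ne' (Nat.dvd_one.mp this)
  · obtain ⟨p, hp, hpk, hpD⟩ := Nat.Prime.not_coprime_iff_dvd.mp h
    refine Finset.prod_eq_zero (Nat.mem_primeFactors.mpr ⟨hp, hpk, hk⟩) ?_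
    rw [if_pos hpD]; norm_num

theorem copWeight_one (d : ℕ) :
    copWeight 1 d = if Squarefree d then ∏ p ∈ d.primeFactors, 1 / ((p : ℝ) - 1) else 0 := by
  unfold copWeight
  split_ifs with h
  · refine Finset.prod_congr rfl fun p hp => ?_
    rw [if_neg]
    intro h
    exact (Nat.prime_of_mem_primeFactors hp).one_lt.ne' (Nat.dvd_one.mp h)
  · rfl

theorem sub_one_pos_of_mem_primeFactors {p d : ℕ} (hp : p ∈ d.primeFactors) : 0 < (p : ℝ) - 1 := by
  have : (2 : ℝ) ≤ p := by exact_mod_cast (Nat.prime_of_mem_primeFactors hp).two_le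
  linarith

theorem copWeight_one_nonneg (d : ℕ) : 0 ≤ copWeight 1 d := by
  rw [copWeight_one]
  split_ifs
  · exact Finset.prod_nonneg fun p hp => (div_pos one_pos (sub_one_pos_of_mem_primeFactors hp)).le
  · rfl

theorem inv_totient_eq {k : ℕ} (hk : k ≠ 0) :
    1 / (k.totient : ℝ) = 1 / k * ∑ d ∈ k.divisors, copWeight 1 d := by
  rw [sum_divisors_copWeight hk, if_pos (Nat.coprime_one_right k)]
  have : (k : ℝ) ≠ 0 := by exact_mod_cast hk
  field_simp

theorem sum_copWeight_one_div_le (n : ℕ) : ∑ d ∈ Icc 1 n, copWeight 1 d / d ≤ 3 := by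
  have h1 : ∑ d ∈ Icc 1 n, copWeight 1 d / d ≤
      ∑ d ∈ (primorial n).divisors.filter Squarefree,
        ∏ p ∈ d.primeFactors, 1 / (((p : ℝ) - 1) * p) := by
    have : ∑ d ∈ Icc 1 n, copWeight 1 d / d =
        ∑ d ∈ (Icc 1 n).filter Squarefree, ∏ p ∈ d.primeFactors, 1 / (((p : ℝ) - 1) * p) := by
      rw [Finset.sum_filter]
      refine Finset.sum_congr rfl fun d hd => ?_
      rw [copWeight_one]
      split_ifs with hs
      · have : (d : ℝ) = ∏ p ∈ d.primeFactors, (p : ℝ) := by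
          rw [← Nat.cast_prod, Nat.prod_primeFactors_of_squarefree hs]
        rw [this, ← Finset.prod_div_distrib]
        refine Finset.prod_congr rfl fun p hp => ?_
        rw [div_div]
      · simp
    rw [this]
    refine Finset.sum_le_sum_of_subset_of_nonneg ?_ ?_
    · intro d hd
      simp only [mem_filter, mem_Icc, Nat.mem_divisors] at hd ⊢
      refine ⟨⟨?_, (primorial_pos n).ne'⟩, hd.2⟩
      rw [← Nat.prod_primeFactors_of_squarefree hd.2]
      unfold primorial
      refine Finset.prod_dvd_prod_of_subset _ _ _ fun p hp => ?_
      rw [mem_filter, mem_range]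
      have := Nat.le_of_dvd (by omega) (Nat.dvd_of_mem_primeFactors hp)
      exact ⟨by omega, Nat.prime_of_mem_primeFactors hp⟩
    · intro d _ _
      exact Finset.prod_nonneg fun p hp => by
        have := sub_one_pos_of_mem_primeFactors hp
        positivity
  refine h1.trans ?_
  rw [sum_squarefree_divisors_prod (primorial_pos n).ne']
  calc ∏ p ∈ (primorial n).primeFactors, (1 + 1 / (((p : ℝ) - 1) * p))
      ≤ ∏ p ∈ (primorial n).primeFactors, Real.exp (1 / (((p : ℝ) - 1) * p)) := by
        refine Finset.prod_le_prod (fun p hp => ?_) fun p hp => ?_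
        · have := sub_one_pos_of_mem_primeFactors hp
          positivity
        · rw [add_comm]; exact Real.add_one_le_exp _
    _ = Real.exp (∑ p ∈ (primorial n).primeFactors, 1 / (((p : ℝ) - 1) * p)) :=
        (Real.exp_sum _ _).symm
    _ ≤ Real.exp 1 := by
        refine Real.exp_le_exp.mpr ?_
        have hsub : (primorial n).primeFactors ⊆ Ico 2 (n + 2) := by
          intro p hp
          have hpp := Nat.prime_of_mem_primeFactors hp
          have := hpp.dvd_primorial_iff.mp (Nat.dvd_of_mem_primeFactors hp)
          rw [mem_Ico]
          exact ⟨hpp.two_le, by omega⟩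
        refine (Finset.sum_le_sum_of_subset_of_nonneg hsub ?_).trans ?_
        · intro p hp _
          have : (2 : ℝ) ≤ p := by exact_mod_cast (mem_Ico.mp hp).1
          have : 0 < (p : ℝ) - 1 := by linarith
          positivity
        · have : ∀ m : ℕ, ∑ p ∈ Ico 2 (m + 2), 1 / (((p : ℝ) - 1) * p) = 1 - 1 / (m + 1) := by
            intro m
            induction m with
            | zero => simp
            | succ m ih =>
              rw [Finset.sum_Ico_succ_top (by omega), ih]
              push_cast
              have h1 : (m : ℝ) + 1 ≠ 0 := by positivity
              have h2 : (m : ℝ) + 2 ≠ 0 := by positivity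
              have h3 : (m : ℝ) + 2 - 1 = m + 1 := by ring
              have h4 : (m : ℝ) + 1 + 1 = m + 2 := by ring
              rw [h3, h4]
              field_simp
              ring
          rw [this]
          have : (0 : ℝ) ≤ 1 / (n + 1) := by positivity
          linarith
    _ ≤ 3 := by have := Real.exp_one_lt_d9; linarith

theorem sum_inv_totient_le (n : ℕ) :
    ∑ k ∈ Icc 1 n, 1 / (k.totient : ℝ) ≤ 3 * (1 + Real.log n) := by
  have h : ∑ k ∈ Icc 1 n, 1 / (k.totient : ℝ) =
      ∑ k ∈ Icc 1 n, 1 / (k : ℝ) * ∑ d ∈ k.divisors, copWeight 1 d :=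
    Finset.sum_congr rfl fun k hk => inv_totient_eq (by have := mem_Icc.mp hk; omega)
  rw [h, sum_Icc_mul_sum_divisors n (fun k => 1 / (k : ℝ))]
  calc _ ≤ ∑ d ∈ Icc 1 n, copWeight 1 d / d * (1 + Real.log n) := by
        refine Finset.sum_le_sum fun d hd => ?_
        have hd1 := mem_Icc.mp hd
        have : ∑ l ∈ Icc 1 (n / d), 1 / ((d * l : ℕ) : ℝ) = 1 / d * ∑ l ∈ Icc 1 (n / d), 1 / (l : ℝ) := by
          rw [Finset.mul_sum]
          refine Finset.sum_congr rfl fun l _ => ?_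
          push_cast
          rw [div_mul_div_comm, one_mul]
        rw [this, ← mul_assoc, mul_one_div]
        refine mul_le_mul_of_nonneg_left ?_ (div_nonneg (copWeight_one_nonneg d) (by positivity))
        refine (sum_Icc_inv_le _).trans ?_
        have h1 : 1 ≤ n / d := Nat.div_pos hd1.2 hd1.1
        have : Real.log (n / d : ℕ) ≤ Real.log n :=
          Real.log_le_log (by exact_mod_cast h1) (by exact_mod_cast Nat.div_le_self n d)
        linarith
    _ = (∑ d ∈ Icc 1 n, copWeight 1 d / d) * (1 + Real.log n) := by rw [Finset.sum_mul]
    _ ≤ 3 * (1 + Real.log n) := by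
        refine mul_le_mul_of_nonneg_right (sum_copWeight_one_div_le n) ?_
        have := Real.log_natCast_nonneg n
        linarith

theorem sum_inv_mul_totient_tail_le (Z : ℕ) {v : ℝ} (hv : 0 < v) :
    ∑ k ∈ (Icc 1 Z).filter (fun k : ℕ => v < k), 1 / ((k : ℝ) * k.totient) ≤ 6 / v := by
  have h : ∑ k ∈ (Icc 1 Z).filter (fun k : ℕ => v < k), 1 / ((k : ℝ) * k.totient) =
      ∑ k ∈ Icc 1 Z, (if v < k then 1 / (k : ℝ) ^ 2 else 0) * ∑ d ∈ k.divisors, copWeight 1 d := by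
    rw [Finset.sum_filter]
    refine Finset.sum_congr rfl fun k hk => ?_
    split_ifs
    · rw [← div_div, div_eq_mul_one_div, inv_totient_eq (by have := mem_Icc.mp hk; omega),
        ← mul_assoc, div_mul_div_comm, one_mul, sq]
    · simp
  rw [h, sum_Icc_mul_sum_divisors Z (fun k : ℕ => if v < k then 1 / (k : ℝ) ^ 2 else 0)]
  calc _ ≤ ∑ d ∈ Icc 1 Z, copWeight 1 d / d * (2 / v) := by
        refine Finset.sum_le_sum fun d hd => ?_
        have hd1 : (0 : ℝ) < d := by exact_mod_cast (mem_Icc.mp hd).1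
        have h1 : ∑ l ∈ Icc 1 (Z / d), (if v < ((d * l : ℕ) : ℝ) then 1 / ((d * l : ℕ) : ℝ) ^ 2 else 0)
            = 1 / (d : ℝ) ^ 2 * ∑ l ∈ (Icc 1 (Z / d)).filter (fun l : ℕ => v / d < l), 1 / (l : ℝ) ^ 2 := by
          rw [Finset.sum_filter, Finset.mul_sum]
          refine Finset.sum_congr rfl fun l _ => ?_
          have : (v < ((d * l : ℕ) : ℝ)) ↔ v / d < l := by
            push_cast; rw [div_lt_iff₀ hd1, mul_comm]
          simp only [this]
          split_ifs
          · push_cast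
            rw [mul_pow, div_mul_div_comm, one_mul]
          · simp
        rw [h1]
        have h2 := sum_Icc_inv_sq_tail_le (Z / d) (div_pos hv hd1)
        calc _ ≤ copWeight 1 d * (1 / (d : ℝ) ^ 2 * (2 / (v / d))) := by
              refine mul_le_mul_of_nonneg_left ?_ (copWeight_one_nonneg d)
              exact mul_le_mul_of_nonneg_left h2 (by positivity)
          _ = _ := by field_simp
    _ = (∑ d ∈ Icc 1 Z, copWeight 1 d / d) * (2 / v) := by rw [Finset.sum_mul]
    _ ≤ 3 * (2 / v) := mul_le_mul_of_nonneg_right (sum_copWeight_one_div_le Z) (by positivity)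
    _ = 6 / v := by ring

theorem sum_le_sum_sum_of_cover {ι κ : Type*} (S : Finset ι) (U : Finset κ) (T : κ → Finset ι)
    {f : ι → ℝ} (hf : ∀ i, 0 ≤ f i) (h : ∀ i ∈ S, ∃ k ∈ U, i ∈ T k) :
    ∑ i ∈ S, f i ≤ ∑ k ∈ U, ∑ i ∈ T k, f i := by
  calc ∑ i ∈ S, f i ≤ ∑ i ∈ S, ∑ k ∈ U, (if i ∈ T k then f i else 0) := by
        refine Finset.sum_le_sum fun i hi => ?_
        obtain ⟨k, hk, hik⟩ := h i hi
        refine le_trans ?_ (Finset.single_le_sum (fun k _ => ?_) hk)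
        · rw [if_pos hik]
        · split_ifs
          exacts [hf i, le_rfl]
    _ = ∑ k ∈ U, ∑ i ∈ S.filter (· ∈ T k), f i := by
        rw [Finset.sum_comm]
        exact Finset.sum_congr rfl fun k _ => (Finset.sum_filter _ _).symm
    _ ≤ _ := Finset.sum_le_sum fun k _ =>
        Finset.sum_le_sum_of_subset_of_nonneg (fun i hi => (mem_filter.mp hi).2) (fun i _ _ => hf i)

/-- The sum of `1/φ(k)` over `z/2 < k ≤ z` coprime to `D`. -/
noncomputable def copDyadic (D : ℕ) (z : ℝ) : ℝ :=
  ∑ k ∈ (Icc 1 ⌊z⌋₊).filter (fun k : ℕ => z < 2 * k ∧ Nat.Coprime k D), 1 / (k.totient : ℝ)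

theorem copDyadic_nonneg (D : ℕ) (z : ℝ) : 0 ≤ copDyadic D z :=
  Finset.sum_nonneg fun _ _ => by positivity

theorem copDyadic_of_lt_one (D : ℕ) {z : ℝ} (hz : z < 1) : copDyadic D z = 0 := by
  unfold copDyadic
  rw [Nat.floor_eq_zero.mpr hz]; simp

theorem copDyadic_eq (D : ℕ) (z : ℝ) :
    copDyadic D z = ∑ d ∈ Icc 1 ⌊z⌋₊, copWeight D d / d * dyadicHarmonic (z / d) := by
  have h : copDyadic D z = ∑ k ∈ Icc 1 ⌊z⌋₊,
      (if z < 2 * (k : ℝ) then 1 / (k : ℝ) else 0) * ∑ d ∈ k.divisors, copWeight D d := by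
    unfold copDyadic
    rw [Finset.sum_filter]
    refine Finset.sum_congr rfl fun k hk => ?_
    have hk1 := mem_Icc.mp hk
    have hk0 : (k : ℝ) ≠ 0 := by have := hk1.1; positivity
    rw [sum_divisors_copWeight (by omega)]
    by_cases h1 : z < 2 * (k : ℝ) <;> by_cases h2 : Nat.Coprime k D <;> simp [h1, h2]
    field_simp
  rw [h, sum_Icc_mul_sum_divisors ⌊z⌋₊ (fun k : ℕ => if z < 2 * (k : ℝ) then 1 / (k : ℝ) else 0)]
  refine Finset.sum_congr rfl fun d hd => ?_
  have hd0 : (0 : ℝ) < d := by exact_mod_cast (mem_Icc.mp hd).1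
  unfold dyadicHarmonic
  rw [Nat.floor_div_natCast, Finset.sum_filter, div_mul_eq_mul_div, mul_div_assoc]
  congr 1
  rw [Finset.sum_div]
  refine Finset.sum_congr rfl fun l _ => ?_
  have : z < 2 * ((d * l : ℕ) : ℝ) ↔ z / d < 2 * l := by
    rw [div_lt_iff₀ hd0]; push_cast; ring_nf
  simp only [this]
  split_ifs
  · push_cast; rw [div_div, mul_comm]
  · simp

theorem copDyadic_one_le (z : ℝ) : copDyadic 1 z ≤ 6 := by
  rw [copDyadic_eq]
  calc _ ≤ ∑ d ∈ Icc 1 ⌊z⌋₊, copWeight 1 d / d * 2 := by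
        refine Finset.sum_le_sum fun d _ => ?_
        refine mul_le_mul_of_nonneg_left (dyadicHarmonic_le _) ?_
        exact div_nonneg (copWeight_one_nonneg d) (by positivity)
    _ ≤ 3 * 2 := by
        rw [← Finset.sum_mul]
        exact mul_le_mul_of_nonneg_right (sum_copWeight_one_div_le _) (by norm_num)
    _ = 6 := by norm_num

theorem copDyadic_anti {D D' : ℕ} (h : D ∣ D') (z : ℝ) : copDyadic D' z ≤ copDyadic D z := by
  unfold copDyadic
  refine Finset.sum_le_sum_of_subset_of_nonneg ?_ (fun _ _ _ => by positivity)
  intro k hk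
  simp only [mem_filter] at hk ⊢
  exact ⟨hk.1, hk.2.1, hk.2.2.coprime_dvd_right h⟩

theorem copDyadic_le (D : ℕ) (z : ℝ) : copDyadic D z ≤ 6 :=
  (copDyadic_anti (one_dvd D) z).trans (copDyadic_one_le z)

theorem sum_inv_totient_multiples_le {p : ℕ} (hp : p.Prime) (z : ℝ) :
    ∑ k ∈ (Icc 1 ⌊z⌋₊).filter (fun k : ℕ => z < 2 * k ∧ p ∣ k), 1 / (k.totient : ℝ) ≤
      6 / ((p : ℝ) - 1) := by
  have hp2 : (2 : ℝ) ≤ p := by exact_mod_cast hp.two_le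
  have hp1 : 0 < (p : ℝ) - 1 := by linarith
  have hp0 : (0 : ℝ) < p := by linarith
  calc _ ≤ ∑ k ∈ ((Icc 1 ⌊z / p⌋₊).filter
          (fun l : ℕ => z / p < 2 * l ∧ Nat.Coprime l 1)).image (fun l => p * l),
            1 / (k.totient : ℝ) := by
        refine Finset.sum_le_sum_of_subset_of_nonneg ?_ (fun _ _ _ => by positivity)
        intro k hk
        simp only [mem_filter, mem_Icc, mem_image] at hk ⊢
        obtain ⟨l, rfl⟩ := hk.2.2
        refine ⟨l, ⟨⟨Nat.pos_of_ne_zero ?_, ?_⟩, ?_, Nat.coprime_one_right l⟩, rfl⟩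
        · rintro rfl; omega
        · rw [Nat.floor_div_natCast, Nat.le_div_iff_mul_le hp.pos, mul_comm]; exact hk.1.2
        · rw [div_lt_iff₀ hp0]; have := hk.2.1; push_cast at this; linarith
    _ = ∑ l ∈ (Icc 1 ⌊z / p⌋₊).filter (fun l : ℕ => z / p < 2 * l ∧ Nat.Coprime l 1),
          1 / ((p * l).totient : ℝ) := by
        rw [Finset.sum_image]
        intro a _ b _ h
        exact Nat.eq_of_mul_eq_mul_left hp.pos h
    _ ≤ ∑ l ∈ (Icc 1 ⌊z / p⌋₊).filter (fun l : ℕ => z / p < 2 * l ∧ Nat.Coprime l 1),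
          1 / ((p : ℝ) - 1) * (1 / (l.totient : ℝ)) := by
        refine Finset.sum_le_sum fun l hl => ?_
        have hl1 := mem_Icc.mp (mem_filter.mp hl).1
        have h0 : 0 < l.totient := Nat.totient_pos.mpr hl1.1
        have h1 : (p - 1) * l.totient ≤ (p * l).totient := by
          rw [← Nat.totient_prime hp]; exact Nat.totient_super_multiplicative p l
        have h2 : ((p : ℝ) - 1) * l.totient ≤ (p * l).totient := by
          have : ((p - 1 : ℕ) : ℝ) = (p : ℝ) - 1 := by
            rw [Nat.cast_sub hp.one_lt.le]; simp
          rw [← this]; exact_mod_cast h1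
        rw [div_mul_div_comm, one_mul]
        have h3 : (0 : ℝ) < l.totient := by exact_mod_cast h0
        exact one_div_le_one_div_of_le (by positivity) h2
    _ = 1 / ((p : ℝ) - 1) * copDyadic 1 (z / p) := by rw [← Finset.mul_sum]; rfl
    _ ≤ 1 / ((p : ℝ) - 1) * 6 := by
        exact mul_le_mul_of_nonneg_left (copDyadic_one_le _) (by positivity)
    _ = _ := by ring

theorem abs_copDyadic_sub_le {D D' : ℕ} (hD : D ≠ 0) (h : D' ∣ D) (z : ℝ) :
    |copDyadic D z - copDyadic D' z| ≤
      ∑ p ∈ D.primeFactors.filter (fun p => ¬ p ∣ D'), 6 / ((p : ℝ) - 1) := by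
  have h1 := copDyadic_anti h z
  rw [abs_sub_comm, abs_of_nonneg (by linarith), sub_le_iff_le_add']
  have hsplit : copDyadic D' z = copDyadic D z +
      ∑ k ∈ (Icc 1 ⌊z⌋₊).filter (fun k : ℕ => (z < 2 * k ∧ Nat.Coprime k D') ∧ ¬ Nat.Coprime k D),
        1 / (k.totient : ℝ) := by
    unfold copDyadic
    rw [← Finset.sum_filter_add_sum_filter_not _ (fun k : ℕ => Nat.Coprime k D)]
    congr 1
    · rw [Finset.filter_filter]
      refine Finset.sum_congr ?_ fun _ _ => rfl
      ext k
      simp only [mem_filter]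
      constructor
      · rintro ⟨h1, ⟨h2, h3⟩, h4⟩; exact ⟨h1, h2, h4⟩
      · rintro ⟨h1, h2, h4⟩; exact ⟨h1, ⟨h2, h4.coprime_dvd_right h⟩, h4⟩
    · rw [Finset.filter_filter]
  rw [hsplit]
  gcongr
  calc _ ≤ ∑ p ∈ D.primeFactors.filter (fun p => ¬ p ∣ D'),
          ∑ k ∈ (Icc 1 ⌊z⌋₊).filter (fun k : ℕ => z < 2 * k ∧ p ∣ k), 1 / (k.totient : ℝ) := by
        refine sum_le_sum_sum_of_cover _ _ _ (fun _ => by positivity) fun k hk => ?_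
        simp only [mem_filter] at hk ⊢
        obtain ⟨hk1, ⟨hk2, hk3⟩, hk4⟩ := hk
        obtain ⟨p, hp, hpk, hpD⟩ := Nat.Prime.not_coprime_iff_dvd.mp hk4
        refine ⟨p, ⟨Nat.mem_primeFactors.mpr ⟨hp, hpD, hD⟩, fun hpD' => ?_⟩, hk1, hk2, hpk⟩
        exact Nat.Prime.not_coprime_iff_dvd.mpr ⟨p, hp, hpk, hpD'⟩ hk3
    _ ≤ _ := Finset.sum_le_sum fun p hp =>
        sum_inv_totient_multiples_le (Nat.prime_of_mem_primeFactors (mem_filter.mp hp).1) z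

theorem copWeight_one_le (d : ℕ) : copWeight 1 d ≤ 1 / (d.totient : ℝ) := by
  rw [copWeight_one]
  split_ifs with h
  · have h0 : d ≠ 0 := h.ne_zero
    have hd : (d : ℝ) = ∏ p ∈ d.primeFactors, (p : ℝ) := by
      rw [← Nat.cast_prod, Nat.prod_primeFactors_of_squarefree h]
    have h1 : 1 / (d.totient : ℝ) = (d / d.totient) / d := by
      have : (d : ℝ) ≠ 0 := by exact_mod_cast h0
      field_simp
    rw [h1, div_totient_eq_prod h0, hd, ← Finset.prod_div_distrib]
    refine (Finset.prod_congr rfl fun p hp => ?_).le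
    have h3 := sub_one_pos_of_mem_primeFactors hp
    have h4 : (0 : ℝ) < p := by linarith
    field_simp
    ring
  · positivity

theorem abs_copWeight_le (D : ℕ) {d : ℕ} (hd : d ≠ 0) :
    |copWeight D d| ≤ ∑ e ∈ d.divisors, if e ∣ D then 1 / ((d / e).totient : ℝ) else 0 := by
  have hnn : ∀ e ∈ d.divisors, (0 : ℝ) ≤ if e ∣ D then 1 / ((d / e).totient : ℝ) else 0 := by
    intro e _; split_ifs <;> positivity
  by_cases hs : Squarefree d
  swap
  · unfold copWeight; rw [if_neg hs, abs_zero]; exact Finset.sum_nonneg hnn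
  have hg : d.gcd D ∈ d.divisors := Nat.mem_divisors.mpr ⟨Nat.gcd_dvd_left _ _, hd⟩
  refine le_trans ?_ (Finset.single_le_sum hnn hg)
  rw [if_pos (Nat.gcd_dvd_right _ _)]
  refine le_trans ?_ (copWeight_one_le _)
  have hs' : Squarefree (d / d.gcd D) := hs.squarefree_of_dvd (Nat.div_dvd_of_dvd (Nat.gcd_dvd_left _ _))
  rw [copWeight_one, if_pos hs']
  unfold copWeight
  rw [if_pos hs, Finset.abs_prod]
  have hmul : d.gcd D * (d / d.gcd D) = d := Nat.mul_div_cancel' (Nat.gcd_dvd_left _ _)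
  have hcop : Nat.Coprime (d.gcd D) (d / d.gcd D) := by
    apply Nat.coprime_of_squarefree_mul; rw [hmul]; exact hs
  conv_lhs => rw [← hmul]
  rw [hcop.primeFactors_mul, Finset.prod_union hcop.disjoint_primeFactors]
  have h1 : ∏ p ∈ (d.gcd D).primeFactors, |if p ∣ D then (-1 : ℝ) else 1 / ((p : ℝ) - 1)| = 1 := by
    refine Finset.prod_eq_one fun p hp => ?_
    rw [if_pos ((Nat.dvd_of_mem_primeFactors hp).trans (Nat.gcd_dvd_right _ _))]; simp
  rw [h1, one_mul]
  refine (Finset.prod_congr rfl fun p hp => ?_).le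
  have h3 := sub_one_pos_of_mem_primeFactors hp
  rw [if_neg, abs_of_pos (by positivity)]
  intro hpD
  have hpp := Nat.prime_of_mem_primeFactors hp
  have h4 : p ∣ d := (Nat.dvd_of_mem_primeFactors hp).trans (Nat.div_dvd_of_dvd (Nat.gcd_dvd_left _ _))
  have h5 := Nat.dvd_gcd (Nat.dvd_gcd h4 hpD) (Nat.dvd_of_mem_primeFactors hp)
  rw [hcop] at h5
  exact hpp.one_lt.ne' (Nat.dvd_one.mp h5)

theorem sum_mul_abs_copWeight_le {D : ℕ} (hD : D ≠ 0) (Z : ℕ) {f : ℕ → ℝ} (hf : ∀ d, 0 ≤ f d) {B : ℝ}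
    (hB : ∀ e ∈ Icc 1 Z, ∑ l ∈ Icc 1 (Z / e), f (e * l) / (l.totient : ℝ) ≤ B) (hB0 : 0 ≤ B) :
    ∑ d ∈ Icc 1 Z, f d * |copWeight D d| ≤ tau D * B := by
  calc _ ≤ ∑ d ∈ Icc 1 Z, ∑ e ∈ d.divisors,
        (if e ∣ D then f (e * (d / e)) / ((d / e).totient : ℝ) else 0) := by
        refine Finset.sum_le_sum fun d hd => ?_
        have hd1 := mem_Icc.mp hd
        refine (mul_le_mul_of_nonneg_left (abs_copWeight_le D (by omega)) (hf d)).trans_eq ?_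
        rw [Finset.mul_sum]
        refine Finset.sum_congr rfl fun e he => ?_
        rw [Nat.mul_div_cancel' (Nat.dvd_of_mem_divisors he)]
        split_ifs
        · ring
        · ring
    _ = ∑ e ∈ Icc 1 Z, ∑ l ∈ Icc 1 (Z / e), (if e ∣ D then f (e * l) / (l.totient : ℝ) else 0) :=
        sum_Icc_sum_divisors Z (fun e l => if e ∣ D then f (e * l) / (l.totient : ℝ) else 0)
    _ ≤ ∑ e ∈ Icc 1 Z, if e ∣ D then B else 0 := by
        refine Finset.sum_le_sum fun e he => ?_
        split_ifs
        · exact hB e he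
        · simp
    _ = ((Icc 1 Z).filter (· ∣ D)).card * B := by
        rw [← Finset.sum_filter, Finset.sum_const, nsmul_eq_mul]
    _ ≤ tau D * B := by
        refine mul_le_mul_of_nonneg_right ?_ hB0
        unfold tau
        have : (Icc 1 Z).filter (· ∣ D) ⊆ D.divisors := by
          intro e he
          exact Nat.mem_divisors.mpr ⟨(mem_filter.mp he).2, hD⟩
        exact_mod_cast Finset.card_le_card this

theorem abs_copDyadic_sub_copDyadic_le {D : ℕ} (hD : D ≠ 0) {z z' : ℝ} (hz : 1 ≤ z) (hzz : z ≤ z') :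
    |copDyadic D z - copDyadic D z'| ≤ 36 * tau D * (1 + Real.log z) / z := by
  have hz0 : 0 < z := by linarith
  have hz0' : 0 < z' := by linarith
  have hle : ⌊z⌋₊ ≤ ⌊z'⌋₊ := Nat.floor_le_floor hzz
  have hlog : 0 ≤ Real.log z := Real.log_nonneg hz
  have hsplit : Icc 1 ⌊z'⌋₊ = Icc 1 ⌊z⌋₊ ∪ (Icc 1 ⌊z'⌋₊).filter (fun k : ℕ => z < k) := by
    ext k
    simp only [mem_union, mem_Icc, mem_filter]
    rw [← Nat.floor_lt hz0.le]
    omega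
  have hdisj : Disjoint (Icc 1 ⌊z⌋₊) ((Icc 1 ⌊z'⌋₊).filter (fun k : ℕ => z < k)) := by
    rw [Finset.disjoint_left]
    intro k hk hk'
    simp only [mem_Icc, mem_filter] at hk hk'
    rw [← Nat.floor_lt hz0.le] at hk'
    omega
  have e1 : ∑ d ∈ Icc 1 ⌊z⌋₊, 1 * |copWeight D d| ≤ tau D * (3 * (1 + Real.log z)) := by
    refine sum_mul_abs_copWeight_le hD _ (fun _ => zero_le_one) (fun e he => ?_) (by positivity)
    refine (sum_inv_totient_le _).trans ?_
    have he1 := mem_Icc.mp he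
    have h1 : 1 ≤ ⌊z⌋₊ / e := Nat.div_pos he1.2 he1.1
    have : Real.log ((⌊z⌋₊ / e : ℕ) : ℝ) ≤ Real.log z := by
      refine Real.log_le_log (by exact_mod_cast h1) ?_
      calc ((⌊z⌋₊ / e : ℕ) : ℝ) ≤ ⌊z⌋₊ := by exact_mod_cast Nat.div_le_self _ e
        _ ≤ z := Nat.floor_le hz0.le
    linarith
  have e2 : ∑ d ∈ Icc 1 ⌊z'⌋₊, (if z < (d : ℝ) then 1 / (d : ℝ) else 0) * |copWeight D d| ≤
      tau D * (6 / z) := by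
    refine sum_mul_abs_copWeight_le hD _ (f := fun d : ℕ => if z < (d : ℝ) then 1 / (d : ℝ) else 0)
      (fun d => by split_ifs <;> positivity) (fun e he => ?_) (by positivity)
    have he0 : (0 : ℝ) < e := by exact_mod_cast (mem_Icc.mp he).1
    have h1 := sum_inv_mul_totient_tail_le (⌊z'⌋₊ / e) (div_pos hz0 he0)
    calc _ = 1 / (e : ℝ) * ∑ k ∈ (Icc 1 (⌊z'⌋₊ / e)).filter (fun k : ℕ => z / e < k),
          1 / ((k : ℝ) * k.totient) := by
          rw [Finset.sum_filter, Finset.mul_sum]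
          refine Finset.sum_congr rfl fun l _ => ?_
          have : z < ((e * l : ℕ) : ℝ) ↔ z / e < l := by
            rw [div_lt_iff₀ he0]; push_cast; rw [mul_comm]
          simp only [this]
          split_ifs
          · push_cast; rw [div_mul_div_comm, div_div, one_mul, mul_assoc]
          · simp
      _ ≤ 1 / (e : ℝ) * (6 / (z / e)) := mul_le_mul_of_nonneg_left h1 (by positivity)
      _ = 6 / z := by field_simp
  rw [copDyadic_eq, copDyadic_eq, hsplit, Finset.sum_union hdisj, ← sub_sub, ← Finset.sum_sub_distrib]
  have b1 : |∑ d ∈ Icc 1 ⌊z⌋₊, (copWeight D d / d * dyadicHarmonic (z / d) -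
      copWeight D d / d * dyadicHarmonic (z' / d))| ≤ 8 / z * (tau D * (3 * (1 + Real.log z))) := by
    refine (Finset.abs_sum_le_sum_abs _ _).trans ?_
    refine le_trans ?_ (mul_le_mul_of_nonneg_left e1 (by positivity))
    rw [Finset.mul_sum]
    refine Finset.sum_le_sum fun d hd => ?_
    have hd0 : (0 : ℝ) < d := by exact_mod_cast (mem_Icc.mp hd).1
    rw [← mul_sub, abs_mul, abs_div, abs_of_pos hd0, one_mul]
    have h1 := abs_dyadicHarmonic_sub_log_two_le (div_pos hz0 hd0)
    have h2 := abs_dyadicHarmonic_sub_log_two_le (div_pos hz0' hd0)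
    have h3 : 4 / (z' / d) ≤ 4 / (z / d) := by gcongr
    have h4 : |dyadicHarmonic (z / d) - dyadicHarmonic (z' / d)| ≤ 8 * d / z := by
      have h5 : 8 * d / z = 4 / (z / d) + 4 / (z / d) := by field_simp; norm_num
      rw [h5]
      rw [abs_le] at h1 h2 ⊢
      constructor <;> linarith
    calc _ ≤ |copWeight D d| / d * (8 * d / z) := mul_le_mul_of_nonneg_left h4 (by positivity)
      _ = _ := by field_simp
  have b2 : |∑ d ∈ (Icc 1 ⌊z'⌋₊).filter (fun k : ℕ => z < k),
      copWeight D d / d * dyadicHarmonic (z' / d)| ≤ 2 * (tau D * (6 / z)) := by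
    refine (Finset.abs_sum_le_sum_abs _ _).trans ?_
    refine le_trans ?_ (mul_le_mul_of_nonneg_left e2 (by positivity))
    rw [Finset.mul_sum, Finset.sum_filter]
    refine Finset.sum_le_sum fun d hd => ?_
    have hd0 : (0 : ℝ) < d := by exact_mod_cast (mem_Icc.mp hd).1
    split_ifs
    · rw [abs_mul, abs_div, abs_of_pos hd0, abs_of_nonneg (dyadicHarmonic_nonneg _)]
      calc _ ≤ |copWeight D d| / d * 2 :=
            mul_le_mul_of_nonneg_left (dyadicHarmonic_le _) (by positivity)
        _ = _ := by ring
    · simp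
  refine (abs_sub _ _).trans ((add_le_add b1 b2).trans ?_)
  have h6 : 36 * tau D * (1 + Real.log z) / z - (8 / z * (tau D * (3 * (1 + Real.log z))) + 2 * (tau D * (6 / z)))
      = 12 * tau D * Real.log z / z := by field_simp; ring
  have h7 : 0 ≤ 12 * tau D * Real.log z / z := by positivity
  linarith

theorem sum_primeFactors_log_le {n : ℕ} (hn : n ≠ 0) :
    ∑ p ∈ n.primeFactors, Real.log p ≤ Real.log n := by
  rw [← Real.log_prod (fun p hp => by
    have := (Nat.prime_of_mem_primeFactors hp).pos; positivity), ← Nat.cast_prod]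
  refine Real.log_le_log ?_ ?_
  · exact_mod_cast Finset.prod_pos fun p hp => (Nat.prime_of_mem_primeFactors hp).pos
  · exact_mod_cast Nat.le_of_dvd (Nat.pos_of_ne_zero hn) (Nat.prod_primeFactors_dvd n)

theorem sum_log_prime_div_le (N : ℕ) :
    ∑ p ∈ (Icc 1 N).filter Nat.Prime, Real.log p / p ≤ 2 * Real.log N := by
  rcases Nat.eq_zero_or_pos N with rfl | hN
  · simp
  have hN0 : (0 : ℝ) < N := by exact_mod_cast hN
  have h1 : ∑ n ∈ Icc 1 N, ∑ d ∈ n.divisors, (if d.Prime then Real.log d else 0) ≤ N * Real.log N := by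
    calc _ ≤ ∑ n ∈ Icc 1 N, Real.log N := by
          refine Finset.sum_le_sum fun n hn => ?_
          have hn1 := mem_Icc.mp hn
          rw [← Finset.sum_filter, show n.divisors.filter Nat.Prime = n.primeFactors by
            ext p; simp only [mem_filter, Nat.mem_divisors, Nat.mem_primeFactors]; tauto]
          refine (sum_primeFactors_log_le (by omega)).trans ?_
          exact Real.log_le_log (by exact_mod_cast hn1.1) (by exact_mod_cast hn1.2)
      _ = _ := by simp
  rw [sum_Icc_sum_divisors N (fun d _ => if d.Prime then Real.log d else 0)] at h1
  have h2 : ∑ p ∈ (Icc 1 N).filter Nat.Prime, Real.log p / p * (N / 2) ≤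
      ∑ d ∈ Icc 1 N, ∑ l ∈ Icc 1 (N / d), (if d.Prime then Real.log d else 0) := by
    rw [Finset.sum_filter]
    refine Finset.sum_le_sum fun d hd => ?_
    have hd1 := mem_Icc.mp hd
    have hd0 : (0 : ℝ) < d := by exact_mod_cast hd1.1
    split_ifs with hp
    · rw [Finset.sum_const, Nat.card_Icc, nsmul_eq_mul, Nat.add_sub_cancel]
      have h3 : (N : ℝ) / 2 / d ≤ (N / d : ℕ) := by
        rw [div_le_iff₀ hd0, div_le_iff₀ two_pos]
        have h4 : 1 ≤ N / d := Nat.div_pos hd1.2 hd1.1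
        have h5 := Nat.div_add_mod N d
        have h6 := Nat.mod_lt N hd1.1
        have h7 : d * 1 ≤ d * (N / d) := Nat.mul_le_mul_left d h4
        have h8 : N ≤ N / d * d * 2 := by nlinarith
        exact_mod_cast h8
      have hl : 0 ≤ Real.log d := Real.log_natCast_nonneg d
      calc Real.log d / d * (N / 2) = N / 2 / d * Real.log d := by ring
        _ ≤ _ := mul_le_mul_of_nonneg_right h3 hl
    · simp
  rw [← Finset.sum_mul] at h2
  have h3 := h2.trans h1
  have : (∑ p ∈ (Icc 1 N).filter Nat.Prime, Real.log p / p) * N ≤ 2 * Real.log N * N := by linarith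
  exact le_of_mul_le_mul_right this hN0

/-- The completely multiplicative function `n ↦ n ^ (-s)` for `s ≠ 0`. -/
noncomputable def rpowNegHom (s : ℝ) : ℕ →* ℝ where
  toFun n := (n : ℝ) ^ (-s)
  map_one' := by simp
  map_mul' m n := by push_cast; exact Real.mul_rpow (by positivity) (by positivity)

theorem sum_rpow_neg_one_sub_le {δ : ℝ} (hδ : 0 < δ) (N : ℕ) :
    ∑ n ∈ range N, ((n : ℝ) ^ (-(1 + δ))) ≤ 1 + 1 / δ := by
  have key : ∀ N : ℕ, ∑ n ∈ range (N + 2), ((n : ℝ) ^ (-(1 + δ))) ≤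
      1 + (1 - ((N + 1 : ℕ) : ℝ) ^ (-δ)) / δ := by
    intro N
    induction N with
    | zero =>
      simp [Finset.sum_range_succ]
      rw [Real.zero_rpow (by linarith)]
    | succ N ih =>
      rw [Finset.sum_range_succ]
      have hM : (0 : ℝ) < ((N + 1 : ℕ) : ℝ) := by positivity
      have hM2 : (0 : ℝ) < ((N + 2 : ℕ) : ℝ) := by positivity
      have h1 : ((N + 2 : ℕ) : ℝ) ^ (-δ) * (1 + δ / ((N + 2 : ℕ) : ℝ)) ≤ ((N + 1 : ℕ) : ℝ) ^ (-δ) := by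
        have h2 : ((N + 1 : ℕ) : ℝ) = ((N + 2 : ℕ) : ℝ) * (1 - 1 / ((N + 2 : ℕ) : ℝ)) := by
          field_simp; push_cast; ring
        have h3 : 0 < 1 - 1 / ((N + 2 : ℕ) : ℝ) := by
          rw [sub_pos, div_lt_one hM2]; push_cast; linarith [(Nat.cast_nonneg N : (0 : ℝ) ≤ N)]
        rw [h2, Real.mul_rpow hM2.le h3.le]
        refine mul_le_mul_of_nonneg_left ?_ (by positivity)
        rw [Real.rpow_def_of_pos h3]
        have h4 := Real.log_le_sub_one_of_pos h3
        have h5 := Real.add_one_le_exp (Real.log (1 - 1 / ((N + 2 : ℕ) : ℝ)) * -δ)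
        have h6 : Real.log (1 - 1 / ((N + 2 : ℕ) : ℝ)) * δ ≤ (- (1 / ((N + 2 : ℕ) : ℝ))) * δ := by
          refine mul_le_mul_of_nonneg_right ?_ hδ.le
          linarith
        have h7 : δ / ((N + 2 : ℕ) : ℝ) = 1 / ((N + 2 : ℕ) : ℝ) * δ := by ring
        linarith
      have h8 : ((N + 2 : ℕ) : ℝ) ^ (-(1 + δ)) = ((N + 2 : ℕ) : ℝ) ^ (-δ) / ((N + 2 : ℕ) : ℝ) := by
        rw [neg_add, Real.rpow_add hM2, Real.rpow_neg_one]; ring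
      have h9 : ((N + 2 : ℕ) : ℝ) ^ (-(1 + δ)) ≤
          (((N + 1 : ℕ) : ℝ) ^ (-δ) - ((N + 2 : ℕ) : ℝ) ^ (-δ)) / δ := by
        rw [h8, le_div_iff₀ hδ]
        have h10 : ((N + 2 : ℕ) : ℝ) ^ (-δ) * (1 + δ / ((N + 2 : ℕ) : ℝ)) =
          ((N + 2 : ℕ) : ℝ) ^ (-δ) + ((N + 2 : ℕ) : ℝ) ^ (-δ) / ((N + 2 : ℕ) : ℝ) * δ := by ring
        linarith
      calc _ ≤ 1 + (1 - ((N + 1 : ℕ) : ℝ) ^ (-δ)) / δ +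
            (((N + 1 : ℕ) : ℝ) ^ (-δ) - ((N + 2 : ℕ) : ℝ) ^ (-δ)) / δ := add_le_add ih h9
        _ = _ := by rw [add_assoc, ← add_div]; congr 2; ring_nf
  calc _ ≤ ∑ n ∈ range (N + 2), ((n : ℝ) ^ (-(1 + δ))) :=
        Finset.sum_le_sum_of_subset_of_nonneg (Finset.range_mono (by omega))
          (fun _ _ _ => by positivity)
    _ ≤ _ := key N
    _ ≤ _ := by
        gcongr
        have : 0 ≤ ((N + 1 : ℕ) : ℝ) ^ (-δ) := by positivity
        linarith

theorem prod_one_sub_rpow_inv_le {δ : ℝ} (hδ : 0 < δ) (N : ℕ) :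
    ∏ p ∈ N.primesBelow, (1 - (p : ℝ) ^ (-(1 + δ)))⁻¹ ≤ 1 + 1 / δ := by
  have hs : Summable (rpowNegHom (1 + δ)) := Real.summable_nat_rpow.mpr (by linarith)
  have h := EulerProduct.prod_primesBelow_geometric_eq_tsum_smoothNumbers hs N
  change ∏ p ∈ N.primesBelow, (1 - (rpowNegHom (1 + δ)) p)⁻¹ ≤ _
  rw [h]
  calc _ ≤ ∑' n, rpowNegHom (1 + δ) n :=
        Summable.tsum_subtype_le _ _ (fun n => Real.rpow_nonneg (Nat.cast_nonneg n) _) hs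
    _ ≤ _ := by
      refine Real.tsum_le_of_sum_range_le (fun n => Real.rpow_nonneg (Nat.cast_nonneg n) _) ?_
      exact sum_rpow_neg_one_sub_le hδ

theorem exp_sub_exp_neg_le {u : ℝ} (h0 : 0 ≤ u) (h1 : u ≤ 1) :
    Real.exp u - Real.exp (-u) ≤ 3 * u := by
  have h3 : Real.exp u ≤ (1 - u) * 1 + u * Real.exp 1 := by
    have := convexOn_exp.2 (Set.mem_univ 0) (Set.mem_univ 1) (sub_nonneg.mpr h1) h0 (by ring)
    simpa using this
  have h4 := Real.add_one_le_exp (-u)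
  have h5 := Real.exp_one_lt_d9
  nlinarith

theorem rpow_neg_le_of_two_le {s p : ℝ} (hs : 0.08 ≤ s) (hp : 2 ≤ p) : p ^ (-s) ≤ 0.96 := by
  have h1 : Real.exp (-0.05) ≤ 0.96 := by
    have := Real.add_one_le_exp (0.05 : ℝ)
    rw [Real.exp_neg, inv_le_comm₀ (Real.exp_pos _) (by norm_num)]
    refine le_trans ?_ this
    norm_num
  refine le_trans ?_ h1
  rw [Real.rpow_def_of_pos (by linarith)]
  refine Real.exp_le_exp.mpr ?_
  have h2 : Real.log 2 ≤ Real.log p := Real.log_le_log (by norm_num) hp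
  have h3 := Real.log_two_gt_d9
  nlinarith

theorem one_div_log_three_lt : 1 / Real.log 3 < 0.92 := by
  have h : Real.exp 1.09 < 3 := by
    have h1 := Real.exp_one_lt_d9
    have h2 : Real.exp 0.09 ≤ 1 / (1 - 0.09) :=
      Real.exp_bound_div_one_sub_of_interval (by norm_num) (by norm_num)
    have h3 : Real.exp 1.09 = Real.exp 1 * Real.exp 0.09 := by rw [← Real.exp_add]; norm_num
    rw [h3]
    have h4 := Real.exp_pos 0.09
    calc Real.exp 1 * Real.exp 0.09 ≤ (2.7182818286 : ℝ) * (1 / (1 - 0.09)) :=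
          mul_le_mul h1.le h2 h4.le (by norm_num)
      _ < 3 := by norm_num
  have h' : 1.09 < Real.log 3 := (Real.lt_log_iff_exp_lt (by norm_num)).mpr h
  rw [div_lt_iff₀ (by linarith)]
  linarith

theorem prod_one_sub_rpow_inv_le_log {P : ℝ} (hP : 3 ≤ P) :
    ∏ p ∈ (⌊P⌋₊ + 1).primesBelow, (1 - (p : ℝ) ^ (-(1 - 1 / Real.log P)))⁻¹ ≤
      Real.exp 150 * (1 + Real.log P) := by
  set δ := 1 / Real.log P with hδdef
  have hlog3 : Real.log 3 ≤ Real.log P := Real.log_le_log (by norm_num) hP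
  have hl3 : 0 < Real.log 3 := Real.log_pos (by norm_num)
  have hlP : 0 < Real.log P := by linarith
  have hδ : 0 < δ := by positivity
  have hδ1 : δ < 0.92 := (one_div_le_one_div_of_le hl3 hlog3).trans_lt one_div_log_three_lt
  have hfac : ∀ p ∈ (⌊P⌋₊ + 1).primesBelow, (1 - (p : ℝ) ^ (-(1 - δ)))⁻¹ ≤
      (1 - (p : ℝ) ^ (-(1 + δ)))⁻¹ * Real.exp (75 * δ * (Real.log p / p)) := by
    intro p hp
    have hpp := Nat.prime_of_mem_primesBelow hp
    have hp2 : (2 : ℝ) ≤ p := by exact_mod_cast hpp.two_le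
    have hp0 : (0 : ℝ) < p := by linarith
    have hpP : (p : ℝ) ≤ P := by
      have := Nat.lt_of_mem_primesBelow hp
      exact (Nat.le_floor_iff (by linarith)).mp (by omega)
    have h1 : (p : ℝ) ^ (-(1 - δ)) ≤ 0.96 := rpow_neg_le_of_two_le (by linarith) hp2
    have h2 : (p : ℝ) ^ (-(1 + δ)) ≤ 0.96 := rpow_neg_le_of_two_le (by linarith) hp2
    set t := (p : ℝ) ^ (-(1 - δ))
    set t' := (p : ℝ) ^ (-(1 + δ))
    have hlp : 0 ≤ Real.log p := Real.log_nonneg (by linarith)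
    have hu : δ * Real.log p ≤ 1 := by
      rw [hδdef, one_div_mul_eq_div, div_le_one hlP]; exact Real.log_le_log hp0 hpP
    have h3 : t - t' ≤ 3 * (δ * Real.log p) / p := by
      have e1 : t = Real.exp (δ * Real.log p) / p := by
        simp only [t]
        rw [show -(1 - δ) = δ + -1 by ring, Real.rpow_add hp0, Real.rpow_neg_one,
          Real.rpow_def_of_pos hp0, mul_comm δ]; rfl
      have e2 : t' = Real.exp (-(δ * Real.log p)) / p := by
        simp only [t']
        rw [show -(1 + δ) = -δ + -1 by ring, Real.rpow_add hp0, Real.rpow_neg_one,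
          Real.rpow_def_of_pos hp0, mul_neg, mul_comm δ]; rfl
      rw [e1, e2, ← sub_div]
      gcongr
      exact exp_sub_exp_neg_le (by positivity) hu
    have h4 : 1 - t' ≤ (1 - t) * Real.exp (75 * δ * (Real.log p / p)) := by
      have h5 := Real.add_one_le_exp (75 * δ * (Real.log p / p))
      have h6 : 3 * (δ * Real.log p) / p = 0.04 * (75 * δ * (Real.log p / p)) := by ring
      have h7 : 0 ≤ 75 * δ * (Real.log p / p) := by positivity
      nlinarith
    rw [inv_eq_one_div, inv_mul_eq_div, div_le_div_iff₀ (by linarith) (by linarith)]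
    linarith
  calc _ ≤ ∏ p ∈ (⌊P⌋₊ + 1).primesBelow, ((1 - (p : ℝ) ^ (-(1 + δ)))⁻¹ *
          Real.exp (75 * δ * (Real.log p / p))) := by
        refine Finset.prod_le_prod (fun p hp => ?_) hfac
        have hpp := Nat.prime_of_mem_primesBelow hp
        have hp2 : (2 : ℝ) ≤ p := by exact_mod_cast hpp.two_le
        have h1 : (p : ℝ) ^ (-(1 - δ)) ≤ 0.96 := rpow_neg_le_of_two_le (by linarith) hp2
        exact inv_nonneg.mpr (by linarith)
    _ = (∏ p ∈ (⌊P⌋₊ + 1).primesBelow, (1 - (p : ℝ) ^ (-(1 + δ)))⁻¹) *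
          Real.exp (75 * δ * ∑ p ∈ (⌊P⌋₊ + 1).primesBelow, (Real.log p / p)) := by
        rw [Finset.prod_mul_distrib, ← Real.exp_sum, Finset.mul_sum]
    _ ≤ (1 + 1 / δ) * Real.exp 150 := by
        have hN1 : 1 ≤ ⌊P⌋₊ := Nat.le_floor (by push_cast; linarith)
        have h1 : ∑ p ∈ (⌊P⌋₊ + 1).primesBelow, (Real.log p / p) ≤ 2 * Real.log P := by
          calc _ = ∑ p ∈ (Icc 1 ⌊P⌋₊).filter Nat.Prime, Real.log p / p := by
                refine Finset.sum_congr ?_ fun _ _ => rfl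
                ext p
                simp only [Nat.mem_primesBelow, mem_filter, mem_Icc]
                constructor
                · rintro ⟨h1, h2⟩; exact ⟨⟨h2.pos, by omega⟩, h2⟩
                · rintro ⟨h1, h2⟩; exact ⟨by omega, h2⟩
            _ ≤ _ := sum_log_prime_div_le _
            _ ≤ _ := by
                gcongr
                exact Nat.floor_le (by linarith)
        refine mul_le_mul (prod_one_sub_rpow_inv_le hδ _) ?_ (Real.exp_pos _).le (by positivity)
        refine Real.exp_le_exp.mpr ?_
        calc _ ≤ 75 * δ * (2 * Real.log P) := by gcongr
          _ = 150 := by rw [hδdef]; field_simp; norm_num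
    _ = _ := by rw [hδdef, one_div_one_div]; ring

/-- `d` is a positive integer all of whose prime factors are at most `P`. -/
def IsSmooth (P : ℝ) (d : ℕ) : Prop := d ≠ 0 ∧ ∀ p ∈ d.primeFactors, (p : ℝ) ≤ P

theorem IsSmooth.mem_smoothNumbers {P : ℝ} (hP : 0 ≤ P) {d : ℕ} (h : IsSmooth P d) :
    d ∈ (⌊P⌋₊ + 1).smoothNumbers := by
  rw [Nat.mem_smoothNumbers']
  intro p hp hpd
  exact Nat.lt_succ_of_le ((Nat.le_floor_iff hP).mpr (h.2 p (Nat.mem_primeFactors.mpr ⟨hp, hpd, h.1⟩)))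

theorem sum_smooth_rpow_le {P : ℝ} (hP : 3 ≤ P) (s : Finset ℕ) (hs : ∀ d ∈ s, IsSmooth P d) :
    ∑ d ∈ s, (d : ℝ) ^ (-(1 - 1 / Real.log P)) ≤ Real.exp 150 * (1 + Real.log P) := by
  have hlog3 : Real.log 3 ≤ Real.log P := Real.log_le_log (by norm_num) hP
  have hl3 : 0 < Real.log 3 := Real.log_pos (by norm_num)
  have hδ1 : 1 / Real.log P < 0.92 :=
    (one_div_le_one_div_of_le hl3 hlog3).trans_lt one_div_log_three_lt
  refine le_trans ?_ (prod_one_sub_rpow_inv_le_log hP)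
  have h := EulerProduct.summable_and_hasSum_smoothNumbers_prod_primesBelow_geometric
    (f := rpowNegHom (1 - 1 / Real.log P)) (fun {p} hp => by
      have hp2 : (2 : ℝ) ≤ p := by exact_mod_cast hp.two_le
      have h1 := rpow_neg_le_of_two_le (s := 1 - 1 / Real.log P) (by linarith) hp2
      change ‖(p : ℝ) ^ (-(1 - 1 / Real.log P))‖ < 1
      rw [Real.norm_of_nonneg (by positivity)]; linarith) (⌊P⌋₊ + 1)
  have h2 : ∑ d ∈ s, (d : ℝ) ^ (-(1 - 1 / Real.log P)) =
      ∑ m ∈ s.subtype (· ∈ (⌊P⌋₊ + 1).smoothNumbers), rpowNegHom (1 - 1 / Real.log P) m := by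
    rw [Finset.sum_subtype_of_mem (f := fun m => rpowNegHom (1 - 1 / Real.log P) m)]
    · rfl
    · intro d hd; exact (hs d hd).mem_smoothNumbers (by linarith)
  rw [h2]
  exact sum_le_hasSum _ (fun m _ => Real.rpow_nonneg (Nat.cast_nonneg _) _) h.2

/-- An absolute constant bounding normalized sums over smooth numbers. -/
noncomputable def smoothConst : ℝ := 2 * Real.exp 150

theorem one_le_smoothConst : 1 ≤ smoothConst := by
  have := Real.add_one_le_exp (150 : ℝ)
  unfold smoothConst
  linarith

theorem one_lt_log_of_three_le {P : ℝ} (hP : 3 ≤ P) : 1 < Real.log P := by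
  rw [Real.lt_log_iff_exp_lt (by linarith)]
  have := Real.exp_one_lt_d9
  linarith

theorem sum_smooth_rpow_le_log {P : ℝ} (hP : 3 ≤ P) (s : Finset ℕ) (hs : ∀ d ∈ s, IsSmooth P d) :
    ∑ d ∈ s, (d : ℝ) ^ (-(1 - 1 / Real.log P)) ≤ smoothConst * Real.log P := by
  refine (sum_smooth_rpow_le hP s hs).trans ?_
  have h1 := one_lt_log_of_three_le hP
  have h2 := Real.exp_pos 150
  unfold smoothConst
  nlinarith

theorem inv_le_rpow {P : ℝ} (hP : 3 ≤ P) {d : ℕ} (hd : 1 ≤ d) :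
    1 / (d : ℝ) ≤ (d : ℝ) ^ (-(1 - 1 / Real.log P)) := by
  have h1 := one_lt_log_of_three_le hP
  have hd1 : (1 : ℝ) ≤ d := by exact_mod_cast hd
  rw [one_div, ← Real.rpow_neg_one]
  refine Real.rpow_le_rpow_of_exponent_le hd1 ?_
  have : 0 < 1 / Real.log P := by positivity
  linarith

theorem sum_smooth_inv_le {P : ℝ} (hP : 3 ≤ P) (s : Finset ℕ) (hs : ∀ d ∈ s, IsSmooth P d) :
    ∑ d ∈ s, 1 / (d : ℝ) ≤ smoothConst * Real.log P :=
  (Finset.sum_le_sum fun d hd => inv_le_rpow hP (Nat.pos_of_ne_zero (hs d hd).1)).trans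
    (sum_smooth_rpow_le_log hP s hs)

theorem IsSmooth.of_dvd {P : ℝ} {d e : ℕ} (h : IsSmooth P d) (hed : e ∣ d) : IsSmooth P e :=
  ⟨ne_zero_of_dvd_ne_zero h.1 hed, fun p hp => h.2 p (Nat.primeFactors_mono hed h.1 hp)⟩

theorem IsSmooth.mul {P : ℝ} {d e : ℕ} (h : IsSmooth P d) (h' : IsSmooth P e) :
    IsSmooth P (d * e) := by
  refine ⟨mul_ne_zero h.1 h'.1, fun p hp => ?_⟩
  rw [Nat.primeFactors_mul h.1 h'.1, mem_union] at hp
  exact hp.elim (h.2 p) (h'.2 p)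

theorem sum_smooth_tau_mul_rpow_le {P : ℝ} (hP : 3 ≤ P) (Y : ℕ) :
    ∑ d ∈ (Icc 1 Y).filter (IsSmooth P), (tau d : ℝ) * (d : ℝ) ^ (-(1 - 1 / Real.log P)) ≤
      (smoothConst * Real.log P) ^ 2 := by
  set s := -(1 - 1 / Real.log P)
  have hlog := one_lt_log_of_three_le hP
  set g : ℕ → ℝ := fun d => if IsSmooth P d then (d : ℝ) ^ s else 0 with hg
  have hg0 : ∀ d, 0 ≤ g d := fun d => by simp only [hg]; split_ifs <;> positivity
  have hZ : ∀ Y : ℕ, ∑ d ∈ Icc 1 Y, g d ≤ smoothConst * Real.log P := by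
    intro Y
    simp only [hg]
    rw [← Finset.sum_filter]
    exact sum_smooth_rpow_le_log hP _ fun d hd => (mem_filter.mp hd).2
  have hC : 0 ≤ smoothConst * Real.log P := by
    have := one_le_smoothConst; positivity
  calc _ ≤ ∑ d ∈ Icc 1 Y, ∑ e ∈ d.divisors, g e * g (d / e) := by
        rw [Finset.sum_filter]
        refine Finset.sum_le_sum fun d hd => ?_
        split_ifs with hsm
        · unfold tau
          rw [Finset.card_eq_sum_ones, Nat.cast_sum, Finset.sum_mul]
          refine Finset.sum_le_sum fun e he => ?_
          have hed := Nat.dvd_of_mem_divisors he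
          have h1 := hsm.of_dvd hed
          have h2 := hsm.of_dvd (Nat.div_dvd_of_dvd hed)
          simp only [hg, if_pos h1, if_pos h2]
          rw [← Real.mul_rpow (by positivity) (by positivity), ← Nat.cast_mul,
            Nat.mul_div_cancel' hed]
          simp
        · exact Finset.sum_nonneg fun e _ => mul_nonneg (hg0 _) (hg0 _)
    _ = ∑ e ∈ Icc 1 Y, ∑ l ∈ Icc 1 (Y / e), g e * g l := sum_Icc_sum_divisors Y (fun e l => g e * g l)
    _ ≤ ∑ e ∈ Icc 1 Y, g e * (smoothConst * Real.log P) := by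
        refine Finset.sum_le_sum fun e _ => ?_
        rw [← Finset.mul_sum]
        exact mul_le_mul_of_nonneg_left (hZ _) (hg0 _)
    _ ≤ (smoothConst * Real.log P) * (smoothConst * Real.log P) := by
        rw [← Finset.sum_mul]
        exact mul_le_mul_of_nonneg_right (hZ _) hC
    _ = _ := by ring

theorem sum_smooth_tau_div_le {P : ℝ} (hP : 3 ≤ P) (Y : ℕ) :
    ∑ d ∈ (Icc 1 Y).filter (IsSmooth P), (tau d : ℝ) / d ≤ (smoothConst * Real.log P) ^ 2 := by
  refine le_trans (Finset.sum_le_sum fun d hd => ?_) (sum_smooth_tau_mul_rpow_le hP Y)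
  rw [div_eq_mul_one_div]
  exact mul_le_mul_of_nonneg_left (inv_le_rpow hP (mem_Icc.mp (mem_filter.mp hd).1).1) (by positivity)

theorem sum_smooth_tau_div_tail_le {P R : ℝ} (hP : 3 ≤ P) (hR : 0 < R) (Y : ℕ) :
    ∑ d ∈ (Icc 1 Y).filter (fun d : ℕ => IsSmooth P d ∧ R < d), (tau d : ℝ) / d ≤
      (smoothConst * Real.log P) ^ 2 / R ^ (1 / Real.log P) := by
  have hlog := one_lt_log_of_three_le hP
  have hRp : 0 < R ^ (1 / Real.log P) := by positivity
  rw [le_div_iff₀ hRp]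
  refine le_trans ?_ (sum_smooth_tau_mul_rpow_le hP Y)
  rw [Finset.sum_mul]
  refine le_trans (Finset.sum_le_sum (g := fun d : ℕ => (tau d : ℝ) * (d : ℝ) ^ (-(1 - 1 / Real.log P)))
    fun d hd => ?_) (Finset.sum_le_sum_of_subset_of_nonneg ?_ fun _ _ _ => by positivity)
  · simp only [mem_filter, mem_Icc] at hd
    have hd0 : (0 : ℝ) < d := by exact_mod_cast hd.1.1
    rw [neg_sub, sub_eq_add_neg, Real.rpow_add hd0, Real.rpow_neg_one, div_mul_eq_mul_div,
      div_eq_mul_inv, mul_assoc]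
    have : R ^ (1 / Real.log P) ≤ (d : ℝ) ^ (1 / Real.log P) :=
      Real.rpow_le_rpow hR.le hd.2.2.le (by positivity)
    gcongr
  · intro d hd
    simp only [mem_filter] at hd ⊢
    exact ⟨hd.1, hd.2.1⟩

theorem sum_tau_le (M : ℕ) : ∑ n ∈ Icc 1 M, (tau n : ℝ) ≤ M * (1 + Real.log M) := by
  calc _ = ∑ n ∈ Icc 1 M, ∑ d ∈ n.divisors, (1 : ℝ) := by
        refine Finset.sum_congr rfl fun n _ => ?_
        simp [tau]
    _ = ∑ d ∈ Icc 1 M, ∑ l ∈ Icc 1 (M / d), (1 : ℝ) := sum_Icc_sum_divisors M (fun _ _ => (1 : ℝ))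
    _ ≤ ∑ d ∈ Icc 1 M, M * (1 / (d : ℝ)) := by
        refine Finset.sum_le_sum fun d _ => ?_
        simp only [sum_const, Nat.card_Icc, nsmul_eq_mul, mul_one, Nat.add_sub_cancel]
        rw [mul_one_div]
        exact Nat.cast_div_le
    _ ≤ _ := by
        rw [← Finset.mul_sum]
        exact mul_le_mul_of_nonneg_left (sum_Icc_inv_le M) (by positivity)

theorem factorization_smoothPart (y : ℝ) (n : ℕ) :
    (smoothPart y n).factorization = n.factorization.filter (fun p : ℕ => (p : ℝ) ≤ y) := by
  have h : smoothPart y n =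
      (n.factorization.filter (fun p : ℕ => (p : ℝ) ≤ y)).prod (fun p k => p ^ k) := by
    rw [Finsupp.prod, Finsupp.support_filter]
    unfold smoothPart
    rw [Nat.support_factorization]
    refine Finset.prod_congr rfl fun p hp => ?_
    rw [Finsupp.filter_apply, if_pos (mem_filter.mp hp).2]
  rw [h]
  refine Nat.prod_pow_factorization_eq_self fun p hp => ?_
  rw [Finsupp.support_filter, mem_filter, Nat.support_factorization] at hp
  exact Nat.prime_of_mem_primeFactors hp.1

theorem smoothPart_ne_zero (y : ℝ) (n : ℕ) : smoothPart y n ≠ 0 :=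
  Finset.prod_ne_zero_iff.mpr fun _ hp =>
    pow_ne_zero _ (Nat.prime_of_mem_primeFactors (mem_filter.mp hp).1).ne_zero

theorem smoothPart_dvd (y : ℝ) {n : ℕ} (hn : n ≠ 0) : smoothPart y n ∣ n := by
  rw [← Nat.factorization_le_iff_dvd (smoothPart_ne_zero y n) hn, factorization_smoothPart]
  intro p
  rw [Finsupp.filter_apply]
  split_ifs <;> simp

theorem isSmooth_smoothPart (y : ℝ) (n : ℕ) : IsSmooth y (smoothPart y n) := by
  refine ⟨smoothPart_ne_zero y n, fun p hp => ?_⟩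
  rw [← Nat.support_factorization, factorization_smoothPart, Finsupp.support_filter, mem_filter] at hp
  exact hp.2

theorem dvd_smoothPart {y : ℝ} {n d : ℕ} (hn : n ≠ 0) (hd : IsSmooth y d) (h : d ∣ n) :
    d ∣ smoothPart y n := by
  rw [← Nat.factorization_le_iff_dvd hd.1 (smoothPart_ne_zero y n), factorization_smoothPart]
  intro p
  rw [Finsupp.filter_apply]
  split_ifs with hp
  · exact (Nat.factorization_le_iff_dvd hd.1 hn).mpr h p
  · rw [Nat.le_zero, ← Finsupp.notMem_support_iff, Nat.support_factorization]
    exact fun hpd => hp (hd.2 p hpd)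

/-- All prime factors of `n` exceed `P`. -/
def IsRough (P : ℝ) (n : ℕ) : Prop := ∀ p ∈ n.primeFactors, P < (p : ℝ)

theorem isRough_div_smoothPart (P : ℝ) {n : ℕ} (hn : n ≠ 0) : IsRough P (n / smoothPart P n) := by
  intro p hp
  by_contra hle
  have hpp := Nat.prime_of_mem_primeFactors hp
  have h1 : smoothPart P n * p ∣ n := by
    obtain ⟨k, hk⟩ := Nat.dvd_of_mem_primeFactors hp
    refine ⟨k, ?_⟩
    rw [mul_assoc, ← hk, Nat.mul_div_cancel' (smoothPart_dvd P hn)]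
  have hps : IsSmooth P p := ⟨hpp.ne_zero, fun q hq => by
    rw [hpp.primeFactors, mem_singleton] at hq; rw [hq]; exact not_lt.mp hle⟩
  have h2 := dvd_smoothPart hn ((isSmooth_smoothPart P n).mul hps) h1
  have h3 := Nat.le_of_dvd (Nat.pos_of_ne_zero (smoothPart_ne_zero P n)) h2
  have h4 := hpp.two_le
  have h5 := Nat.pos_of_ne_zero (smoothPart_ne_zero P n)
  nlinarith

theorem smoothPart_mul_of_isRough {P : ℝ} {d s : ℕ} (hd : IsSmooth P d) (hs : IsRough P s)
    (hs0 : s ≠ 0) : smoothPart P (d * s) = d := by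
  refine Nat.eq_of_factorization_eq (smoothPart_ne_zero _ _) hd.1 fun p => ?_
  rw [factorization_smoothPart, Finsupp.filter_apply, Nat.factorization_mul hd.1 hs0]
  split_ifs with hp
  · have : s.factorization p = 0 := by
      rw [← Finsupp.notMem_support_iff, Nat.support_factorization]
      exact fun h => absurd (hs p h) (not_lt.mpr hp)
    simp [this]
  · symm
    rw [← Finsupp.notMem_support_iff, Nat.support_factorization]
    exact fun hpd => hp (hd.2 p hpd)

theorem exists_smooth_dvd_of_lt {P R : ℝ} (hR : 1 ≤ R) {n : ℕ}
    (h : R < smoothPart P n) :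
    ∃ d, IsSmooth P d ∧ d ∣ smoothPart P n ∧ R < d ∧ (d : ℝ) ≤ R * P := by
  have hex : ∃ d, d ∣ smoothPart P n ∧ R < (d : ℝ) := ⟨_, dvd_rfl, h⟩
  obtain ⟨hd1, hd2⟩ := Nat.find_spec hex
  set d := Nat.find hex
  have hsm := (isSmooth_smoothPart P n).of_dvd hd1
  refine ⟨d, hsm, hd1, hd2, ?_⟩
  have hd1' : d ≠ 1 := by
    intro h1; rw [h1] at hd2; norm_num at hd2; linarith
  obtain ⟨p, hp, hpd⟩ := Nat.exists_prime_and_dvd hd1'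
  have hmin := Nat.find_min hex (m := d / p) (Nat.div_lt_self (Nat.pos_of_ne_zero hsm.1) hp.one_lt)
  have h2 : ((d / p : ℕ) : ℝ) ≤ R := by
    by_contra hc
    exact hmin ⟨(Nat.div_dvd_of_dvd hpd).trans hd1, not_le.mp hc⟩
  have hpP := hsm.2 p (Nat.mem_primeFactors.mpr ⟨hp, hpd, hsm.1⟩)
  calc (d : ℝ) = ((d / p : ℕ) : ℝ) * p := by
        rw [← Nat.cast_mul, Nat.div_mul_cancel hpd]
    _ ≤ R * P := by gcongr

theorem tau3_eq_sum {n : ℕ} (hn : n ≠ 0) : tau3 n = ∑ h ∈ n.divisors, tau (n / h) := by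
  unfold tau3
  have h1 : Nat.card {t : ℕ × ℕ × ℕ // t.1 * t.2.1 * t.2.2 = n} =
      ((n.divisors ×ˢ n.divisors ×ˢ n.divisors).filter
        (fun t : ℕ × ℕ × ℕ => t.1 * t.2.1 * t.2.2 = n)).card := by
    refine Nat.subtype_card _ fun t => ?_
    simp only [mem_filter, mem_product, Nat.mem_divisors]
    constructor
    · exact fun h => h.2
    · rintro rfl
      refine ⟨⟨⟨⟨t.2.1 * t.2.2, by ring⟩, hn⟩, ⟨⟨t.1 * t.2.2, by ring⟩, hn⟩,
        ⟨⟨t.1 * t.2.1, by ring⟩, hn⟩⟩, rfl⟩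
  rw [h1, Finset.card_eq_sum_card_fiberwise (f := fun t => t.1) (t := n.divisors)]
  · refine Finset.sum_congr rfl fun h hh => ?_
    obtain ⟨k, rfl⟩ := Nat.dvd_of_mem_divisors hh
    have hh0 : 0 < h := Nat.pos_of_mem_divisors hh
    have hk0 : k ≠ 0 := fun hk => hn (by simp [hk])
    unfold tau
    rw [Nat.mul_div_cancel_left _ hh0]
    refine Finset.card_bij (fun t _ => t.2.1) ?_ ?_ ?_
    · intro t ht
      simp only [mem_filter] at ht
      obtain ⟨⟨_, h2⟩, h3⟩ := ht
      rw [h3, mul_assoc] at h2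
      exact Nat.mem_divisors.mpr ⟨⟨_, (Nat.eq_of_mul_eq_mul_left hh0 h2).symm⟩, hk0⟩
    · rintro ⟨a, b, c⟩ ht ⟨a', b', c'⟩ ht' heq
      simp only [mem_filter] at ht ht' heq
      obtain ⟨⟨_, h2⟩, h3⟩ := ht
      obtain ⟨⟨_, h2'⟩, h3'⟩ := ht'
      subst heq
      subst h3
      subst h3'
      have h5 : a' * b ≠ 0 := by
        intro h0
        rw [h0, zero_mul] at h2
        exact hn h2.symm
      have := Nat.eq_of_mul_eq_mul_left (Nat.pos_of_ne_zero h5) (h2.trans h2'.symm)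
      rw [this]
    · intro b hb
      obtain ⟨c, rfl⟩ := Nat.dvd_of_mem_divisors hb
      refine ⟨(h, b, c), ?_, rfl⟩
      simp only [mem_filter, mem_product, Nat.mem_divisors, and_true]
      refine ⟨⟨⟨Dvd.intro _ rfl, hn⟩, ⟨⟨h * c, by ring⟩, hn⟩, ⟨⟨h * b, by ring⟩, hn⟩⟩, by ring⟩
  · intro t ht
    exact (mem_product.mp (mem_filter.mp ht).1).1

theorem tau_le_tau3 {n : ℕ} (hn : n ≠ 0) : tau n ≤ tau3 n := by
  rw [tau3_eq_sum hn]
  refine le_trans ?_ (Finset.single_le_sum (f := fun h => tau (n / h)) (fun _ _ => Nat.zero_le _)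
    (Nat.one_mem_divisors.mpr hn))
  simp

theorem one_le_tau3P (y : ℝ) (n : ℕ) : 1 ≤ tau3P y n :=
  (tau_pos (smoothPart_ne_zero y n)).trans (tau_le_tau3 (smoothPart_ne_zero y n))

theorem sum_tau_smoothPart_le_tau3 (P : ℝ) {n : ℕ} (hn : n ≠ 0) (s : Finset ℕ) (hs : s ⊆ n.divisors) :
    ∑ h ∈ s, tau (smoothPart P (n / h)) ≤ tau3 n := by
  rw [tau3_eq_sum hn]
  refine (Finset.sum_le_sum_of_subset hs).trans (Finset.sum_le_sum fun h hh => ?_)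
  have : n / h ≠ 0 := (Nat.div_pos (Nat.divisor_le hh) (Nat.pos_of_mem_divisors hh)).ne'
  exact tau_le_of_dvd this (smoothPart_dvd P this)

theorem isSmooth_of_le {y : ℝ} {h : ℕ} (h0 : h ≠ 0) (hy : (h : ℝ) ≤ y) : IsSmooth y h :=
  ⟨h0, fun _ hp => le_trans (Nat.cast_le.mpr (Nat.le_of_dvd (Nat.pos_of_ne_zero h0)
    (Nat.dvd_of_mem_primeFactors hp))) hy⟩

theorem IsSmooth.mono {P y : ℝ} (hPy : P ≤ y) {d : ℕ} (h : IsSmooth P d) : IsSmooth y d :=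
  ⟨h.1, fun p hp => (h.2 p hp).trans hPy⟩

theorem sum_tau_smoothPart_le_tau3P {P y : ℝ} (hPy : P ≤ y) {n : ℕ} (hn : n ≠ 0) (s : Finset ℕ)
    (hs : s ⊆ n.divisors) (hsy : ∀ h ∈ s, (h : ℝ) ≤ y) :
    ∑ h ∈ s, tau (smoothPart P (n / h)) ≤ tau3P y n := by
  unfold tau3P
  rw [tau3_eq_sum (smoothPart_ne_zero y n)]
  have hmem : ∀ h ∈ s, h ∣ smoothPart y n := fun h hh =>
    dvd_smoothPart hn (isSmooth_of_le (Nat.pos_of_mem_divisors (hs hh)).ne' (hsy h hh))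
      (Nat.dvd_of_mem_divisors (hs hh))
  refine le_trans (Finset.sum_le_sum (g := fun h => tau (smoothPart y n / h)) fun h hh => ?_)
    (Finset.sum_le_sum_of_subset fun h hh =>
      Nat.mem_divisors.mpr ⟨hmem h hh, smoothPart_ne_zero y n⟩)
  have hh0 : 0 < h := Nat.pos_of_mem_divisors (hs hh)
  have hdiv := Nat.dvd_of_mem_divisors (hs hh)
  have h1 : n / h ≠ 0 := (Nat.div_pos (Nat.divisor_le (hs hh)) hh0).ne'
  have h2 : h * smoothPart P (n / h) ∣ n := by
    refine (Nat.mul_dvd_mul_left h (smoothPart_dvd P h1)).trans ?_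
    rw [Nat.mul_div_cancel' hdiv]
  have h3 : h * smoothPart P (n / h) ∣ smoothPart y n :=
    dvd_smoothPart hn ((isSmooth_of_le hh0.ne' (hsy h hh)).mul
      ((isSmooth_smoothPart P _).mono hPy)) h2
  obtain ⟨k, hk⟩ := hmem h hh
  rw [hk] at h3 ⊢
  rw [Nat.mul_div_cancel_left _ hh0]
  have hk0 : k ≠ 0 := by
    rintro rfl; exact smoothPart_ne_zero y n (by rw [hk]; simp)
  exact tau_le_of_dvd hk0 (Nat.dvd_of_mul_dvd_mul_left hh0 h3)

/-- The two conditions expressing that `a` resembles the integers, with mean `α` and error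
parameters `E₁`, `E₂`, `E₃`. -/
structure Resembles (a : ℕ → ℂ) (x P E₁ E₂ E₃ : ℝ) (α : ℂ) : Prop where
  rough : ∀ h : ℕ, 1 ≤ h → ∀ y₁ y₂ : ℝ, 1 ≤ y₁ → y₁ ≤ y₂ → y₂ ≤ x / h →
    ‖(∑ n ∈ (Icc 1 ⌊x⌋₊).filter
          (fun n : ℕ => y₁ ≤ (n : ℝ) ∧ (n : ℝ) ≤ y₂ ∧ IsRough P n), a (n * h))
        - α * (((Icc 1 ⌊x⌋₊).filter
            (fun n : ℕ => y₁ ≤ (n : ℝ) ∧ (n : ℝ) ≤ y₂ ∧ IsRough P n)).card : ℂ)‖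
      ≤ (y₂ - y₁) * E₁ + E₂
  divisor : ∀ h : ℕ, 1 ≤ h → ∀ y₁ y₂ : ℝ, 1 ≤ y₁ → y₁ ≤ y₂ → y₂ ≤ x / h →
    ∑ n ∈ (Icc 1 ⌊x⌋₊).filter (fun n : ℕ => y₁ ≤ (n : ℝ) ∧ (n : ℝ) ≤ y₂),
        ‖a (n * h)‖ * (tau n : ℝ) ≤ (y₂ - y₁) * E₃ + E₂

theorem sum_filter_dvd_Icc_eq {M : Type*} [AddCommMonoid M] {m₁ m₂ d : ℕ} (hd : 1 ≤ d)
    {x : ℝ} (hx : (m₂ : ℝ) ≤ x) (F : ℕ → M) :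
    ∑ m ∈ (Icc m₁ m₂).filter (fun m => d ∣ m ∧ m ≠ 0), F m =
      ∑ s ∈ (Icc 1 ⌊x⌋₊).filter
        (fun s : ℕ => max 1 ((m₁ : ℝ) / d) ≤ (s : ℝ) ∧ (s : ℝ) ≤ (m₂ : ℝ) / d), F (d * s) := by
  have hd0 : (0 : ℝ) < d := by exact_mod_cast hd
  symm
  refine Finset.sum_nbij' (fun s => d * s) (fun m => m / d) ?_ ?_ ?_ ?_ ?_
  · intro s hs
    simp only [mem_filter, mem_Icc, max_le_iff, div_le_iff₀ hd0, le_div_iff₀ hd0] at hs ⊢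
    obtain ⟨⟨h1, _⟩, ⟨_, h2⟩, h3⟩ := hs
    refine ⟨⟨?_, ?_⟩, Dvd.intro _ rfl, by positivity⟩
    · rw [mul_comm]; exact_mod_cast h2
    · rw [mul_comm]; exact_mod_cast h3
  · intro m hm
    simp only [mem_filter, mem_Icc, max_le_iff, div_le_iff₀ hd0, le_div_iff₀ hd0] at hm ⊢
    obtain ⟨⟨h1, h2⟩, ⟨s, rfl⟩, h3⟩ := hm
    rw [Nat.mul_div_cancel_left _ hd]
    have hs : 1 ≤ s := Nat.pos_of_ne_zero (by rintro rfl; simp at h3)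
    refine ⟨⟨hs, Nat.le_floor ?_⟩, ⟨by exact_mod_cast hs, ?_⟩, ?_⟩
    · refine le_trans ?_ hx
      exact_mod_cast (Nat.le_mul_of_pos_left s hd).trans h2
    · rw [mul_comm] at h1; exact_mod_cast h1
    · rw [mul_comm] at h2; exact_mod_cast h2
  · intro s _
    exact Nat.mul_div_cancel_left _ hd
  · intro m hm
    exact Nat.mul_div_cancel' (mem_filter.mp hm).2.1
  · intro s _; rfl

theorem sum_filter_smoothPart_eq {M : Type*} [AddCommMonoid M] {m₁ m₂ d : ℕ} {P x : ℝ}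
    (hd : IsSmooth P d) (hm₁ : 1 ≤ m₁) (hx : (m₂ : ℝ) ≤ x) (F : ℕ → M) :
    ∑ m ∈ (Icc m₁ m₂).filter (fun m => smoothPart P m = d), F m =
      ∑ s ∈ (Icc 1 ⌊x⌋₊).filter (fun s : ℕ => max 1 ((m₁ : ℝ) / d) ≤ (s : ℝ) ∧
        (s : ℝ) ≤ (m₂ : ℝ) / d ∧ IsRough P s), F (d * s) := by
  have hd1 : 1 ≤ d := Nat.pos_of_ne_zero hd.1
  have h := sum_filter_dvd_Icc_eq (m₁ := m₁) hd1 hx (fun m => if smoothPart P m = d then F m else 0)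
  rw [← Finset.sum_filter, ← Finset.sum_filter, Finset.filter_filter, Finset.filter_filter] at h
  convert h using 2
  · ext m
    simp only [mem_filter, mem_Icc]
    constructor
    · rintro ⟨h1, rfl⟩
      exact ⟨h1, ⟨smoothPart_dvd P (by omega), by omega⟩, rfl⟩
    · rintro ⟨h1, _, h3⟩; exact ⟨h1, h3⟩
  · ext s
    simp only [mem_filter, mem_Icc]
    constructor
    · rintro ⟨h1, h2, h3, h4⟩
      exact ⟨h1, ⟨h2, h3⟩, smoothPart_mul_of_isRough hd h4 (by omega)⟩
    · rintro ⟨h1, ⟨h2, h3⟩, h4⟩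
      refine ⟨h1, h2, h3, ?_⟩
      have h5 := isRough_div_smoothPart P (n := d * s) (mul_ne_zero hd.1 (by omega))
      rwa [h4, Nat.mul_div_cancel_left _ hd1] at h5

theorem Resembles.smoothPart_fiber {a : ℕ → ℂ} {x P E₁ E₂ E₃ : ℝ} {α : ℂ}
    (H : Resembles a x P E₁ E₂ E₃ α) (hE₁ : 0 ≤ E₁) (hE₂ : 0 ≤ E₂) {h m₁ m₂ d : ℕ} (hh : 1 ≤ h)
    (hm₁ : 1 ≤ m₁) (hm : m₁ ≤ m₂) (hm₂ : (m₂ : ℝ) ≤ x / h) (hd : IsSmooth P d) :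
    ‖∑ m ∈ (Icc m₁ m₂).filter (fun m => smoothPart P m = d), (a (h * m) - α)‖ ≤
      ((m₂ : ℝ) - m₁) / d * E₁ + E₂ := by
  have hd0 : (0 : ℝ) < d := by exact_mod_cast Nat.pos_of_ne_zero hd.1
  have hh0 : (1 : ℝ) ≤ h := by exact_mod_cast hh
  have hmm : (m₁ : ℝ) ≤ m₂ := by exact_mod_cast hm
  have hx0 : 0 ≤ x := by
    have : 0 ≤ x / h := le_trans (by positivity) hm₂
    by_contra hc
    have := div_neg_of_neg_of_pos (not_le.mp hc) (show (0 : ℝ) < h by linarith)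
    linarith
  have hx : (m₂ : ℝ) ≤ x := hm₂.trans (div_le_self hx0 hh0)
  have hRHS : 0 ≤ ((m₂ : ℝ) - m₁) / d * E₁ + E₂ := by
    have : 0 ≤ (m₂ : ℝ) - m₁ := by linarith
    positivity
  rw [sum_filter_smoothPart_eq hd hm₁ hx]
  rcases lt_or_ge ((m₂ : ℝ) / d) (max 1 ((m₁ : ℝ) / d)) with hlt | hle
  · rw [Finset.filter_false_of_mem, Finset.sum_empty, norm_zero]
    · exact hRHS
    · intro s _ hs
      linarith [hs.1, hs.2.1]
  · have h1 := H.rough (h * d) (Nat.mul_pos hh (Nat.pos_of_ne_zero hd.1)) _ _ (le_max_left _ _) hle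
      (by push_cast; rw [← div_div]; gcongr)
    rw [Finset.sum_sub_distrib, Finset.sum_const, nsmul_eq_mul, mul_comm _ α]
    have e : ∀ s : ℕ, a (h * (d * s)) = a (s * (h * d)) := fun s => by congr 1; ring
    simp only [e]
    refine h1.trans ?_
    gcongr
    rw [sub_div]
    gcongr
    exact le_max_right _ _

theorem Resembles.multiples {a : ℕ → ℂ} {x P E₁ E₂ E₃ : ℝ} {α : ℂ}
    (H : Resembles a x P E₁ E₂ E₃ α) (hE₂ : 0 ≤ E₂) (hE₃ : 0 ≤ E₃) {h m₁ m₂ d : ℕ} (hh : 1 ≤ h)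
    (hm₁ : 1 ≤ m₁) (hm : m₁ ≤ m₂) (hm₂ : (m₂ : ℝ) ≤ x / h) (hd : 1 ≤ d) :
    ∑ m ∈ (Icc m₁ m₂).filter (fun m => d ∣ m), ‖a (h * m)‖ * tau m ≤
      tau d * (((m₂ : ℝ) - m₁) / d * E₃ + E₂) := by
  have hd0 : (0 : ℝ) < d := by exact_mod_cast hd
  have hh0 : (1 : ℝ) ≤ h := by exact_mod_cast hh
  have hmm : (m₁ : ℝ) ≤ m₂ := by exact_mod_cast hm
  have hx0 : 0 ≤ x := by
    have : 0 ≤ x / h := le_trans (by positivity) hm₂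
    by_contra hc
    have := div_neg_of_neg_of_pos (not_le.mp hc) (show (0 : ℝ) < h by linarith)
    linarith
  have hx : (m₂ : ℝ) ≤ x := hm₂.trans (div_le_self hx0 hh0)
  have hRHS : 0 ≤ ((m₂ : ℝ) - m₁) / d * E₃ + E₂ := by
    have : 0 ≤ (m₂ : ℝ) - m₁ := by linarith
    positivity
  have e0 : (Icc m₁ m₂).filter (fun m => d ∣ m) = (Icc m₁ m₂).filter (fun m => d ∣ m ∧ m ≠ 0) := by
    refine Finset.filter_congr fun m hm => ?_
    have := (mem_Icc.mp hm).1
    simp only [iff_self_and]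
    omega
  rw [e0, sum_filter_dvd_Icc_eq hd hx]
  rcases lt_or_ge ((m₂ : ℝ) / d) (max 1 ((m₁ : ℝ) / d)) with hlt | hle
  · rw [Finset.filter_false_of_mem, Finset.sum_empty]
    · positivity
    · intro s _ hs
      linarith [hs.1, hs.2]
  · have h1 := H.divisor (h * d) (Nat.mul_pos hh hd) _ _ (le_max_left _ _) hle
      (by push_cast; rw [← div_div]; gcongr)
    calc _ ≤ ∑ s ∈ (Icc 1 ⌊x⌋₊).filter (fun s : ℕ => max 1 ((m₁ : ℝ) / d) ≤ (s : ℝ) ∧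
            (s : ℝ) ≤ (m₂ : ℝ) / d), tau d * (‖a (s * (h * d))‖ * tau s) := by
          refine Finset.sum_le_sum fun s _ => ?_
          have e : h * (d * s) = s * (h * d) := by ring
          rw [e]
          have : (tau (d * s) : ℝ) ≤ tau d * tau s := by exact_mod_cast tau_mul_le d s
          calc _ ≤ ‖a (s * (h * d))‖ * (tau d * tau s) := by gcongr
            _ = _ := by ring
      _ ≤ _ := by
          rw [← Finset.mul_sum]
          refine mul_le_mul_of_nonneg_left (h1.trans ?_) (by positivity)
          gcongr
          rw [sub_div]
          gcongr
          exact le_max_right _ _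

theorem Resembles.sum_smoothPart {a : ℕ → ℂ} {x P R E₁ E₂ E₃ : ℝ} {α : ℂ}
    (H : Resembles a x P E₁ E₂ E₃ α) (hE₁ : 0 ≤ E₁) (hE₂ : 0 ≤ E₂) (hE₃ : 0 ≤ E₃)
    (hP : 3 ≤ P) (hR : 1 ≤ R) (hRP : R * P ≤ x) {h m₁ m₂ : ℕ} (hh : 1 ≤ h)
    (hm₁ : 1 ≤ m₁) (hm : m₁ ≤ m₂) (hm₂ : (m₂ : ℝ) ≤ x / h) {M Γ : ℝ} (hM : 0 ≤ M)
    {g f : ℕ → ℝ} (hg0 : ∀ d, 0 ≤ g d) (hg : ∀ d, d ≠ 0 → g d ≤ tau d)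
    (hf : ∀ d, d ≠ 0 → |f d| ≤ M * g d)
    (hΓ : ∑ d ∈ (Icc 1 ⌊R⌋₊).filter (IsSmooth P), g d / d ≤ Γ) :
    ‖∑ m ∈ Icc m₁ m₂, a (h * m) * (f (smoothPart P m) : ℂ) -
        α * ∑ m ∈ (Icc m₁ m₂).filter (fun m : ℕ => (smoothPart P m : ℝ) ≤ R),
          (f (smoothPart P m) : ℂ)‖ ≤
      M * (((m₂ : ℝ) - m₁) * E₁ * Γ + 2 * (R * P * (1 + Real.log x)) * E₂ +
        ((m₂ : ℝ) - m₁) * E₃ * ((smoothConst * Real.log P) ^ 2 / R ^ (1 / Real.log P))) := by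
  have hmm : 0 ≤ (m₂ : ℝ) - m₁ := by
    have : (m₁ : ℝ) ≤ m₂ := by exact_mod_cast hm
    linarith
  set ℓ := (m₂ : ℝ) - m₁
  have hR0 : 0 ≤ R := by linarith
  -- sums of divisor functions over short ranges
  have hRPn : 1 ≤ R * P := by nlinarith
  have hlogx : 0 ≤ Real.log x := Real.log_nonneg (by linarith)
  have htau : ∀ Y : ℝ, 0 ≤ Y → Y ≤ R * P → ∑ d ∈ Icc 1 ⌊Y⌋₊, (tau d : ℝ) ≤ R * P * (1 + Real.log x) := by
    intro Y hY0 hY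
    have h1 : (⌊Y⌋₊ : ℝ) ≤ R * P := (Nat.floor_le hY0).trans hY
    have h2 : Real.log (⌊Y⌋₊ : ℝ) ≤ Real.log x := by
      rcases Nat.eq_zero_or_pos ⌊Y⌋₊ with h0 | h0
      · rw [h0]; simpa using hlogx
      · exact Real.log_le_log (by exact_mod_cast h0) (h1.trans hRP)
    have h3 : 0 ≤ Real.log (⌊Y⌋₊ : ℝ) := Real.log_natCast_nonneg _
    refine (sum_tau_le _).trans ?_
    gcongr
  have hsplit : ∑ m ∈ Icc m₁ m₂, a (h * m) * (f (smoothPart P m) : ℂ) -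
        α * ∑ m ∈ (Icc m₁ m₂).filter (fun m : ℕ => (smoothPart P m : ℝ) ≤ R),
          (f (smoothPart P m) : ℂ) =
      (∑ m ∈ (Icc m₁ m₂).filter (fun m : ℕ => (smoothPart P m : ℝ) ≤ R),
          (f (smoothPart P m) : ℂ) * (a (h * m) - α)) +
      ∑ m ∈ (Icc m₁ m₂).filter (fun m : ℕ => ¬ (smoothPart P m : ℝ) ≤ R),
        a (h * m) * (f (smoothPart P m) : ℂ) := by
    rw [← Finset.sum_filter_add_sum_filter_not (Icc m₁ m₂)
      (fun m : ℕ => (smoothPart P m : ℝ) ≤ R), add_sub_right_comm, Finset.mul_sum,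
      ← Finset.sum_sub_distrib]
    congr 1
    exact Finset.sum_congr rfl fun m _ => by ring
  have hhead : ‖∑ m ∈ (Icc m₁ m₂).filter (fun m : ℕ => (smoothPart P m : ℝ) ≤ R),
      (f (smoothPart P m) : ℂ) * (a (h * m) - α)‖ ≤
      M * (ℓ * E₁ * Γ + R * P * (1 + Real.log x) * E₂) := by
    have hmaps : ∀ m ∈ (Icc m₁ m₂).filter (fun m : ℕ => (smoothPart P m : ℝ) ≤ R),
        smoothPart P m ∈ (Icc 1 ⌊R⌋₊).filter (IsSmooth P) := by
      intro m hm
      rw [mem_filter, mem_Icc]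
      exact ⟨⟨Nat.pos_of_ne_zero (smoothPart_ne_zero P m), Nat.le_floor (mem_filter.mp hm).2⟩,
        isSmooth_smoothPart P m⟩
    rw [← Finset.sum_fiberwise_of_maps_to hmaps]
    refine (norm_sum_le _ _).trans ?_
    calc _ ≤ ∑ d ∈ (Icc 1 ⌊R⌋₊).filter (IsSmooth P), M * g d * (ℓ / d * E₁ + E₂) := by
          refine Finset.sum_le_sum fun d hd => ?_
          rw [mem_filter, mem_Icc] at hd
          have hdR : (d : ℝ) ≤ R := (Nat.le_floor_iff hR0).mp hd.1.2
          have e1 : ∑ m ∈ ((Icc m₁ m₂).filter (fun m : ℕ => (smoothPart P m : ℝ) ≤ R)).filter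
              (fun m => smoothPart P m = d), (f (smoothPart P m) : ℂ) * (a (h * m) - α) =
              (f d : ℂ) * ∑ m ∈ (Icc m₁ m₂).filter (fun m => smoothPart P m = d), (a (h * m) - α) := by
            rw [Finset.mul_sum, Finset.filter_filter]
            refine Finset.sum_congr ?_ ?_
            · refine Finset.filter_congr fun m _ => ?_
              constructor
              · exact fun h => h.2
              · rintro rfl; exact ⟨hdR, rfl⟩
            · intro m hm
              rw [(mem_filter.mp hm).2]
          rw [e1, norm_mul, Complex.norm_real, Real.norm_eq_abs]
          exact mul_le_mul (hf d (by omega))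
            (H.smoothPart_fiber hE₁ hE₂ hh hm₁ hm hm₂ hd.2) (norm_nonneg _)
            (mul_nonneg hM (hg0 d))
      _ = M * (ℓ * E₁ * (∑ d ∈ (Icc 1 ⌊R⌋₊).filter (IsSmooth P), g d / d) +
            (∑ d ∈ (Icc 1 ⌊R⌋₊).filter (IsSmooth P), g d) * E₂) := by
          simp only [Finset.mul_sum, Finset.sum_mul, ← Finset.sum_add_distrib]
          exact Finset.sum_congr rfl fun d _ => by ring
      _ ≤ _ := by
          refine mul_le_mul_of_nonneg_left (add_le_add ?_ ?_) hM
          · exact mul_le_mul_of_nonneg_left hΓ (by positivity)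
          · refine mul_le_mul_of_nonneg_right ?_ hE₂
            refine le_trans ?_ (htau R hR0 (by nlinarith))
            refine (Finset.sum_le_sum fun d hd => hg d ?_).trans
              (Finset.sum_le_sum_of_subset_of_nonneg (filter_subset _ _) fun _ _ _ => by positivity)
            have := (mem_Icc.mp (mem_filter.mp hd).1).1
            omega
  have htail : ‖∑ m ∈ (Icc m₁ m₂).filter (fun m : ℕ => ¬ (smoothPart P m : ℝ) ≤ R),
        a (h * m) * (f (smoothPart P m) : ℂ)‖ ≤
      M * (R * P * (1 + Real.log x) * E₂ +
        ℓ * E₃ * ((smoothConst * Real.log P) ^ 2 / R ^ (1 / Real.log P))) := by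
    refine (norm_sum_le _ _).trans ?_
    calc _ ≤ ∑ m ∈ (Icc m₁ m₂).filter (fun m : ℕ => ¬ (smoothPart P m : ℝ) ≤ R),
            M * (‖a (h * m)‖ * tau m) := by
          refine Finset.sum_le_sum fun m hm => ?_
          rw [mem_filter, mem_Icc] at hm
          rw [norm_mul, Complex.norm_real, Real.norm_eq_abs]
          have h1 := hf _ (smoothPart_ne_zero P m)
          have h2 := hg _ (smoothPart_ne_zero P m)
          have h3 : (tau (smoothPart P m) : ℝ) ≤ tau m := by
            exact_mod_cast tau_le_of_dvd (by omega) (smoothPart_dvd P (by omega))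
          calc _ ≤ ‖a (h * m)‖ * (M * tau m) := by
                gcongr
                refine h1.trans ?_
                gcongr
                exact h2.trans h3
            _ = _ := by ring
      _ ≤ ∑ d ∈ (Icc 1 ⌊R * P⌋₊).filter (fun d : ℕ => IsSmooth P d ∧ R < d),
            ∑ m ∈ (Icc m₁ m₂).filter (fun m => d ∣ m), M * (‖a (h * m)‖ * tau m) := by
          refine sum_le_sum_sum_of_cover _ _ _ (fun _ => by positivity) fun m hm => ?_
          simp only [mem_filter, mem_Icc, not_le] at hm ⊢
          obtain ⟨d, hd1, hd2, hd3, hd4⟩ := exists_smooth_dvd_of_lt hR hm.2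
          exact ⟨d, ⟨⟨Nat.pos_of_ne_zero hd1.1, Nat.le_floor hd4⟩, hd1, hd3⟩, hm.1,
            hd2.trans (smoothPart_dvd P (by omega))⟩
      _ ≤ ∑ d ∈ (Icc 1 ⌊R * P⌋₊).filter (fun d : ℕ => IsSmooth P d ∧ R < d),
            M * (tau d * (ℓ / d * E₃ + E₂)) := by
          refine Finset.sum_le_sum fun d hd => ?_
          rw [← Finset.mul_sum]
          exact mul_le_mul_of_nonneg_left (H.multiples hE₂ hE₃ hh hm₁ hm hm₂
            (mem_Icc.mp (mem_filter.mp hd).1).1) hM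
      _ = M * ((∑ d ∈ (Icc 1 ⌊R * P⌋₊).filter (fun d : ℕ => IsSmooth P d ∧ R < d), (tau d : ℝ)) * E₂ +
            ℓ * E₃ * ∑ d ∈ (Icc 1 ⌊R * P⌋₊).filter (fun d : ℕ => IsSmooth P d ∧ R < d),
              (tau d : ℝ) / d) := by
          simp only [Finset.mul_sum, Finset.sum_mul, ← Finset.sum_add_distrib]
          exact Finset.sum_congr rfl fun d _ => by ring
      _ ≤ _ := by
          refine mul_le_mul_of_nonneg_left (add_le_add ?_ ?_) hM
          · refine mul_le_mul_of_nonneg_right ?_ hE₂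
            refine le_trans ?_ (htau (R * P) (by linarith) le_rfl)
            exact Finset.sum_le_sum_of_subset_of_nonneg (filter_subset _ _) fun _ _ _ => by positivity
          · exact mul_le_mul_of_nonneg_left (sum_smooth_tau_div_tail_le hP (by linarith) _)
              (by positivity)
  rw [hsplit]
  refine (norm_add_le _ _).trans ((add_le_add hhead htail).trans_eq ?_)
  ring

/-- The kernel of the averaging operator over residues with a fixed gcd with `q`. -/
noncomputable def gcdKernel (q m n : ℕ) : ℝ :=
  if m.gcd q = n.gcd q then 1 / ((q / n.gcd q).totient : ℝ) else 0

theorem gcdKernel_nonneg (q m n : ℕ) : 0 ≤ gcdKernel q m n := by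
  unfold gcdKernel; split_ifs <;> positivity

theorem gcdKernel_le_one (q m n : ℕ) : gcdKernel q m n ≤ 1 := by
  unfold gcdKernel
  split_ifs
  · rcases Nat.eq_zero_or_pos (q / n.gcd q).totient with h | h
    · simp [h]
    · rw [div_le_one (by positivity)]; exact_mod_cast h
  · norm_num

theorem gcd_eq_of_mod_eq {q m n : ℕ} (h : m % q = n % q) : m.gcd q = n.gcd q := by
  exact Nat.ModEq.gcd_eq h

theorem sum_Icc_residue {M : Type*} [AddCommMonoid M] {q : ℕ} (hq : 1 ≤ q) (n : ℕ) (F : ℕ → M)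
    (hF : ∀ b, b % q = n % q → F b = F n) :
    ∑ b ∈ (Icc 1 q).filter (fun b => n % q = b % q), F b = F n := by
  have h : (Icc 1 q).filter (fun b => n % q = b % q) = {if n % q = 0 then q else n % q} := by
    ext b
    simp only [mem_filter, mem_Icc, mem_singleton]
    have hlt := Nat.mod_lt n hq
    constructor
    · rintro ⟨⟨h1, h2⟩, h3⟩
      rcases h2.lt_or_eq with h2 | h2
      · rw [Nat.mod_eq_of_lt h2] at h3
        rw [if_neg (by omega), h3]
      · subst h2; rw [Nat.mod_self] at h3; rw [if_pos h3]
    · rintro rfl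
      split_ifs with h0
      · exact ⟨⟨hq, le_rfl⟩, by rw [Nat.mod_self, h0]⟩
      · exact ⟨⟨by omega, hlt.le⟩, (Nat.mod_mod _ _).symm⟩
  have hmem : (if n % q = 0 then q else n % q) ∈ (Icc 1 q).filter (fun b => n % q = b % q) := by
    rw [h]; exact mem_singleton_self _
  rw [h, sum_singleton]
  exact hF _ (mem_filter.mp hmem).2.symm

theorem sum_Icc_sum_residue {M : Type*} [AddCommMonoid M] {q : ℕ} (hq : 1 ≤ q) (s : Finset ℕ)
    (F : ℕ → ℕ → M) (hF : ∀ n b, b % q = n % q → F b n = F n n) :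
    ∑ b ∈ Icc 1 q, ∑ n ∈ s.filter (fun n => n % q = b % q), F b n = ∑ n ∈ s, F n n := by
  simp_rw [Finset.sum_filter]
  rw [Finset.sum_comm]
  refine Finset.sum_congr rfl fun n _ => ?_
  rw [← Finset.sum_filter]
  exact sum_Icc_residue hq n (fun b => F b n) (hF n)

theorem seqAver_eq (a : ℕ → ℂ) (z : ℝ) {q : ℕ} (hq : 1 ≤ q) (m : ℕ) :
    seqAver a z q (m.gcd q) = ∑ n ∈ Icc 1 ⌊z⌋₊, a n * (gcdKernel q m n : ℂ) := by
  unfold seqAver seqSum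
  rw [Finset.sum_filter, Finset.mul_sum]
  rw [← sum_Icc_sum_residue hq (Icc 1 ⌊z⌋₊) (fun b n => a n * (gcdKernel q m b : ℂ))]
  · refine Finset.sum_congr rfl fun b _ => ?_
    rw [← Finset.sum_mul]
    unfold gcdKernel
    by_cases h : b.gcd q = m.gcd q
    · simp [h, mul_comm]
    · simp [h, Ne.symm h]
  · intro n b h
    unfold gcdKernel
    rw [gcd_eq_of_mod_eq h]

/-- The discrepancy of `a` in the progression of `m` modulo `q`. -/
noncomputable def discrep (a : ℕ → ℂ) (z : ℝ) (q m : ℕ) : ℂ :=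
  seqSum a z q m - seqAver a z q (m.gcd q)

theorem discrep_eq (a : ℕ → ℂ) (z : ℝ) {q : ℕ} (hq : 1 ≤ q) (m : ℕ) :
    discrep a z q m =
      ∑ n ∈ Icc 1 ⌊z⌋₊, a n * ((if n % q = m % q then 1 else 0) - (gcdKernel q m n : ℂ)) := by
  unfold discrep
  rw [seqAver_eq a z hq, seqSum, Finset.sum_filter, ← Finset.sum_sub_distrib]
  refine Finset.sum_congr rfl fun n _ => ?_
  split_ifs <;> ring

theorem discrep_congr (a : ℕ → ℂ) (z : ℝ) {q m m' : ℕ} (h : m % q = m' % q) :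
    discrep a z q m = discrep a z q m' := by
  unfold discrep seqSum; rw [gcd_eq_of_mod_eq h, h]

theorem norm_discrep_le (a : ℕ → ℂ) {z x : ℝ} (hz : z ≤ x) {q : ℕ} (hq : 1 ≤ q) (m : ℕ) :
    ‖discrep a z q m‖ ≤ ∑ n ∈ Icc 1 ⌊x⌋₊, ‖a n‖ := by
  rw [discrep_eq a z hq]
  refine (norm_sum_le _ _).trans ?_
  refine (Finset.sum_le_sum_of_subset_of_nonneg (Icc_subset_Icc_right (Nat.floor_mono hz))
    (fun _ _ _ => norm_nonneg _)).trans ?_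
  refine Finset.sum_le_sum fun n _ => ?_
  rw [norm_mul]
  refine mul_le_of_le_one_right (norm_nonneg _) ?_
  have h0 := gcdKernel_nonneg q m n
  have h1 := gcdKernel_le_one q m n
  split_ifs
  · rw [← Complex.ofReal_one, ← Complex.ofReal_sub, Complex.norm_real, Real.norm_eq_abs, abs_le]
    constructor <;> linarith
  · rw [zero_sub, norm_neg, Complex.norm_real, Real.norm_eq_abs, abs_of_nonneg h0]; exact h1

/-- The supremum of the discrepancy over initial segments. -/
noncomputable def discrepSup (a : ℕ → ℂ) (x : ℝ) (q m : ℕ) : ℝ :=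
  ⨆ z ∈ Set.Icc (0 : ℝ) x, ‖discrep a z q m‖

theorem norm_discrep_le_discrepSup (a : ℕ → ℂ) {z x : ℝ} (hz0 : 0 ≤ z) (hz : z ≤ x) {q : ℕ}
    (hq : 1 ≤ q) (m : ℕ) : ‖discrep a z q m‖ ≤ discrepSup a x q m := by
  unfold discrepSup
  refine le_ciSup_of_le ⟨∑ n ∈ Icc 1 ⌊x⌋₊, ‖a n‖, ?_⟩ z ?_
  · rintro _ ⟨y, rfl⟩
    refine Real.iSup_le (fun hy => norm_discrep_le a hy.2 hq m) (by positivity)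
  · rw [ciSup_pos (show z ∈ Set.Icc 0 x from ⟨hz0, hz⟩)]

theorem discrepSup_nonneg (a : ℕ → ℂ) (x : ℝ) (q m : ℕ) : 0 ≤ discrepSup a x q m :=
  Real.iSup_nonneg fun _ => Real.iSup_nonneg fun _ => norm_nonneg _

theorem discrepSup_congr (a : ℕ → ℂ) (x : ℝ) {q m m' : ℕ} (h : m % q = m' % q) :
    discrepSup a x q m = discrepSup a x q m' := by
  unfold discrepSup; simp_rw [discrep_congr a _ h]

theorem progLHS_eq (a : ℕ → ℂ) (x Q : ℝ) :
    progLHS a x Q =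
      ∑ r ∈ Icc 1 ⌊2 * x / Q⌋₊, ∑ n ∈ Icc 1 ⌊x⌋₊, ‖a n‖ * discrepSup a x r n := by
  unfold progLHS
  refine Finset.sum_congr rfl fun r hr => ?_
  rw [← sum_Icc_sum_residue (mem_Icc.mp hr).1 (Icc 1 ⌊x⌋₊)
    (fun b n => ‖a n‖ * discrepSup a x r b)]
  · exact Finset.sum_congr rfl fun b _ => by rw [Finset.sum_mul]; rfl
  · intro n b h
    rw [discrepSup_congr a x h]

theorem card_gcd_class {q h : ℕ} (hq : 1 ≤ q) (hh : h ∣ q) :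
    ((Icc 1 q).filter (fun b => b.gcd q = h)).card = (q / h).totient := by
  rw [Nat.totient_div_of_dvd hh]
  refine Finset.card_nbij' (fun b => if b = q then 0 else b) (fun b => if b = 0 then q else b)
    ?_ ?_ ?_ ?_
  · intro b hb
    simp only [coe_filter, mem_Icc, mem_range, Set.mem_ofPred_eq] at hb ⊢
    split_ifs with h1
    · subst h1; exact ⟨by omega, by simpa using hb.2⟩
    · exact ⟨by omega, by rw [Nat.gcd_comm]; exact hb.2⟩
  · intro b hb
    simp only [coe_filter, mem_Icc, mem_range, Set.mem_ofPred_eq] at hb ⊢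
    split_ifs with h1
    · subst h1; exact ⟨⟨hq, le_rfl⟩, by simpa using hb.2⟩
    · exact ⟨⟨by omega, by omega⟩, by rw [Nat.gcd_comm]; exact hb.2⟩
  · intro b hb
    simp only [coe_filter, mem_Icc, Set.mem_ofPred_eq] at hb
    dsimp only; split_ifs <;> omega
  · intro b hb
    simp only [coe_filter, mem_range, Set.mem_ofPred_eq] at hb
    dsimp only; split_ifs <;> omega

theorem sum_gcd_class_discrep (a : ℕ → ℂ) (z : ℝ) {q h : ℕ} (hq : 1 ≤ q) (hh : h ∣ q) :
    ∑ b ∈ (Icc 1 q).filter (fun b => b.gcd q = h), discrep a z q b = 0 := by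
  unfold discrep
  rw [Finset.sum_sub_distrib]
  have : ∀ b ∈ (Icc 1 q).filter (fun b => b.gcd q = h), seqAver a z q (b.gcd q) = seqAver a z q h :=
    fun b hb => by rw [(mem_filter.mp hb).2]
  rw [Finset.sum_congr rfl this, Finset.sum_const, card_gcd_class hq hh, seqAver, nsmul_eq_mul,
    ← mul_assoc, mul_one_div_cancel, one_mul, sub_self]
  exact_mod_cast (Nat.totient_pos.mpr (Nat.div_pos (Nat.le_of_dvd hq hh)
    (Nat.pos_of_dvd_of_pos hh hq))).ne'

theorem sum_norm_sq_discrep (a : ℕ → ℂ) (x : ℝ) {q : ℕ} (hq : 1 ≤ q) :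
    ((∑ b ∈ Icc 1 q, ‖discrep a x q b‖ ^ 2 : ℝ) : ℂ) =
      ∑ m ∈ Icc 1 ⌊x⌋₊, conj (a m) * discrep a x q m := by
  have h1 : ((∑ b ∈ Icc 1 q, ‖discrep a x q b‖ ^ 2 : ℝ) : ℂ) =
      ∑ b ∈ Icc 1 q, conj (seqSum a x q b) * discrep a x q b
        - ∑ b ∈ Icc 1 q, conj (seqAver a x q (b.gcd q)) * discrep a x q b := by
    rw [← Finset.sum_sub_distrib]
    push_cast
    refine Finset.sum_congr rfl fun b _ => ?_
    rw [← sub_mul, ← map_sub]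
    exact (Complex.conj_mul' _).symm
  have h2 : ∑ b ∈ Icc 1 q, conj (seqAver a x q (b.gcd q)) * discrep a x q b = 0 := by
    rw [← Finset.sum_fiberwise_of_maps_to (t := q.divisors) (g := fun b => b.gcd q)]
    · refine Finset.sum_eq_zero fun h hh => ?_
      rw [← mul_zero (conj (seqAver a x q h)),
        ← sum_gcd_class_discrep a x hq (Nat.dvd_of_mem_divisors hh), Finset.mul_sum]
      exact Finset.sum_congr rfl fun b hb => by rw [(mem_filter.mp hb).2]
    · intro b _
      exact Nat.mem_divisors.mpr ⟨Nat.gcd_dvd_right _ _, by omega⟩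
  rw [h1, h2, sub_zero, ← sum_Icc_sum_residue hq (Icc 1 ⌊x⌋₊)
    (fun b n => conj (a n) * discrep a x q b)]
  · refine Finset.sum_congr rfl fun b _ => ?_
    rw [← Finset.sum_mul, ← map_sum]; rfl
  · intro n b h
    rw [discrep_congr a x h]

theorem eq_Icc_of_ordConnected {s : Finset ℕ} (hs : s.Nonempty)
    (h : ∀ u ∈ s, ∀ v ∈ s, ∀ w, u ≤ w → w ≤ v → w ∈ s) : s = Icc (s.min' hs) (s.max' hs) := by
  ext w
  rw [mem_Icc]
  exact ⟨fun hw => ⟨s.min'_le w hw, s.le_max' w hw⟩,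
    fun hw => h _ (s.min'_mem hs) _ (s.max'_mem hs) w hw.1 hw.2⟩

theorem norm_sum_interval_le_discrepSup (a : ℕ → ℂ) {x : ℝ} (hx : 0 ≤ x) {r : ℕ} (hr : 1 ≤ r)
    (m : ℕ) {s : Finset ℕ} (hsub : s ⊆ Icc 1 ⌊x⌋₊)
    (h : ∀ u ∈ s, ∀ v ∈ s, ∀ w, u ≤ w → w ≤ v → w ∈ s) :
    ‖∑ n ∈ s, a n * ((if n % r = m % r then 1 else 0) - (gcdKernel r m n : ℂ))‖ ≤
      2 * discrepSup a x r m := by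
  rcases s.eq_empty_or_nonempty with rfl | hs
  · simpa using discrepSup_nonneg a x r m
  rw [eq_Icc_of_ordConnected hs h]
  set u := s.min' hs
  set v := s.max' hs
  have hu := mem_Icc.mp (hsub (s.min'_mem hs))
  have hv := mem_Icc.mp (hsub (s.max'_mem hs))
  have huv : u ≤ v := s.min'_le _ (s.max'_mem hs)
  have key : ∀ k : ℕ, k ≤ ⌊x⌋₊ → ‖discrep a (k : ℝ) r m‖ ≤ discrepSup a x r m := fun k hk =>
    norm_discrep_le_discrepSup a (by positivity) ((Nat.cast_le.mpr hk).trans (Nat.floor_le hx)) hr m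
  have h1 := discrep_eq a (v : ℝ) hr m
  have h2 := discrep_eq a ((u - 1 : ℕ) : ℝ) hr m
  rw [Nat.floor_natCast] at h1 h2
  have h3 : Icc u v = Icc 1 v \ Icc 1 (u - 1) := by
    ext w; simp only [mem_sdiff, mem_Icc]; omega
  rw [h3, Finset.sum_sdiff_eq_sub (Icc_subset_Icc_right (by omega)), ← h1, ← h2]
  refine (norm_sub_le _ _).trans ?_
  linarith [key v hv.2, key (u - 1) (by omega)]

/-- `n` lies at distance between `Qr/2` and `Qr` from `m`. -/
def Window (Q : ℝ) (r m n : ℕ) : Prop :=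
  Q * r / 2 < |(n : ℝ) - m| ∧ |(n : ℝ) - m| ≤ Q * r

theorem Window.symm {Q : ℝ} {r m n : ℕ} (h : Window Q r m n) : Window Q r n m := by
  unfold Window at h ⊢; rwa [abs_sub_comm]

theorem norm_sum_window_le (a : ℕ → ℂ) {x Q : ℝ} (hx : 0 ≤ x) (hQ : 0 ≤ Q) {r : ℕ} (hr : 1 ≤ r)
    (m : ℕ) :
    ‖∑ n ∈ (Icc 1 ⌊x⌋₊).filter (Window Q r m),
        a n * ((if n % r = m % r then 1 else 0) - (gcdKernel r m n : ℂ))‖ ≤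
      4 * discrepSup a x r m := by
  rw [← Finset.sum_filter_add_sum_filter_not _ (fun n : ℕ => m ≤ n)]
  refine (norm_add_le _ _).trans ?_
  have hQr : 0 ≤ Q * r / 2 := by positivity
  have h1 := norm_sum_interval_le_discrepSup a hx hr m
    (s := ((Icc 1 ⌊x⌋₊).filter (Window Q r m)).filter (fun n : ℕ => m ≤ n))
    ((filter_subset _ _).trans (filter_subset _ _)) (by
      intro u hu v hv w huw hwv
      simp only [mem_filter, mem_Icc, Window] at hu hv ⊢
      have h1 : (m : ℝ) ≤ u := by exact_mod_cast hu.2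
      have h2 : (u : ℝ) ≤ w := by exact_mod_cast huw
      have h3 : (w : ℝ) ≤ v := by exact_mod_cast hwv
      rw [abs_of_nonneg (by linarith)] at hu hv ⊢
      exact ⟨⟨⟨by omega, by omega⟩, by linarith, by linarith⟩, by omega⟩)
  have h2 := norm_sum_interval_le_discrepSup a hx hr m
    (s := ((Icc 1 ⌊x⌋₊).filter (Window Q r m)).filter (fun n : ℕ => ¬ m ≤ n))
    ((filter_subset _ _).trans (filter_subset _ _)) (by
      intro u hu v hv w huw hwv
      simp only [mem_filter, mem_Icc, Window, not_le] at hu hv ⊢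
      have h1 : (v : ℝ) ≤ m := by exact_mod_cast hv.2.le
      have h2 : (u : ℝ) ≤ w := by exact_mod_cast huw
      have h3 : (w : ℝ) ≤ v := by exact_mod_cast hwv
      rw [abs_of_nonpos (by linarith)] at hu hv ⊢
      exact ⟨⟨⟨by omega, by omega⟩, by linarith, by linarith⟩, by omega⟩)
  linarith

theorem card_moduli_eq_card_window {x Q : ℝ} (hQ : 0 < Q) {m n : ℕ} (hm : 1 ≤ m)
    (hmn : m < n) (hn : n ≤ ⌊x⌋₊) :
    ((Ioc ⌊Q / 2⌋₊ ⌊Q⌋₊).filter (fun q => n % q = m % q)).card =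
      ((Icc 1 ⌊2 * x / Q⌋₊).filter (fun r => Window Q r m n ∧ n % r = m % r)).card := by
  have hx : (n : ℝ) ≤ x := (Nat.le_floor_iff' (by omega)).mp hn
  have hm' : (1 : ℝ) ≤ m := by exact_mod_cast hm
  obtain ⟨u, rfl⟩ := Nat.exists_eq_add_of_lt hmn
  have hmod : ∀ q, (m + u + 1) % q = m % q ↔ q ∣ u + 1 := by
    intro q
    rw [eq_comm, ← Nat.ModEq, Nat.modEq_iff_dvd' (by omega)]
    congr! 1; omega
  have habs : ∀ r : ℕ, Window Q r m (m + u + 1) ↔ Q * r / 2 < (u + 1 : ℕ) ∧ ((u + 1 : ℕ) : ℝ) ≤ Q * r := by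
    intro r
    unfold Window
    have : ((m + u + 1 : ℕ) : ℝ) - m = (u + 1 : ℕ) := by push_cast; ring
    rw [this, abs_of_nonneg (by positivity)]
  simp only [hmod, habs]
  have hx' : ((u + 1 : ℕ) : ℝ) ≤ x := by push_cast at hx ⊢; linarith
  have hv : 0 < u + 1 := by omega
  generalize u + 1 = v at hx' hv ⊢
  refine Finset.card_nbij' (fun q => v / q) (fun q => v / q) ?_ ?_ ?_ ?_
  · intro q hq
    simp only [coe_filter, mem_Icc, mem_Ioc, Set.mem_ofPred_eq] at hq ⊢
    obtain ⟨⟨h1, h2⟩, k, rfl⟩ := hq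
    have hq0 : 0 < q := by omega
    have hk0 : 0 < k := Nat.pos_of_mul_pos_left hv
    rw [Nat.mul_div_cancel_left _ hq0]
    rw [Nat.floor_lt (by positivity)] at h1
    rw [Nat.le_floor_iff (by positivity)] at h2
    push_cast at hx' ⊢
    have hk1 : (1 : ℝ) ≤ k := by exact_mod_cast hk0
    refine ⟨⟨hk0, Nat.le_floor ?_⟩, ⟨by nlinarith, by nlinarith⟩, Dvd.intro_left _ rfl⟩
    rw [le_div_iff₀ hQ]; nlinarith
  · intro q hq
    simp only [coe_filter, mem_Icc, mem_Ioc, Set.mem_ofPred_eq] at hq ⊢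
    obtain ⟨⟨h1, h2⟩, ⟨h3, h4⟩, k, rfl⟩ := hq
    rw [Nat.mul_div_cancel_left _ h1]
    have hq1 : (1 : ℝ) ≤ q := by exact_mod_cast h1
    push_cast at h3 h4
    refine ⟨⟨?_, Nat.le_floor ?_⟩, Dvd.intro_left _ rfl⟩
    · rw [Nat.floor_lt (by positivity)]; nlinarith
    · nlinarith
  · intro q hq
    simp only [coe_filter, Set.mem_ofPred_eq] at hq
    exact Nat.div_div_self hq.2 hv.ne'
  · intro q hq
    simp only [coe_filter, Set.mem_ofPred_eq] at hq
    exact Nat.div_div_self hq.2.2 hv.ne'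

/-- The kernel of the bilinear form to which the variance is compared. -/
noncomputable def offKernel (x Q : ℝ) (m n : ℕ) : ℝ :=
  (∑ r ∈ Icc 1 ⌊2 * x / Q⌋₊, if Window Q r m n then gcdKernel r m n else 0)
    - ∑ q ∈ Ioc ⌊Q / 2⌋₊ ⌊Q⌋₊, gcdKernel q m n

/-- The bilinear form with kernel `offKernel`. -/
noncomputable def offForm (a : ℕ → ℂ) (x Q : ℝ) : ℂ :=
  ∑ m ∈ Icc 1 ⌊x⌋₊, ∑ n ∈ Icc 1 ⌊x⌋₊, conj (a m) * a n * (offKernel x Q m n : ℂ)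

theorem sum_moduli_kernel_eq {x Q : ℝ} (hQ : 0 < Q) {m n : ℕ} (hm : m ∈ Icc 1 ⌊x⌋₊)
    (hn : n ∈ Icc 1 ⌊x⌋₊) :
    ∑ q ∈ Ioc ⌊Q / 2⌋₊ ⌊Q⌋₊, ((if n % q = m % q then 1 else 0) - (gcdKernel q m n : ℂ)) =
      (if m = n then ((⌊Q⌋₊ - ⌊Q / 2⌋₊ : ℕ) : ℂ) else 0) + (offKernel x Q m n : ℂ)
        + ∑ r ∈ Icc 1 ⌊2 * x / Q⌋₊, (if Window Q r m n then
            ((if n % r = m % r then 1 else 0) - (gcdKernel r m n : ℂ)) else 0) := by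
  rw [mem_Icc] at hm hn
  have h1 : (∑ q ∈ Ioc ⌊Q / 2⌋₊ ⌊Q⌋₊, (if n % q = m % q then 1 else 0) : ℂ) =
      (if m = n then ((⌊Q⌋₊ - ⌊Q / 2⌋₊ : ℕ) : ℂ) else 0)
      + ∑ r ∈ Icc 1 ⌊2 * x / Q⌋₊, if Window Q r m n then (if n % r = m % r then 1 else 0) else 0 := by
    have h2 : ∀ r, (if Window Q r m n then (if n % r = m % r then (1 : ℂ) else 0) else 0) =
        if Window Q r m n ∧ n % r = m % r then 1 else 0 := by
      intro r; split_ifs <;> simp_all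
    simp only [h2, Finset.sum_boole]
    rcases lt_trichotomy m n with h | h | h
    · rw [card_moduli_eq_card_window hQ hm.1 h hn.2, if_neg h.ne, zero_add]
    · subst h
      rw [if_pos rfl, Finset.filter_true_of_mem (fun _ _ => rfl), Nat.card_Ioc]
      rw [Finset.filter_false_of_mem, card_empty, Nat.cast_zero, add_zero]
      rintro r hr ⟨⟨h3, _⟩, _⟩
      rw [sub_self, abs_zero] at h3
      have : 0 ≤ Q * r / 2 := by positivity
      linarith
    · have h3 := card_moduli_eq_card_window hQ hn.1 h hm.2
      rw [if_neg h.ne', zero_add]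
      have h4 : ∀ q, n % q = m % q ↔ m % q = n % q := fun q => eq_comm
      have h5 : ∀ r, Window Q r m n ↔ Window Q r n m := fun r => ⟨Window.symm, Window.symm⟩
      simp only [h4, h5]
      rw [h3]
  rw [Finset.sum_sub_distrib, h1]
  unfold offKernel
  push_cast
  have h6 : ∀ r, (if Window Q r m n then
            ((if n % r = m % r then 1 else 0) - (gcdKernel r m n : ℂ)) else 0) =
      (if Window Q r m n then (if n % r = m % r then 1 else 0) else 0)
        - (((if Window Q r m n then gcdKernel r m n else 0 : ℝ)) : ℂ) := by
    intro r; split_ifs <;> simp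
  simp only [h6, Finset.sum_sub_distrib]
  ring

theorem norm_varV_sub_le (a : ℕ → ℂ) {x Q : ℝ} (hx : 0 ≤ x) (hQ : 0 < Q) :
    ‖(varV a x Q : ℂ) - (((⌊Q⌋₊ - ⌊Q / 2⌋₊ : ℕ) * ∑ n ∈ Icc 1 ⌊x⌋₊, ‖a n‖ ^ 2 : ℝ) : ℂ)
      - offForm a x Q‖ ≤ 4 * progLHS a x Q := by
  have h1 : (varV a x Q : ℂ) = ∑ m ∈ Icc 1 ⌊x⌋₊, ∑ n ∈ Icc 1 ⌊x⌋₊, conj (a m) * a n *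
      ∑ q ∈ Ioc ⌊Q / 2⌋₊ ⌊Q⌋₊, ((if n % q = m % q then 1 else 0) - (gcdKernel q m n : ℂ)) := by
    have : (varV a x Q : ℂ) = ∑ q ∈ Ioc ⌊Q / 2⌋₊ ⌊Q⌋₊,
        ((∑ b ∈ Icc 1 q, ‖discrep a x q b‖ ^ 2 : ℝ) : ℂ) := by
      rw [← Complex.ofReal_sum]; rfl
    rw [this]
    simp_rw [Finset.mul_sum]
    rw [Finset.sum_congr rfl fun q hq =>
      sum_norm_sq_discrep a x (show 1 ≤ q by have := (mem_Ioc.mp hq).1; omega), Finset.sum_comm]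
    refine Finset.sum_congr rfl fun m _ => ?_
    rw [Finset.sum_comm]
    refine Finset.sum_congr rfl fun q hq => ?_
    rw [discrep_eq a x (show 1 ≤ q by have := (mem_Ioc.mp hq).1; omega), Finset.mul_sum]
    exact Finset.sum_congr rfl fun n _ => by ring
  have h2 : (varV a x Q : ℂ) - (((⌊Q⌋₊ - ⌊Q / 2⌋₊ : ℕ) * ∑ n ∈ Icc 1 ⌊x⌋₊, ‖a n‖ ^ 2 : ℝ) : ℂ)
      - offForm a x Q = ∑ r ∈ Icc 1 ⌊2 * x / Q⌋₊, ∑ m ∈ Icc 1 ⌊x⌋₊, conj (a m) *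
        ∑ n ∈ (Icc 1 ⌊x⌋₊).filter (Window Q r m),
          a n * ((if n % r = m % r then 1 else 0) - (gcdKernel r m n : ℂ)) := by
    rw [h1, Finset.sum_congr rfl fun m hm => Finset.sum_congr rfl fun n hn => by
      rw [sum_moduli_kernel_eq hQ hm hn]]
    simp only [mul_add, Finset.sum_add_distrib]
    have h3 : ∑ m ∈ Icc 1 ⌊x⌋₊, ∑ n ∈ Icc 1 ⌊x⌋₊, conj (a m) * a n *
        (if m = n then ((⌊Q⌋₊ - ⌊Q / 2⌋₊ : ℕ) : ℂ) else 0) =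
        (((⌊Q⌋₊ - ⌊Q / 2⌋₊ : ℕ) * ∑ n ∈ Icc 1 ⌊x⌋₊, ‖a n‖ ^ 2 : ℝ) : ℂ) := by
      rw [Complex.ofReal_mul, Complex.ofReal_sum, Finset.mul_sum]
      refine Finset.sum_congr rfl fun m hm => ?_
      simp only [mul_ite, mul_zero]
      rw [Finset.sum_ite_eq, if_pos hm, Complex.conj_mul', mul_comm]
      push_cast; ring
    rw [h3, offForm]
    have h4 : ∑ m ∈ Icc 1 ⌊x⌋₊, ∑ n ∈ Icc 1 ⌊x⌋₊, conj (a m) * a n *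
        ∑ r ∈ Icc 1 ⌊2 * x / Q⌋₊, (if Window Q r m n then
            ((if n % r = m % r then 1 else 0) - (gcdKernel r m n : ℂ)) else 0) =
        ∑ r ∈ Icc 1 ⌊2 * x / Q⌋₊, ∑ m ∈ Icc 1 ⌊x⌋₊, conj (a m) *
        ∑ n ∈ (Icc 1 ⌊x⌋₊).filter (Window Q r m),
          a n * ((if n % r = m % r then 1 else 0) - (gcdKernel r m n : ℂ)) := by
      simp_rw [Finset.mul_sum]
      symm
      rw [Finset.sum_comm]
      refine Finset.sum_congr rfl fun m _ => ?_
      symm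
      rw [Finset.sum_comm]
      refine Finset.sum_congr rfl fun r _ => ?_
      rw [Finset.sum_filter]
      refine Finset.sum_congr rfl fun n _ => ?_
      split_ifs <;> ring
    rw [h4]; ring
  rw [h2, progLHS_eq, Finset.mul_sum]
  refine (norm_sum_le _ _).trans (Finset.sum_le_sum fun r hr => ?_)
  rw [Finset.mul_sum]
  refine (norm_sum_le _ _).trans (Finset.sum_le_sum fun m _ => ?_)
  rw [norm_mul, Complex.norm_conj]
  have := norm_sum_window_le a hx hQ.le (mem_Icc.mp hr).1 m
  nlinarith [norm_nonneg (a m)]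

theorem gcdKernel_eq_sum_divisors {q m n : ℕ} (hq : 1 ≤ q) (hm : 1 ≤ m) (hn : 1 ≤ n) :
    gcdKernel q m n = ∑ h ∈ q.divisors,
      if h ∣ m ∧ h ∣ n ∧ Nat.Coprime (q / h) ((m / h) * (n / h)) then
        1 / ((q / h).totient : ℝ) else 0 := by
  have key : ∀ h ∈ q.divisors, (h ∣ m ∧ h ∣ n ∧ Nat.Coprime (q / h) ((m / h) * (n / h))) ↔
      (h = n.gcd q ∧ m.gcd q = n.gcd q) := by
    intro h hh
    obtain ⟨k, rfl⟩ := Nat.dvd_of_mem_divisors hh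
    have hh0 : 0 < h := Nat.pos_of_mul_pos_right hq
    rw [Nat.mul_div_cancel_left _ hh0]
    constructor
    · rintro ⟨⟨m', rfl⟩, ⟨n', rfl⟩, h3⟩
      rw [Nat.mul_div_cancel_left _ hh0, Nat.mul_div_cancel_left _ hh0, Nat.coprime_mul_iff_right] at h3
      rw [Nat.gcd_mul_left, Nat.gcd_mul_left, Nat.gcd_comm n' k, Nat.gcd_comm m' k, h3.1, h3.2]
      simp
    · rintro ⟨h1, h2⟩
      have h3 : h = m.gcd (h * k) := by rw [h2]; exact h1
      have hdm : h ∣ m := by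
        have := Nat.gcd_dvd_left m (h * k); rwa [← h3] at this
      have hdn : h ∣ n := by
        have := Nat.gcd_dvd_left n (h * k); rwa [← h1] at this
      refine ⟨hdm, hdn, ?_⟩
      obtain ⟨m', rfl⟩ := hdm
      obtain ⟨n', rfl⟩ := hdn
      rw [Nat.mul_div_cancel_left _ hh0, Nat.mul_div_cancel_left _ hh0, Nat.coprime_mul_iff_right]
      rw [Nat.gcd_mul_left] at h1 h3
      refine ⟨?_, ?_⟩
      · rw [Nat.coprime_comm]; exact (Nat.eq_of_mul_eq_mul_left hh0 (by rw [← h3, mul_one]))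
      · rw [Nat.coprime_comm]; exact (Nat.eq_of_mul_eq_mul_left hh0 (by rw [← h1, mul_one]))
  rw [Finset.sum_congr rfl fun h hh => if_congr (key h hh) rfl rfl]
  unfold gcdKernel
  by_cases h : m.gcd q = n.gcd q
  · simp only [h, and_true, if_true]
    rw [Finset.sum_ite_eq', if_pos (Nat.mem_divisors.mpr ⟨Nat.gcd_dvd_right _ _, by omega⟩)]
  · simp [h]

theorem sum_gcdKernel_eq {m n : ℕ} (hm : 1 ≤ m) (hn : 1 ≤ n) (Z : ℕ) (p : ℕ → Prop) :
    ∑ q ∈ Icc 1 Z, (if p q then gcdKernel q m n else 0) =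
      ∑ h ∈ Icc 1 Z, if h ∣ m ∧ h ∣ n then
        ∑ k ∈ (Icc 1 (Z / h)).filter
          (fun k => p (h * k) ∧ Nat.Coprime k ((m / h) * (n / h))), 1 / (k.totient : ℝ) else 0 := by
  have h1 := sum_Icc_sum_divisors Z (fun h k =>
    if (h ∣ m ∧ h ∣ n) ∧ p (h * k) ∧ Nat.Coprime k ((m / h) * (n / h)) then
        1 / (k.totient : ℝ) else 0)
  convert h1 using 1
  · refine Finset.sum_congr rfl fun q hq => ?_
    have hq1 := (mem_Icc.mp hq).1
    by_cases hp : p q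
    · rw [if_pos hp, gcdKernel_eq_sum_divisors hq1 hm hn]
      refine Finset.sum_congr rfl fun h hh => ?_
      rw [Nat.mul_div_cancel' (Nat.dvd_of_mem_divisors hh)]
      simp only [hp, true_and, and_assoc]
    · rw [if_neg hp]
      symm
      refine Finset.sum_eq_zero fun h hh => ?_
      rw [Nat.mul_div_cancel' (Nat.dvd_of_mem_divisors hh), if_neg (by tauto)]
  · refine Finset.sum_congr rfl fun h _ => ?_
    by_cases hd : h ∣ m ∧ h ∣ n
    · rw [if_pos hd, Finset.sum_filter]
      simp only [hd, true_and, and_self]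
    · rw [if_neg hd]
      symm
      exact Finset.sum_eq_zero fun k _ => if_neg (by tauto)

/-- The index of the dyadic window containing the distance between `m` and `n`. -/
noncomputable def windowIndex (Q : ℝ) (m n : ℕ) : ℕ := ⌈2 * |(n : ℝ) - m| / Q⌉₊ - 1

theorem windowIndex_comm (Q : ℝ) (m n : ℕ) : windowIndex Q m n = windowIndex Q n m := by
  unfold windowIndex; rw [abs_sub_comm]

theorem window_iff {Q : ℝ} (hQ : 0 < Q) {h k m n : ℕ} (hh : 1 ≤ h) :
    Window Q (h * k) (h * m) (h * n) ↔
      k ≤ windowIndex Q m n ∧ (windowIndex Q m n : ℝ) < 2 * k := by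
  have hh0 : (0 : ℝ) < h := by exact_mod_cast hh
  unfold Window windowIndex
  set u := |(n : ℝ) - m| with hu
  have hu0 : 0 ≤ u := abs_nonneg _
  have h1 : |((h * n : ℕ) : ℝ) - (h * m : ℕ)| = h * u := by
    push_cast; rw [← mul_sub, abs_mul, abs_of_pos hh0]
  rw [h1]
  push_cast
  have h2 : (k : ℝ) < 2 * u / Q ↔ k < ⌈2 * u / Q⌉₊ := Nat.lt_ceil.symm
  have h3 : 2 * u / Q ≤ ((2 * k : ℕ) : ℝ) ↔ ⌈2 * u / Q⌉₊ ≤ 2 * k := Nat.ceil_le.symm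
  have h4 : Q * (h * k) / 2 < h * u ↔ (k : ℝ) < 2 * u / Q := by
    rw [lt_div_iff₀ hQ]
    constructor
    · intro hw; exact lt_of_mul_lt_mul_left (by linarith : (h : ℝ) * (k * Q) < h * (2 * u)) hh0.le
    · intro hw; have := mul_lt_mul_of_pos_left hw hh0; linarith
  have h5 : h * u ≤ Q * (h * k) ↔ 2 * u / Q ≤ ((2 * k : ℕ) : ℝ) := by
    rw [div_le_iff₀ hQ]
    push_cast
    constructor
    · intro hw; exact le_of_mul_le_mul_left (by linarith : (h : ℝ) * (2 * u) ≤ h * (2 * k * Q)) hh0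
    · intro hw; have := mul_le_mul_of_nonneg_left hw hh0.le; linarith
  rw [h4, h5, h2, h3]
  have h6 : ((⌈2 * u / Q⌉₊ - 1 : ℕ) : ℝ) < 2 * k ↔ ⌈2 * u / Q⌉₊ - 1 < 2 * k := by
    exact_mod_cast Iff.rfl
  rw [h6]
  omega

/-- The contribution of the common divisor `h` to `offKernel`. -/
noncomputable def gcdPiece (Q : ℝ) (h : ℕ) (D m n : ℕ) : ℝ :=
  copDyadic D (windowIndex Q m n) - copDyadic D (Q / h)

theorem offKernel_eq {x Q : ℝ} (hQ : 0 < Q) (hQx : 2 * x / Q ≤ Q) {m n : ℕ} (hm : m ∈ Icc 1 ⌊x⌋₊)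
    (hn : n ∈ Icc 1 ⌊x⌋₊) :
    offKernel x Q m n = ∑ h ∈ Icc 1 ⌊Q⌋₊, if h ∣ m ∧ h ∣ n then
      gcdPiece Q h ((m / h) * (n / h)) (m / h) (n / h) else 0 := by
  rw [mem_Icc] at hm hn
  have hmx : (m : ℝ) ≤ x := (Nat.le_floor_iff' (by omega)).mp hm.2
  have hnx : (n : ℝ) ≤ x := (Nat.le_floor_iff' (by omega)).mp hn.2
  have hm1 : (1 : ℝ) ≤ m := by exact_mod_cast hm.1
  have hn1 : (1 : ℝ) ≤ n := by exact_mod_cast hn.1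
  have hWr : ∀ r : ℕ, Window Q r m n → r ≤ ⌊2 * x / Q⌋₊ := by
    intro r hr
    refine Nat.le_floor ?_
    have h1 : |(n : ℝ) - m| ≤ x := by rw [abs_le]; constructor <;> linarith
    rw [le_div_iff₀ hQ]
    have := hr.1
    linarith
  have h1 : (∑ r ∈ Icc 1 ⌊2 * x / Q⌋₊, if Window Q r m n then gcdKernel r m n else 0) =
      ∑ r ∈ Icc 1 ⌊Q⌋₊, if Window Q r m n then gcdKernel r m n else 0 := by
    refine Finset.sum_subset (Icc_subset_Icc_right (Nat.floor_mono hQx)) fun r hr hr' => ?_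
    rw [if_neg]
    intro hw
    exact hr' (mem_Icc.mpr ⟨(mem_Icc.mp hr).1, hWr r hw⟩)
  have h2 : ∑ q ∈ Ioc ⌊Q / 2⌋₊ ⌊Q⌋₊, gcdKernel q m n =
      ∑ q ∈ Icc 1 ⌊Q⌋₊, if Q < 2 * (q : ℝ) then gcdKernel q m n else 0 := by
    rw [← Finset.sum_filter]
    congr 1
    ext q
    simp only [mem_Ioc, mem_filter, mem_Icc]
    rw [Nat.floor_lt (by positivity), div_lt_iff₀ two_pos, mul_comm (q : ℝ)]
    constructor
    · rintro ⟨h3, h4⟩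
      refine ⟨⟨?_, h4⟩, h3⟩
      by_contra h5
      have : q = 0 := by omega
      subst this
      simp at h3; linarith
    · tauto
  unfold offKernel
  rw [h1, h2, sum_gcdKernel_eq hm.1 hn.1, sum_gcdKernel_eq hm.1 hn.1, ← Finset.sum_sub_distrib]
  refine Finset.sum_congr rfl fun h hh => ?_
  rw [mem_Icc] at hh
  by_cases hd : h ∣ m ∧ h ∣ n
  · rw [if_pos hd, if_pos hd, if_pos hd]
    obtain ⟨⟨m', rfl⟩, ⟨n', rfl⟩⟩ := hd
    have hh0 : (0 : ℝ) < h := by exact_mod_cast hh.1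
    rw [Nat.mul_div_cancel_left _ hh.1, Nat.mul_div_cancel_left _ hh.1]
    unfold gcdPiece copDyadic
    congr 2
    · ext k
      simp only [mem_filter, mem_Icc, Nat.floor_natCast]
      constructor
      · rintro ⟨⟨h3, h4⟩, h5, h6⟩
        rw [window_iff hQ hh.1] at h5
        exact ⟨⟨h3, h5.1⟩, h5.2, h6⟩
      · rintro ⟨⟨h3, h4⟩, h5, h6⟩
        have hw := (window_iff hQ hh.1).mpr ⟨h4, h5⟩
        refine ⟨⟨h3, ?_⟩, hw, h6⟩
        rw [Nat.le_div_iff_mul_le hh.1, mul_comm]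
        exact (hWr _ hw).trans (Nat.floor_mono hQx)
    · ext k
      simp only [mem_filter, mem_Icc, Nat.floor_div_natCast]
      have : Q < 2 * ((h * k : ℕ) : ℝ) ↔ Q / h < 2 * k := by
        rw [div_lt_iff₀ hh0]; push_cast; ring_nf
      rw [this]
  · rw [if_neg hd, if_neg hd, if_neg hd, sub_zero]

theorem sum_Icc_filter_dvd {M : Type*} [AddCommMonoid M] (N : ℕ) {h : ℕ} (hh : 1 ≤ h) (F : ℕ → M) :
    ∑ n ∈ (Icc 1 N).filter (fun n => h ∣ n), F n = ∑ n ∈ Icc 1 (N / h), F (h * n) := by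
  symm
  refine Finset.sum_nbij' (fun s => h * s) (fun m => m / h) ?_ ?_ ?_ ?_ ?_
  · intro s hs
    simp only [mem_filter, mem_Icc, Nat.le_div_iff_mul_le hh] at hs ⊢
    exact ⟨⟨Nat.mul_pos hh hs.1, by linarith [mul_comm h s]⟩, Dvd.intro _ rfl⟩
  · intro m hm
    simp only [mem_filter, mem_Icc] at hm ⊢
    exact ⟨Nat.div_pos (Nat.le_of_dvd hm.1.1 hm.2) hh, Nat.div_le_div_right hm.1.2⟩
  · intro s _; exact Nat.mul_div_cancel_left _ hh
  · intro m hm; exact Nat.mul_div_cancel' (mem_filter.mp hm).2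
  · intro s _; rfl

theorem offForm_eq (a : ℕ → ℂ) {x Q : ℝ} (hQ : 0 < Q) (hQx : 2 * x / Q ≤ Q) :
    offForm a x Q = ∑ h ∈ Icc 1 ⌊Q⌋₊, ∑ m ∈ Icc 1 (⌊x⌋₊ / h), ∑ n ∈ Icc 1 (⌊x⌋₊ / h),
      conj (a (h * m)) * a (h * n) * (gcdPiece Q h (m * n) m n : ℂ) := by
  unfold offForm
  rw [Finset.sum_congr rfl fun m hm => Finset.sum_congr rfl fun n hn => by
    rw [offKernel_eq hQ hQx hm hn, Complex.ofReal_sum, Finset.mul_sum]]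
  rw [Finset.sum_congr rfl fun m _ => Finset.sum_comm, Finset.sum_comm]
  refine Finset.sum_congr rfl fun h hh => ?_
  have hh1 := (mem_Icc.mp hh).1
  calc _ = ∑ m ∈ (Icc 1 ⌊x⌋₊).filter (fun m => h ∣ m), ∑ n ∈ (Icc 1 ⌊x⌋₊).filter (fun n => h ∣ n),
        conj (a m) * a n * (gcdPiece Q h ((m / h) * (n / h)) (m / h) (n / h) : ℂ) := by
        rw [Finset.sum_filter]
        refine Finset.sum_congr rfl fun m _ => ?_
        by_cases hm : h ∣ m
        · rw [if_pos hm, Finset.sum_filter]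
          refine Finset.sum_congr rfl fun n _ => ?_
          by_cases hn : h ∣ n <;> simp [hm, hn]
        · simp [hm]
    _ = _ := by
        rw [sum_Icc_filter_dvd _ hh1]
        refine Finset.sum_congr rfl fun m _ => ?_
        rw [sum_Icc_filter_dvd _ hh1]
        refine Finset.sum_congr rfl fun n _ => ?_
        rw [Nat.mul_div_cancel_left _ hh1, Nat.mul_div_cancel_left _ hh1]

theorem abs_copDyadic_sub_smoothPart_le {P x : ℝ} (hP : 3 ≤ P) {m n : ℕ} (hm : 1 ≤ m) (hn : 1 ≤ n)
    (hmx : (m : ℝ) ≤ x) (hnx : (n : ℝ) ≤ x) (z : ℝ) :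
    |copDyadic (m * n) z - copDyadic (smoothPart P m * smoothPart P n) z| ≤
      18 * (Real.log x / (P * Real.log P)) := by
  have hm0 : m ≠ 0 := by omega
  have hn0 : n ≠ 0 := by omega
  have hlP := one_lt_log_of_three_le hP
  refine (abs_copDyadic_sub_le (mul_ne_zero hm0 hn0)
    (mul_dvd_mul (smoothPart_dvd P hm0) (smoothPart_dvd P hn0)) z).trans ?_
  set s := (m * n).primeFactors.filter (fun p => ¬ p ∣ smoothPart P m * smoothPart P n)
  have hs : ∀ p ∈ s, P < (p : ℝ) := by
    intro p hp
    obtain ⟨hp1, hp2⟩ := mem_filter.mp hp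
    have hpp := Nat.prime_of_mem_primeFactors hp1
    by_contra hle
    rw [not_lt] at hle
    have hsm : IsSmooth P p := isSmooth_of_le hpp.ne_zero hle
    refine hp2 ?_
    rcases (Nat.Prime.dvd_mul hpp).mp (Nat.dvd_of_mem_primeFactors hp1) with h | h
    · exact (dvd_smoothPart hm0 hsm h).mul_right _
    · exact (dvd_smoothPart hn0 hsm h).mul_left _
  have h1 : ∀ p ∈ s, (6 : ℝ) / ((p : ℝ) - 1) ≤ 9 / (P * Real.log P) * Real.log p := by
    intro p hp
    have hpP := hs p hp
    have hl : Real.log P ≤ Real.log p := Real.log_le_log (by linarith) hpP.le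
    rw [div_mul_eq_mul_div, div_le_div_iff₀ (by linarith) (by positivity)]
    have : P * Real.log P ≤ P * Real.log p := by gcongr
    have h3 : 0 < Real.log p := by linarith
    nlinarith
  calc ∑ p ∈ s, (6 : ℝ) / ((p : ℝ) - 1) ≤ ∑ p ∈ s, 9 / (P * Real.log P) * Real.log p :=
        Finset.sum_le_sum h1
    _ = 9 / (P * Real.log P) * ∑ p ∈ s, Real.log p := (Finset.mul_sum _ _ _).symm
    _ ≤ 9 / (P * Real.log P) * ∑ p ∈ (m * n).primeFactors, Real.log p := by
        refine mul_le_mul_of_nonneg_left ?_ (by positivity)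
        exact Finset.sum_le_sum_of_subset_of_nonneg (filter_subset _ _)
          (fun p _ _ => Real.log_natCast_nonneg p)
    _ ≤ 9 / (P * Real.log P) * (2 * Real.log x) := by
        refine mul_le_mul_of_nonneg_left ?_ (by positivity)
        refine (sum_primeFactors_log_le (mul_ne_zero hm0 hn0)).trans ?_
        have hm' : (0 : ℝ) < m := by positivity
        have hn' : (0 : ℝ) < n := by positivity
        rw [Nat.cast_mul, Real.log_mul hm'.ne' hn'.ne', two_mul]
        exact add_le_add (Real.log_le_log hm' hmx) (Real.log_le_log hn' hnx)
    _ = _ := by ring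

/-- The bilinear form in which coprimality is only tested on smooth parts. -/
noncomputable def smoothForm (a : ℕ → ℂ) (x Q P : ℝ) : ℂ :=
  ∑ h ∈ Icc 1 ⌊Q⌋₊, ∑ m ∈ Icc 1 (⌊x⌋₊ / h), ∑ n ∈ Icc 1 (⌊x⌋₊ / h),
      conj (a (h * m)) * a (h * n) * (gcdPiece Q h (smoothPart P m * smoothPart P n) m n : ℂ)

theorem concLHS_eq (a : ℕ → ℂ) (x Q H : ℝ) :
    concLHS a x Q H = ∑ h ∈ (Icc 1 ⌊Q⌋₊).filter (fun h : ℕ => H ≤ (h : ℝ)),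
      (∑ m ∈ Icc 1 (⌊x⌋₊ / h), ‖a (h * m)‖) ^ 2 := by
  unfold concLHS
  refine Finset.sum_congr rfl fun h hh => ?_
  rw [sum_Icc_filter_dvd _ (mem_Icc.mp (mem_filter.mp hh).1).1]

theorem norm_offForm_sub_smoothForm_le (a : ℕ → ℂ) {x Q P : ℝ} (hP : 3 ≤ P) (hQ : 0 < Q)
    (hQx : 2 * x / Q ≤ Q) :
    ‖offForm a x Q - smoothForm a x Q P‖ ≤
      36 * (Real.log x / (P * Real.log P)) * concLHS a x Q 1 := by
  rw [offForm_eq a hQ hQx, smoothForm, ← Finset.sum_sub_distrib, concLHS_eq, Finset.mul_sum]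
  have h1 : (Icc 1 ⌊Q⌋₊).filter (fun h : ℕ => (1 : ℝ) ≤ (h : ℝ)) = Icc 1 ⌊Q⌋₊ :=
    Finset.filter_true_of_mem fun h hh => by exact_mod_cast (mem_Icc.mp hh).1
  rw [h1]
  refine (norm_sum_le _ _).trans (Finset.sum_le_sum fun h hh => ?_)
  rw [← Finset.sum_sub_distrib, sq, Finset.sum_mul_sum, Finset.mul_sum]
  refine (norm_sum_le _ _).trans (Finset.sum_le_sum fun m hm => ?_)
  rw [← Finset.sum_sub_distrib, Finset.mul_sum]
  refine (norm_sum_le _ _).trans (Finset.sum_le_sum fun n hn => ?_)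
  have hb : ∀ k ∈ Icc 1 (⌊x⌋₊ / h), (k : ℝ) ≤ x := by
    intro k hk
    rw [mem_Icc] at hk
    exact (Nat.le_floor_iff' (by omega)).mp (hk.2.trans (Nat.div_le_self _ _))
  have key := fun z => abs_copDyadic_sub_smoothPart_le hP (mem_Icc.mp hm).1 (mem_Icc.mp hn).1
    (hb m hm) (hb n hn) z
  have h2 : |gcdPiece Q h (m * n) m n - gcdPiece Q h (smoothPart P m * smoothPart P n) m n| ≤
      36 * (Real.log x / (P * Real.log P)) := by
    have k1 := abs_le.mp (key (windowIndex Q m n))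
    have k2 := abs_le.mp (key (Q / h))
    unfold gcdPiece
    rw [abs_le]; constructor <;> linarith
  rw [← mul_sub, norm_mul, norm_mul, Complex.norm_conj, ← Complex.ofReal_sub, Complex.norm_real,
    Real.norm_eq_abs, mul_comm (36 * _)]
  gcongr

theorem sum_tau_smoothPart_le {P : ℝ} (hP : 3 ≤ P) (M : ℕ) :
    ∑ m ∈ Icc 1 M, (tau (smoothPart P m) : ℝ) ≤ M * (smoothConst * Real.log P) := by
  calc ∑ m ∈ Icc 1 M, (tau (smoothPart P m) : ℝ)
      ≤ ∑ m ∈ Icc 1 M, ∑ e ∈ m.divisors, (if IsSmooth P e then (1 : ℝ) else 0) := by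
        refine Finset.sum_le_sum fun m hm => ?_
        have hm0 : m ≠ 0 := by have := (mem_Icc.mp hm).1; omega
        rw [Finset.sum_boole]
        unfold tau
        exact_mod_cast Finset.card_le_card fun e he => mem_filter.mpr
          ⟨Nat.divisors_subset_of_dvd hm0 (smoothPart_dvd P hm0) he,
            (isSmooth_smoothPart P m).of_dvd (Nat.dvd_of_mem_divisors he)⟩
    _ = ∑ e ∈ Icc 1 M, ∑ l ∈ Icc 1 (M / e), (if IsSmooth P e then (1 : ℝ) else 0) :=
        sum_Icc_sum_divisors M (fun e _ => if IsSmooth P e then (1 : ℝ) else 0)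
    _ ≤ ∑ e ∈ Icc 1 M, (if IsSmooth P e then M * (1 / (e : ℝ)) else 0) := by
        refine Finset.sum_le_sum fun e _ => ?_
        simp only [sum_const, Nat.card_Icc, nsmul_eq_mul, Nat.add_sub_cancel]
        split_ifs
        · rw [mul_one_div, mul_one]; exact Nat.cast_div_le
        · simp
    _ = M * ∑ e ∈ (Icc 1 M).filter (IsSmooth P), 1 / (e : ℝ) := by
        rw [← Finset.sum_filter, Finset.mul_sum]
    _ ≤ _ := mul_le_mul_of_nonneg_left (sum_smooth_inv_le hP _ fun d hd => (mem_filter.mp hd).2)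
        (by positivity)

theorem sum_tau_smoothPart_tail_le {P R : ℝ} (hP : 3 ≤ P) (hR : 0 < R) (M : ℕ) :
    ∑ m ∈ (Icc 1 M).filter (fun m : ℕ => ¬ (smoothPart P m : ℝ) ≤ R), (tau (smoothPart P m) : ℝ) ≤
      M * ((smoothConst * Real.log P) ^ 2 / R ^ (1 / Real.log P)) := by
  calc _ ≤ ∑ m ∈ Icc 1 M, ∑ e ∈ m.divisors, (if IsSmooth P e ∧ R < e then (tau e : ℝ) else 0) := by
        rw [Finset.sum_filter]
        refine Finset.sum_le_sum fun m hm => ?_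
        have hm0 : m ≠ 0 := by have := (mem_Icc.mp hm).1; omega
        have hnn : ∀ e ∈ m.divisors, (0 : ℝ) ≤ if IsSmooth P e ∧ R < e then (tau e : ℝ) else 0 :=
          fun e _ => by split_ifs <;> positivity
        split_ifs with h
        · exact Finset.sum_nonneg hnn
        · refine le_trans ?_ (Finset.single_le_sum hnn
            (Nat.mem_divisors.mpr ⟨smoothPart_dvd P hm0, hm0⟩))
          rw [if_pos ⟨isSmooth_smoothPart P m, not_le.mp h⟩]
    _ = ∑ e ∈ Icc 1 M, ∑ l ∈ Icc 1 (M / e), (if IsSmooth P e ∧ R < e then (tau e : ℝ) else 0) :=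
        sum_Icc_sum_divisors M (fun e _ => if IsSmooth P e ∧ R < e then (tau e : ℝ) else 0)
    _ ≤ ∑ e ∈ Icc 1 M, (if IsSmooth P e ∧ R < e then M * ((tau e : ℝ) / (e : ℝ)) else 0) := by
        refine Finset.sum_le_sum fun e _ => ?_
        simp only [sum_const, Nat.card_Icc, nsmul_eq_mul, Nat.add_sub_cancel]
        split_ifs
        · have : ((M / e : ℕ) : ℝ) ≤ (M : ℝ) / e := Nat.cast_div_le
          calc ((M / e : ℕ) : ℝ) * tau e ≤ (M : ℝ) / e * tau e := by gcongr
            _ = _ := by ring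
        · simp
    _ = M * ∑ e ∈ (Icc 1 M).filter (fun d : ℕ => IsSmooth P d ∧ R < d), (tau e : ℝ) / (e : ℝ) := by
        rw [← Finset.sum_filter, Finset.mul_sum]
    _ ≤ _ := mul_le_mul_of_nonneg_left (sum_smooth_tau_div_tail_le hP hR M) (by positivity)

theorem card_Icc_filter_dvd_le {u v e : ℕ} (he : 1 ≤ e) (huv : u ≤ v) :
    (((Icc u v).filter (fun n => e ∣ n)).card : ℝ) ≤ ((v : ℝ) - u) / e + 1 := by
  have h : ((Icc u v).filter (fun n => e ∣ n)).card ≤ (range ((v - u) / e + 1)).card := by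
    refine Finset.card_le_card_of_injOn (fun n => (n - u) / e) ?_ ?_
    · intro n hn
      simp only [coe_filter, mem_Icc, Set.mem_ofPred_eq] at hn
      simp only [coe_range, Set.mem_Iio]
      exact Nat.lt_succ_of_le (Nat.div_le_div_right (by omega))
    · intro n hn n' hn' hnn
      simp only [coe_filter, mem_Icc, Set.mem_ofPred_eq] at hn hn'
      obtain ⟨⟨h1, _⟩, k, rfl⟩ := hn
      obtain ⟨⟨h2, _⟩, k', rfl⟩ := hn'
      have key : ∀ i j : ℕ, u ≤ e * i → i < j → (e * i - u) / e < (e * j - u) / e := by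
        intro i j hi hij
        have : e * i + e ≤ e * j := by nlinarith
        have h3 : e * j - u ≥ (e * i - u) + e := by omega
        calc (e * i - u) / e < (e * i - u) / e + 1 := Nat.lt_succ_self _
          _ = ((e * i - u) + e) / e := (Nat.add_div_right _ he).symm
          _ ≤ _ := Nat.div_le_div_right h3
      rcases lt_trichotomy k k' with h | h | h
      · exact absurd hnn (key k k' h1 h).ne
      · rw [h]
      · exact absurd hnn (key k' k h2 h).ne'
  rw [card_range] at h
  calc (((Icc u v).filter (fun n => e ∣ n)).card : ℝ) ≤ (((v - u) / e + 1 : ℕ) : ℝ) := by exact_mod_cast h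
    _ ≤ _ := by
        push_cast
        have : (((v - u) / e : ℕ) : ℝ) ≤ ((v - u : ℕ) : ℝ) / e := Nat.cast_div_le
        rw [Nat.cast_sub huv] at this
        linarith

theorem tau_le_two_mul_card (n : ℕ) :
    tau n ≤ 2 * (n.divisors.filter (fun e => e * e ≤ n)).card := by
  unfold tau
  rw [← Finset.card_filter_add_card_filter_not (s := n.divisors) (fun e => e * e ≤ n), two_mul]
  refine Nat.add_le_add_left ?_ _
  refine Finset.card_le_card_of_injOn (fun e => n / e) ?_ ?_
  · intro e he
    simp only [coe_filter, Nat.mem_divisors, Set.mem_ofPred_eq, not_le] at he ⊢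
    obtain ⟨⟨⟨k, rfl⟩, h0⟩, h1⟩ := he
    have he0 : 0 < e := Nat.pos_of_ne_zero (by rintro rfl; simp at h0)
    rw [Nat.mul_div_cancel_left _ he0]
    refine ⟨⟨Dvd.intro_left _ rfl, h0⟩, ?_⟩
    have : k < e := lt_of_mul_lt_mul_left h1 (Nat.zero_le _)
    exact Nat.mul_le_mul_right _ this.le
  · intro e he e' he' h
    simp only [coe_filter, Nat.mem_divisors, Set.mem_ofPred_eq] at he he'
    have h' : n / e = n / e' := h
    rw [← Nat.div_div_self he.1.1 he.1.2, h', Nat.div_div_self he'.1.1 he'.1.2]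

theorem sum_tau_interval_le {u v : ℕ} (hu : 1 ≤ u) (huv : u ≤ v) :
    ∑ n ∈ Icc u v, (tau n : ℝ) ≤ 2 * (((v : ℝ) - u) * (1 + Real.log v) + Real.sqrt v) := by
  have hvu : 0 ≤ (v : ℝ) - u := by
    have : (u : ℝ) ≤ v := by exact_mod_cast huv
    linarith
  calc ∑ n ∈ Icc u v, (tau n : ℝ)
      ≤ ∑ n ∈ Icc u v, ∑ e ∈ Icc 1 (Nat.sqrt v), (if e ∣ n then (2 : ℝ) else 0) := by
        refine Finset.sum_le_sum fun n hn => ?_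
        rw [mem_Icc] at hn
        rw [← Finset.sum_filter, Finset.sum_const, nsmul_eq_mul]
        have h1 := tau_le_two_mul_card n
        have h2 : (n.divisors.filter (fun e => e * e ≤ n)).card ≤
            ((Icc 1 (Nat.sqrt v)).filter (fun e => e ∣ n)).card := by
          refine Finset.card_le_card fun e he => ?_
          simp only [mem_filter, Nat.mem_divisors, mem_Icc] at he ⊢
          exact ⟨⟨Nat.pos_of_dvd_of_pos he.1.1 (by omega), Nat.le_sqrt.mpr (by omega)⟩, he.1.1⟩
        have h3 : tau n ≤ ((Icc 1 (Nat.sqrt v)).filter (fun e => e ∣ n)).card * 2 := by omega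
        exact_mod_cast h3
    _ = ∑ e ∈ Icc 1 (Nat.sqrt v), 2 * (((Icc u v).filter (fun n => e ∣ n)).card : ℝ) := by
        rw [Finset.sum_comm]
        refine Finset.sum_congr rfl fun e _ => ?_
        rw [← Finset.sum_filter, Finset.sum_const, nsmul_eq_mul, mul_comm]
    _ ≤ ∑ e ∈ Icc 1 (Nat.sqrt v), 2 * (((v : ℝ) - u) * (1 / (e : ℝ)) + 1) := by
        refine Finset.sum_le_sum fun e he => ?_
        have := card_Icc_filter_dvd_le (mem_Icc.mp he).1 huv
        rw [mul_one_div]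
        linarith
    _ = 2 * (((v : ℝ) - u) * ∑ e ∈ Icc 1 (Nat.sqrt v), 1 / (e : ℝ) + Nat.sqrt v) := by
        rw [← Finset.mul_sum, Finset.sum_add_distrib, ← Finset.mul_sum]
        simp
    _ ≤ _ := by
        have h1 := sum_Icc_inv_le (Nat.sqrt v)
        have h2 : Real.log (Nat.sqrt v) ≤ Real.log v := by
          refine Real.log_le_log ?_ (by exact_mod_cast Nat.sqrt_le_self v)
          exact_mod_cast Nat.sqrt_pos.mpr (by omega)
        have h3 : ((Nat.sqrt v : ℕ) : ℝ) ≤ Real.sqrt v := Real.nat_sqrt_le_real_sqrt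
        gcongr
        linarith

theorem norm_bilinear_sub_le (s : Finset ℕ) (b : ℕ → ℂ) {w : ℕ → ℕ → ℝ} (hw : ∀ m n, w m n = w n m)
    (good : ℕ → Prop) (α : ℂ) {D : ℕ → ℂ}
    (hD : ∀ n, D n = ∑ m ∈ s, b m * (w m n : ℂ) - α * ∑ m ∈ s.filter good, (w m n : ℂ)) :
    ‖∑ m ∈ s, ∑ n ∈ s, conj (b m) * b n * (w m n : ℂ)
        - ((‖α‖ ^ 2 : ℝ) : ℂ) * ∑ m ∈ s, ∑ n ∈ s, (w m n : ℂ)‖ ≤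
      ∑ m ∈ s, ‖b m‖ * ‖D m‖ + ‖α‖ * ∑ m ∈ s, ‖D m‖
        + 2 * ‖α‖ ^ 2 * ∑ m ∈ s.filter (fun m => ¬ good m), ∑ n ∈ s, |w m n| := by
  have hα : ((‖α‖ ^ 2 : ℝ) : ℂ) = α * conj α := by
    rw [Complex.mul_conj']; push_cast; rfl
  have h1 : ∑ m ∈ s, ∑ n ∈ s, conj (b m) * b n * (w m n : ℂ) =
      ∑ m ∈ s, conj (b m) * D m + α * ∑ n ∈ s.filter good, conj (D n)
        + α * conj α * ∑ m ∈ s.filter good, ∑ n ∈ s.filter good, (w m n : ℂ) := by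
    have e1 : ∑ m ∈ s, ∑ n ∈ s, conj (b m) * b n * (w m n : ℂ) =
        ∑ m ∈ s, conj (b m) * D m
          + α * ∑ m ∈ s, ∑ n ∈ s.filter good, conj (b m) * (w m n : ℂ) := by
      rw [Finset.mul_sum, ← Finset.sum_add_distrib]
      refine Finset.sum_congr rfl fun m _ => ?_
      rw [hD m, mul_sub, Finset.mul_sum, Finset.mul_sum]
      have : ∀ n, (w m n : ℂ) = (w n m : ℂ) := fun n => by rw [hw]
      simp only [this]
      rw [← Finset.mul_sum, ← Finset.mul_sum, Finset.sum_congr rfl fun n _ =>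
        mul_assoc (conj (b m)) (b n) (w n m : ℂ), ← Finset.mul_sum, ← Finset.mul_sum]
      ring
    have e2 : ∑ m ∈ s, ∑ n ∈ s.filter good, conj (b m) * (w m n : ℂ) =
        ∑ n ∈ s.filter good, conj (D n)
          + conj α * ∑ m ∈ s.filter good, ∑ n ∈ s.filter good, (w m n : ℂ) := by
      have e3 : ∑ m ∈ s.filter good, ∑ n ∈ s.filter good, (w m n : ℂ) =
        ∑ n ∈ s.filter good, ∑ m ∈ s.filter good, (w m n : ℂ) := Finset.sum_comm
      rw [Finset.sum_comm, e3, Finset.mul_sum, ← Finset.sum_add_distrib]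
      refine Finset.sum_congr rfl fun n _ => ?_
      rw [hD n]
      simp only [map_sub, map_sum, map_mul, Complex.conj_ofReal]
      ring
    rw [e1, e2]; ring
  have h2 : ∑ m ∈ s, ∑ n ∈ s, (w m n : ℂ) =
      ∑ m ∈ s.filter good, ∑ n ∈ s.filter good, (w m n : ℂ)
      + ∑ m ∈ s.filter good, ∑ n ∈ s.filter (fun m => ¬ good m), (w m n : ℂ)
      + ∑ m ∈ s.filter (fun m => ¬ good m), ∑ n ∈ s, (w m n : ℂ) := by
    rw [← Finset.sum_filter_add_sum_filter_not s good, ← Finset.sum_add_distrib]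
    congr 1
    exact Finset.sum_congr rfl fun m _ => (Finset.sum_filter_add_sum_filter_not s good _).symm
  rw [h1, h2, hα]
  have h3 : ‖∑ m ∈ s.filter good, ∑ n ∈ s.filter (fun m => ¬ good m), (w m n : ℂ)‖ ≤
      ∑ m ∈ s.filter (fun m => ¬ good m), ∑ n ∈ s, |w m n| := by
    rw [Finset.sum_comm]
    refine (norm_sum_le _ _).trans (Finset.sum_le_sum fun n _ => (norm_sum_le _ _).trans ?_)
    refine (Finset.sum_le_sum_of_subset_of_nonneg (filter_subset _ _)
      (fun _ _ _ => norm_nonneg _)).trans (Finset.sum_le_sum fun m _ => ?_)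
    rw [Complex.norm_real, hw, Real.norm_eq_abs]
  have h4 : ‖∑ m ∈ s.filter (fun m => ¬ good m), ∑ n ∈ s, (w m n : ℂ)‖ ≤
      ∑ m ∈ s.filter (fun m => ¬ good m), ∑ n ∈ s, |w m n| := by
    refine (norm_sum_le _ _).trans (Finset.sum_le_sum fun n _ => (norm_sum_le _ _).trans ?_)
    exact Finset.sum_le_sum fun m _ => by rw [Complex.norm_real, Real.norm_eq_abs]
  have h5 : ‖∑ m ∈ s, conj (b m) * D m‖ ≤ ∑ m ∈ s, ‖b m‖ * ‖D m‖ :=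
    (norm_sum_le _ _).trans (Finset.sum_le_sum fun m _ => by rw [norm_mul, Complex.norm_conj])
  have h6 : ‖α * ∑ n ∈ s.filter good, conj (D n)‖ ≤ ‖α‖ * ∑ m ∈ s, ‖D m‖ := by
    rw [norm_mul]
    refine mul_le_mul_of_nonneg_left ?_ (norm_nonneg _)
    refine (norm_sum_le _ _).trans ?_
    simp only [Complex.norm_conj]
    exact Finset.sum_le_sum_of_subset_of_nonneg (filter_subset _ _) (fun _ _ _ => norm_nonneg _)
  set G := ∑ m ∈ s.filter good, ∑ n ∈ s.filter good, (w m n : ℂ)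
  set U := ∑ m ∈ s.filter good, ∑ n ∈ s.filter (fun m => ¬ good m), (w m n : ℂ)
  set V := ∑ m ∈ s.filter (fun m => ¬ good m), ∑ n ∈ s, (w m n : ℂ)
  set B := ∑ m ∈ s, conj (b m) * D m
  set E := α * ∑ n ∈ s.filter good, conj (D n)
  set T := ∑ m ∈ s.filter (fun m => ¬ good m), ∑ n ∈ s, |w m n|
  have h7 : B + E + α * conj α * G - α * conj α * (G + U + V) = B + E - α * conj α * (U + V) := by
    ring
  rw [h7]
  have h8 : ‖α * conj α * (U + V)‖ ≤ 2 * ‖α‖ ^ 2 * T := by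
    rw [norm_mul, norm_mul, Complex.norm_conj]
    have := norm_add_le U V
    nlinarith [sq_nonneg ‖α‖]
  have := norm_sub_le (B + E) (α * conj α * (U + V))
  have := norm_add_le B E
  linarith

theorem windowIndex_mul_le {Q : ℝ} (hQ : 0 < Q) (m n : ℕ) :
    (windowIndex Q m n : ℝ) * Q ≤ 2 * |(n : ℝ) - m| := by
  unfold windowIndex
  have hu : 0 ≤ |(n : ℝ) - m| := abs_nonneg _
  set u := |(n : ℝ) - m|
  rcases Nat.eq_zero_or_pos (⌈2 * u / Q⌉₊ - 1) with h | h
  · rw [h]; simpa using hu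
  · have h1 : ⌈2 * u / Q⌉₊ - 1 < ⌈2 * u / Q⌉₊ := by omega
    rw [Nat.lt_ceil, lt_div_iff₀ hQ] at h1
    exact h1.le

theorem le_windowIndex_mul {Q : ℝ} (hQ : 0 < Q) (m n : ℕ) :
    2 * |(n : ℝ) - m| ≤ ((windowIndex Q m n : ℝ) + 1) * Q := by
  unfold windowIndex
  set u := |(n : ℝ) - m|
  have h1 : 2 * u / Q ≤ ⌈2 * u / Q⌉₊ := Nat.le_ceil _
  rw [div_le_iff₀ hQ] at h1
  refine h1.trans ?_
  gcongr
  have : ⌈2 * u / Q⌉₊ ≤ (⌈2 * u / Q⌉₊ - 1) + 1 := by omega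
  exact_mod_cast this

theorem windowIndex_mono {Q : ℝ} (hQ : 0 < Q) {m m' n n' : ℕ}
    (h : |(n : ℝ) - m| ≤ |(n' : ℝ) - m'|) : windowIndex Q m n ≤ windowIndex Q m' n' := by
  unfold windowIndex
  refine Nat.sub_le_sub_right (Nat.ceil_mono ?_) 1
  gcongr

theorem norm_sum_le_of_windows {E : Type*} [SeminormedAddCommGroup E] {Q : ℝ} (hQ : 0 < Q)
    {M n J : ℕ} (G : ℕ → E) {B : ℕ → ℝ} (hB : ∀ j, 0 ≤ B j)
    (hJ : ∀ m ∈ Icc 1 M, windowIndex Q m n ≤ J)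
    (hG : ∀ j u v : ℕ, 1 ≤ u → u ≤ v → v ≤ M → (v : ℝ) - u ≤ Q / 2 →
      (∀ m ∈ Icc u v, windowIndex Q m n = j) → ‖∑ m ∈ Icc u v, G m‖ ≤ B j) :
    ‖∑ m ∈ Icc 1 M, G m‖ ≤ 2 * ∑ j ∈ range (J + 1), B j := by
  have hpiece : ∀ (j : ℕ) (s : Finset ℕ), s ⊆ Icc 1 M →
      (∀ u ∈ s, ∀ v ∈ s, ∀ w, u ≤ w → w ≤ v → w ∈ s) → (∀ m ∈ s, windowIndex Q m n = j) →
      ((∀ m ∈ s, n ≤ m) ∨ (∀ m ∈ s, m ≤ n)) → ‖∑ m ∈ s, G m‖ ≤ B j := by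
    intro j s hsub hconn hidx hside
    rcases s.eq_empty_or_nonempty with rfl | hs
    · simpa using hB j
    have hmin := s.min'_mem hs
    have hmax := s.max'_mem hs
    have heq := eq_Icc_of_ordConnected hs hconn
    set u := s.min' hs
    set v := s.max' hs
    rw [heq]
    have huv : u ≤ v := s.min'_le _ hmax
    have huv' : (u : ℝ) ≤ v := by exact_mod_cast huv
    refine hG j u v (mem_Icc.mp (hsub hmin)).1 huv (mem_Icc.mp (hsub hmax)).2 ?_
      (fun m hm => hidx m (by rw [heq]; exact hm))
    have h1 := windowIndex_mul_le hQ u n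
    have h2 := le_windowIndex_mul hQ v n
    have h3 := windowIndex_mul_le hQ v n
    have h4 := le_windowIndex_mul hQ u n
    rw [hidx u hmin] at h1 h4
    rw [hidx v hmax] at h2 h3
    rcases hside with hside | hside
    · have h5 : (n : ℝ) ≤ u := by exact_mod_cast hside u hmin
      rw [abs_of_nonpos (by linarith)] at h1 h2
      linarith
    · have h5 : (v : ℝ) ≤ n := by exact_mod_cast hside v hmax
      rw [abs_of_nonneg (by linarith)] at h3 h4
      linarith
  have hsplit : ∑ m ∈ Icc 1 M, G m = ∑ j ∈ range (J + 1),
      (∑ m ∈ ((Icc 1 M).filter (fun m => windowIndex Q m n = j)).filter (fun m => n ≤ m), G m +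
       ∑ m ∈ ((Icc 1 M).filter (fun m => windowIndex Q m n = j)).filter (fun m => ¬ n ≤ m), G m) := by
    rw [← Finset.sum_fiberwise_of_maps_to (t := range (J + 1)) (g := fun m => windowIndex Q m n)
      (fun m hm => mem_range.mpr (Nat.lt_succ_of_le (hJ m hm)))]
    exact Finset.sum_congr rfl fun j _ => (Finset.sum_filter_add_sum_filter_not _ _ _).symm
  rw [hsplit, Finset.mul_sum]
  refine (norm_sum_le _ _).trans (Finset.sum_le_sum fun j _ => (norm_add_le _ _).trans ?_)
  have k1 := hpiece j (((Icc 1 M).filter (fun m => windowIndex Q m n = j)).filter (fun m => n ≤ m))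
    ((filter_subset _ _).trans (filter_subset _ _)) (by
      intro u hu v hv w huw hwv
      simp only [mem_filter, mem_Icc] at hu hv ⊢
      have h1 : (n : ℝ) ≤ u := by exact_mod_cast hu.2
      have h2 : (u : ℝ) ≤ w := by exact_mod_cast huw
      have h3 : (w : ℝ) ≤ v := by exact_mod_cast hwv
      refine ⟨⟨by omega, le_antisymm ?_ ?_⟩, by omega⟩
      · rw [← hv.1.2]
        refine windowIndex_mono hQ ?_
        rw [abs_of_nonpos (by linarith), abs_of_nonpos (by linarith)]; linarith
      · rw [← hu.1.2]
        refine windowIndex_mono hQ ?_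
        rw [abs_of_nonpos (by linarith), abs_of_nonpos (by linarith)]; linarith)
    (fun m hm => (mem_filter.mp (mem_filter.mp hm).1).2) (Or.inl fun m hm => (mem_filter.mp hm).2)
  have k2 := hpiece j (((Icc 1 M).filter (fun m => windowIndex Q m n = j)).filter (fun m => ¬ n ≤ m))
    ((filter_subset _ _).trans (filter_subset _ _)) (by
      intro u hu v hv w huw hwv
      simp only [mem_filter, mem_Icc, not_le] at hu hv ⊢
      have h1 : (v : ℝ) ≤ n := by exact_mod_cast hv.2.le
      have h2 : (u : ℝ) ≤ w := by exact_mod_cast huw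
      have h3 : (w : ℝ) ≤ v := by exact_mod_cast hwv
      refine ⟨⟨by omega, le_antisymm ?_ ?_⟩, by omega⟩
      · rw [← hu.1.2]
        refine windowIndex_mono hQ ?_
        rw [abs_of_nonneg (by linarith), abs_of_nonneg (by linarith)]; linarith
      · rw [← hv.1.2]
        refine windowIndex_mono hQ ?_
        rw [abs_of_nonneg (by linarith), abs_of_nonneg (by linarith)]; linarith)
    (fun m hm => (mem_filter.mp (mem_filter.mp hm).1).2)
    (Or.inr fun m hm => (not_le.mp (mem_filter.mp hm).2).le)
  linarith

theorem abs_copDyadic_sub_le_max {D j : ℕ} (hD : D ≠ 0) {z X : ℝ} (hX : 1 ≤ X) (hjz : (j : ℝ) ≤ z)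
    (hjX : (j : ℝ) ≤ X) :
    |copDyadic D j - copDyadic D z| ≤ 36 * (1 + Real.log X) / max (j : ℝ) 1 * tau D := by
  have hτ : (1 : ℝ) ≤ tau D := by exact_mod_cast tau_pos hD
  have hlX : 0 ≤ Real.log X := Real.log_nonneg hX
  rcases Nat.eq_zero_or_pos j with rfl | hj
  · rw [Nat.cast_zero, copDyadic_of_lt_one D one_pos, zero_sub, abs_neg,
      abs_of_nonneg (copDyadic_nonneg _ _), max_eq_right zero_le_one, div_one]
    have := copDyadic_le D z
    nlinarith
  · have hj1 : (1 : ℝ) ≤ j := by exact_mod_cast hj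
    rw [max_eq_left hj1]
    refine (abs_copDyadic_sub_copDyadic_le hD hj1 hjz).trans ?_
    have : Real.log j ≤ Real.log X := Real.log_le_log (by linarith) hjX
    calc 36 * (tau D : ℝ) * (1 + Real.log j) / j ≤ 36 * (tau D : ℝ) * (1 + Real.log X) / j := by gcongr
      _ = _ := by ring

theorem sum_range_inv_max_le {X : ℝ} (hX : 1 ≤ X) :
    ∑ j ∈ range (⌊X⌋₊ + 1), 1 / max (j : ℝ) 1 ≤ 2 + Real.log X := by
  rw [Finset.sum_range_succ']
  have h1 : ∑ j ∈ range ⌊X⌋₊, 1 / max ((j + 1 : ℕ) : ℝ) 1 = ∑ j ∈ Icc 1 ⌊X⌋₊, 1 / (j : ℝ) := by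
    rw [Finset.range_eq_Ico, Finset.sum_Ico_add' (fun j : ℕ => 1 / max (j : ℝ) 1) 0 ⌊X⌋₊ 1]
    refine Finset.sum_congr (by ext; simp) fun j hj => ?_
    rw [max_eq_left]
    exact_mod_cast (mem_Icc.mp hj).1
  rw [h1]
  have h2 := sum_Icc_inv_le ⌊X⌋₊
  have h3 : Real.log ⌊X⌋₊ ≤ Real.log X :=
    Real.log_le_log (by exact_mod_cast Nat.floor_pos.mpr hX) (Nat.floor_le (by linarith))
  simp only [Nat.cast_zero, max_eq_right zero_le_one, div_one]
  linarith

theorem gcdPiece_comm (Q : ℝ) (h D m n : ℕ) : gcdPiece Q h D m n = gcdPiece Q h D n m := by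
  unfold gcdPiece
  rw [windowIndex_comm]

theorem windowIndex_le_div {x Q : ℝ} (hQ : 0 < Q) {h m n : ℕ} (hh : 1 ≤ h)
    (hm : m ∈ Icc 1 (⌊x⌋₊ / h)) (hn : n ∈ Icc 1 (⌊x⌋₊ / h)) :
    (windowIndex Q m n : ℝ) ≤ 2 * x / Q / h := by
  have hx : 0 ≤ x := by
    by_contra hc
    rw [Nat.floor_of_nonpos (by linarith)] at hm
    simp at hm
  have hb : ∀ k ∈ Icc 1 (⌊x⌋₊ / h), (k : ℝ) ≤ x / h := by
    intro k hk
    calc (k : ℝ) ≤ ((⌊x⌋₊ / h : ℕ) : ℝ) := by exact_mod_cast (mem_Icc.mp hk).2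
      _ ≤ (⌊x⌋₊ : ℝ) / h := Nat.cast_div_le
      _ ≤ x / h := by gcongr; exact Nat.floor_le hx
  have h1 := windowIndex_mul_le hQ m n
  have h2 : |(n : ℝ) - m| ≤ x / h := by
    rw [abs_le]
    have := hb m hm
    have := hb n hn
    have : (0 : ℝ) ≤ m := by positivity
    have : (0 : ℝ) ≤ n := by positivity
    constructor <;> linarith
  rw [show 2 * x / Q / h = 2 * (x / h) / Q by ring, le_div_iff₀ hQ]
  linarith

theorem abs_gcdPiece_le {x Q : ℝ} (hQ : 0 < Q) (hXQ : 2 * x / Q ≤ Q) (hX : 1 ≤ 2 * x / Q)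
    {h m n j D : ℕ} (hD : D ≠ 0) (hh : 1 ≤ h)
    (hm : m ∈ Icc 1 (⌊x⌋₊ / h)) (hn : n ∈ Icc 1 (⌊x⌋₊ / h)) (hj : windowIndex Q m n = j) :
    |copDyadic D j - copDyadic D (Q / h)| ≤
      36 * (1 + Real.log (2 * x / Q)) / max (j : ℝ) 1 * tau D := by
  have h1 := windowIndex_le_div hQ hh hm hn
  rw [hj] at h1
  have hh' : (1 : ℝ) ≤ h := by exact_mod_cast hh
  refine abs_copDyadic_sub_le_max hD hX (h1.trans (by gcongr)) (h1.trans ?_)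
  exact div_le_self (by linarith) hh'

/-- Bound for the linear sums attached to a small common divisor `h`. -/
theorem Resembles.norm_linear_le {a : ℕ → ℂ} {x P Q R E₁ E₂ E₃ : ℝ} {α : ℂ}
    (H : Resembles a x P E₁ E₂ E₃ α) (hE₁ : 0 ≤ E₁) (hE₂ : 0 ≤ E₂) (hE₃ : 0 ≤ E₃)
    (hP : 3 ≤ P) (hR : 1 ≤ R) (hRP : R * P ≤ x) (hQ : 0 < Q) (hXQ : 2 * x / Q ≤ Q)
    (hX : 1 ≤ 2 * x / Q) {h n : ℕ} (hh : 1 ≤ h) (hn : n ∈ Icc 1 (⌊x⌋₊ / h)) :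
    ‖∑ m ∈ Icc 1 (⌊x⌋₊ / h),
          a (h * m) * (gcdPiece Q h (smoothPart P m * smoothPart P n) m n : ℂ) -
        α * ∑ m ∈ (Icc 1 (⌊x⌋₊ / h)).filter (fun m : ℕ => (smoothPart P m : ℝ) ≤ R),
          (gcdPiece Q h (smoothPart P m * smoothPart P n) m n : ℂ)‖ ≤
      tau (smoothPart P n) *
        (72 * (1 + Real.log (2 * x / Q)) * (2 + Real.log (2 * x / Q)) *
          (Q / 2 * E₁ * (smoothConst * Real.log P) ^ 2 + 2 * (R * P * (1 + Real.log x)) * E₂ +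
            Q / 2 * E₃ * ((smoothConst * Real.log P) ^ 2 / R ^ (1 / Real.log P)))) := by
  set X := 2 * x / Q with hXdef
  have hx : 0 ≤ x := by nlinarith
  have hx1 : 1 ≤ x := by nlinarith
  have hlogX : 0 ≤ Real.log X := Real.log_nonneg hX
  have hlogx : 0 ≤ Real.log x := Real.log_nonneg hx1
  have hlogP : 0 ≤ Real.log P := Real.log_nonneg (by linarith)
  have hRp : 0 < R ^ (1 / Real.log P) := Real.rpow_pos_of_pos (by linarith) _
  set B := Q / 2 * E₁ * (smoothConst * Real.log P) ^ 2 + 2 * (R * P * (1 + Real.log x)) * E₂ +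
            Q / 2 * E₃ * ((smoothConst * Real.log P) ^ 2 / R ^ (1 / Real.log P)) with hB
  have hB0 : 0 ≤ B := by
    have : 0 ≤ R * P := by nlinarith
    positivity
  set G : ℕ → ℂ := fun m => a (h * m) * (gcdPiece Q h (smoothPart P m * smoothPart P n) m n : ℂ) -
    (if (smoothPart P m : ℝ) ≤ R then
      α * (gcdPiece Q h (smoothPart P m * smoothPart P n) m n : ℂ) else 0) with hG
  have hsplit : ∀ s : Finset ℕ, ∑ m ∈ s, G m = ∑ m ∈ s,
          a (h * m) * (gcdPiece Q h (smoothPart P m * smoothPart P n) m n : ℂ) -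
        α * ∑ m ∈ s.filter (fun m : ℕ => (smoothPart P m : ℝ) ≤ R),
          (gcdPiece Q h (smoothPart P m * smoothPart P n) m n : ℂ) := by
    intro s
    rw [hG, Finset.sum_sub_distrib, Finset.mul_sum, Finset.sum_filter]
  rw [← hsplit]
  set W : ℕ → ℝ := fun j => 36 * (1 + Real.log X) / max (j : ℝ) 1 * tau (smoothPart P n) with hW
  have hW0 : ∀ j, 0 ≤ W j := fun j => by positivity
  have hmain := norm_sum_le_of_windows hQ (M := ⌊x⌋₊ / h) (n := n) (J := ⌊X⌋₊) G
    (B := fun j => W j * B) (fun j => mul_nonneg (hW0 j) hB0)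
    (fun m hm => Nat.le_floor ((windowIndex_le_div hQ hh hm hn).trans
      (div_le_self (by linarith) (by exact_mod_cast hh)))) ?_
  · refine hmain.trans (le_of_eq_of_le ?_ (?_ : (tau (smoothPart P n) : ℝ) *
      (72 * (1 + Real.log X) * (∑ j ∈ range (⌊X⌋₊ + 1), 1 / max (j : ℝ) 1) * B) ≤ _))
    · simp only [Finset.mul_sum, Finset.sum_mul, hW]
      refine Finset.sum_congr rfl fun j _ => ?_
      ring
    · have := sum_range_inv_max_le hX
      gcongr
  · intro j u v hu huv hv hvu hj
    rw [hsplit]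
    have hmem : ∀ m ∈ Icc u v, m ∈ Icc 1 (⌊x⌋₊ / h) := fun m hm => by
      rw [mem_Icc] at hm ⊢; omega
    have hvx : (v : ℝ) ≤ x / h := by
      calc (v : ℝ) ≤ ((⌊x⌋₊ / h : ℕ) : ℝ) := by exact_mod_cast hv
        _ ≤ (⌊x⌋₊ : ℝ) / h := Nat.cast_div_le
        _ ≤ x / h := by gcongr; exact Nat.floor_le hx
    set f : ℕ → ℝ := fun d => copDyadic (d * smoothPart P n) j -
      copDyadic (d * smoothPart P n) (Q / h) with hf
    have hcong : ∀ m ∈ Icc u v, gcdPiece Q h (smoothPart P m * smoothPart P n) m n =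
        f (smoothPart P m) := fun m hm => by
      simp only [gcdPiece, hf, hj m hm]
    have hfb : ∀ d, d ≠ 0 → |f d| ≤ W j * tau d := by
      intro d hd
      have hu' : u ∈ Icc u v := mem_Icc.mpr ⟨le_rfl, huv⟩
      have h1 := abs_gcdPiece_le hQ hXQ hX (D := d * smoothPart P n)
        (mul_ne_zero hd (smoothPart_ne_zero P n)) hh (hmem u hu') hn (hj u hu')
      refine h1.trans ?_
      have h2 : (tau (d * smoothPart P n) : ℝ) ≤ tau d * tau (smoothPart P n) := by
        exact_mod_cast tau_mul_le d (smoothPart P n)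
      calc 36 * (1 + Real.log X) / max (j : ℝ) 1 * tau (d * smoothPart P n)
          ≤ 36 * (1 + Real.log X) / max (j : ℝ) 1 * (tau d * tau (smoothPart P n)) := by gcongr
        _ = W j * tau d := by simp only [hW]; ring
    have h1 := H.sum_smoothPart hE₁ hE₂ hE₃ hP hR hRP hh hu huv hvx (hW0 j)
      (g := fun d => (tau d : ℝ)) (f := f) (fun d => by positivity) (fun d _ => le_rfl) hfb
      (sum_smooth_tau_div_le hP _)
    have e1 : ∑ m ∈ Icc u v, a (h * m) * (gcdPiece Q h (smoothPart P m * smoothPart P n) m n : ℂ)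
        = ∑ m ∈ Icc u v, a (h * m) * (f (smoothPart P m) : ℂ) :=
      Finset.sum_congr rfl fun m hm => by rw [hcong m hm]
    have e2 : ∑ m ∈ (Icc u v).filter (fun m : ℕ => (smoothPart P m : ℝ) ≤ R),
          (gcdPiece Q h (smoothPart P m * smoothPart P n) m n : ℂ) =
        ∑ m ∈ (Icc u v).filter (fun m : ℕ => (smoothPart P m : ℝ) ≤ R),
          (f (smoothPart P m) : ℂ) :=
      Finset.sum_congr rfl fun m hm => by rw [hcong m (mem_filter.mp hm).1]
    rw [e1, e2]
    refine h1.trans (mul_le_mul_of_nonneg_left ?_ (hW0 j))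
    rw [hB]
    gcongr

/-- Absolute bound for a row of the kernel. -/
theorem sum_abs_gcdPiece_le {x P Q : ℝ} (hQ : 0 < Q) (hXQ : 2 * x / Q ≤ Q)
    (hX : 1 ≤ 2 * x / Q) (hx1 : 1 ≤ x) {h m : ℕ} (hh : 1 ≤ h) (hm : m ∈ Icc 1 (⌊x⌋₊ / h)) :
    ∑ n ∈ Icc 1 (⌊x⌋₊ / h), |gcdPiece Q h (smoothPart P m * smoothPart P n) m n| ≤
      tau (smoothPart P m) *
        (216 * (1 + Real.log (2 * x / Q)) * (2 + Real.log (2 * x / Q)) *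
          (Q * (1 + Real.log x))) := by
  set X := 2 * x / Q with hXdef
  have hx : 0 ≤ x := by linarith
  have hlogX : 0 ≤ Real.log X := Real.log_nonneg hX
  have hlogx : 0 ≤ Real.log x := Real.log_nonneg hx1
  have hxQ : √x ≤ Q := by
    rw [Real.sqrt_le_left hQ.le]
    rw [hXdef, div_le_iff₀ hQ] at hXQ
    nlinarith
  set W : ℕ → ℝ := fun j => 36 * (1 + Real.log X) / max (j : ℝ) 1 * tau (smoothPart P m) with hW
  have hW0 : ∀ j, 0 ≤ W j := fun j => by positivity
  have hmain := norm_sum_le_of_windows hQ (M := ⌊x⌋₊ / h) (n := m) (J := ⌊X⌋₊)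
    (fun n => |gcdPiece Q h (smoothPart P m * smoothPart P n) m n|)
    (B := fun j => W j * (3 * (Q * (1 + Real.log x)))) (fun j => mul_nonneg (hW0 j) (by positivity))
    (fun n hn => Nat.le_floor ((windowIndex_le_div hQ hh hn hm).trans
      (div_le_self (by linarith) (by exact_mod_cast hh)))) ?_
  · rw [Real.norm_of_nonneg (Finset.sum_nonneg fun _ _ => abs_nonneg _)] at hmain
    refine hmain.trans (le_of_eq_of_le ?_ (?_ : (tau (smoothPart P m) : ℝ) *
      (216 * (1 + Real.log X) * (∑ j ∈ range (⌊X⌋₊ + 1), 1 / max (j : ℝ) 1) *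
        (Q * (1 + Real.log x))) ≤ _))
    · simp only [Finset.mul_sum, Finset.sum_mul, hW]
      refine Finset.sum_congr rfl fun j _ => ?_
      ring
    · have := sum_range_inv_max_le hX
      gcongr
  · intro j u v hu huv hv hvu hj
    have hmem : ∀ n ∈ Icc u v, n ∈ Icc 1 (⌊x⌋₊ / h) := fun n hn => by
      rw [mem_Icc] at hn ⊢; omega
    have hh' : (1 : ℝ) ≤ h := by exact_mod_cast hh
    have hvx : (v : ℝ) ≤ x := by
      calc (v : ℝ) ≤ ((⌊x⌋₊ / h : ℕ) : ℝ) := by exact_mod_cast hv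
        _ ≤ (⌊x⌋₊ : ℝ) := by exact_mod_cast Nat.div_le_self _ _
        _ ≤ x := Nat.floor_le hx
    have hv0 : (1 : ℝ) ≤ v := by exact_mod_cast hu.trans huv
    rw [Real.norm_of_nonneg (Finset.sum_nonneg fun _ _ => abs_nonneg _)]
    calc ∑ n ∈ Icc u v, |gcdPiece Q h (smoothPart P m * smoothPart P n) m n|
        ≤ ∑ n ∈ Icc u v, W j * tau n := by
          refine Finset.sum_le_sum fun n hn => ?_
          have hn0 : n ≠ 0 := by have := (mem_Icc.mp hn).1; omega
          have h1 := abs_gcdPiece_le hQ hXQ hX (D := smoothPart P m * smoothPart P n)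
            (mul_ne_zero (smoothPart_ne_zero P m) (smoothPart_ne_zero P n)) hh (hmem n hn) hm
            (hj n hn)
          rw [gcdPiece_comm]
          unfold gcdPiece
          rw [hj n hn]
          refine h1.trans ?_
          have h2 : (tau (smoothPart P m * smoothPart P n) : ℝ) ≤ tau (smoothPart P m) * tau n := by
            exact_mod_cast (tau_mul_le _ _).trans
              (Nat.mul_le_mul_left _ (tau_le_of_dvd hn0 (smoothPart_dvd P hn0)))
          calc 36 * (1 + Real.log X) / max (j : ℝ) 1 * tau (smoothPart P m * smoothPart P n)
              ≤ 36 * (1 + Real.log X) / max (j : ℝ) 1 * (tau (smoothPart P m) * tau n) := by gcongr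
            _ = W j * tau n := by simp only [hW]; ring
      _ = W j * ∑ n ∈ Icc u v, (tau n : ℝ) := by rw [Finset.mul_sum]
      _ ≤ W j * (3 * (Q * (1 + Real.log x))) := by
          refine mul_le_mul_of_nonneg_left ((sum_tau_interval_le hu huv).trans ?_) (hW0 j)
          have h1 : Real.log v ≤ Real.log x := Real.log_le_log (by linarith) hvx
          have h2 : √(v : ℝ) ≤ √x := Real.sqrt_le_sqrt hvx
          have h3 : ((v : ℝ) - u) * (1 + Real.log v) ≤ Q / 2 * (1 + Real.log x) := by
            have : 0 ≤ Real.log v := Real.log_nonneg hv0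
            gcongr
          nlinarith [mul_nonneg hQ.le hlogx]

theorem gcdPiece_eq_of_lt {x Q : ℝ} (hQ : 0 < Q) {h m n : ℕ} (hhX : 2 * x / Q < h) (D : ℕ)
    (hm : m ∈ Icc 1 (⌊x⌋₊ / h)) (hn : n ∈ Icc 1 (⌊x⌋₊ / h)) :
    gcdPiece Q h D m n = -copDyadic D (Q / h) := by
  have hh : 1 ≤ h := by
    rcases Nat.eq_zero_or_pos h with rfl | h0
    · simp at hm
    · exact h0
  have h1 := windowIndex_le_div hQ hh hm hn
  have hh' : (0 : ℝ) < h := by exact_mod_cast hh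
  have h2 : (windowIndex Q m n : ℝ) < 1 := h1.trans_lt (by rwa [div_lt_one hh'])
  unfold gcdPiece
  rw [copDyadic_of_lt_one D h2, zero_sub]

theorem cast_floor_div_le {x : ℝ} (hx : 0 ≤ x) (h : ℕ) : ((⌊x⌋₊ / h : ℕ) : ℝ) ≤ x / h :=
  Nat.cast_div_le.trans (by gcongr; exact Nat.floor_le hx)

/-- Bound for the linear sums attached to a large common divisor `h`. -/
theorem Resembles.norm_linear_le_of_lt {a : ℕ → ℂ} {x P Q R E₁ E₂ E₃ : ℝ} {α : ℂ}
    (H : Resembles a x P E₁ E₂ E₃ α) (hE₁ : 0 ≤ E₁) (hE₂ : 0 ≤ E₂) (hE₃ : 0 ≤ E₃)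
    (hP : 3 ≤ P) (hR : 1 ≤ R) (hRP : R * P ≤ x) (hQ : 0 < Q) (hx : 1 ≤ x) {h n : ℕ}
    (hhX : 2 * x / Q < h) (hn : n ∈ Icc 1 (⌊x⌋₊ / h)) :
    ‖∑ m ∈ Icc 1 (⌊x⌋₊ / h),
          a (h * m) * (gcdPiece Q h (smoothPart P m * smoothPart P n) m n : ℂ) -
        α * ∑ m ∈ (Icc 1 (⌊x⌋₊ / h)).filter (fun m : ℕ => (smoothPart P m : ℝ) ≤ R),
          (gcdPiece Q h (smoothPart P m * smoothPart P n) m n : ℂ)‖ ≤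
      6 * (x / h * E₁ * (smoothConst * Real.log P) + 2 * (R * P * (1 + Real.log x)) * E₂ +
            Q / 2 * E₃ * ((smoothConst * Real.log P) ^ 2 / R ^ (1 / Real.log P))) := by
  have hx0 : 0 ≤ x := by linarith
  have hh : 1 ≤ h := by
    rcases Nat.eq_zero_or_pos h with rfl | h0
    · simp at hn
    · exact h0
  have hh' : (0 : ℝ) < h := by exact_mod_cast hh
  have hM : ((⌊x⌋₊ / h : ℕ) : ℝ) ≤ x / h := cast_floor_div_le hx0 h
  have hM1 : 1 ≤ ⌊x⌋₊ / h := by rw [mem_Icc] at hn; omega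
  have hRp : 0 < R ^ (1 / Real.log P) := Real.rpow_pos_of_pos (by linarith) _
  have hsc : 0 ≤ smoothConst * Real.log P :=
    mul_nonneg (by linarith [one_le_smoothConst]) (Real.log_nonneg (by linarith))
  set f : ℕ → ℝ := fun d => -copDyadic (d * smoothPart P n) (Q / h) with hf
  have hcong : ∀ m ∈ Icc 1 (⌊x⌋₊ / h), gcdPiece Q h (smoothPart P m * smoothPart P n) m n =
      f (smoothPart P m) := fun m hm => gcdPiece_eq_of_lt hQ hhX _ hm hn
  have hfb : ∀ d, d ≠ 0 → |f d| ≤ 6 * (1 : ℝ) := fun d _ => by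
    simp only [hf, abs_neg]
    rw [abs_of_nonneg (copDyadic_nonneg _ _), mul_one]
    exact copDyadic_le _ _
  have h1 := H.sum_smoothPart hE₁ hE₂ hE₃ hP hR hRP hh le_rfl hM1 hM (by norm_num : (0 : ℝ) ≤ 6)
      (g := fun _ => (1 : ℝ)) (f := f) (fun d => zero_le_one)
      (fun d hd => by exact_mod_cast tau_pos hd) hfb
      (sum_smooth_inv_le hP _ (by intro d hd; exact (mem_filter.mp hd).2))
  have e1 : ∑ m ∈ Icc 1 (⌊x⌋₊ / h),
        a (h * m) * (gcdPiece Q h (smoothPart P m * smoothPart P n) m n : ℂ)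
      = ∑ m ∈ Icc 1 (⌊x⌋₊ / h), a (h * m) * (f (smoothPart P m) : ℂ) :=
    Finset.sum_congr rfl fun m hm => by rw [hcong m hm]
  have e2 : ∑ m ∈ (Icc 1 (⌊x⌋₊ / h)).filter (fun m : ℕ => (smoothPart P m : ℝ) ≤ R),
        (gcdPiece Q h (smoothPart P m * smoothPart P n) m n : ℂ) =
      ∑ m ∈ (Icc 1 (⌊x⌋₊ / h)).filter (fun m : ℕ => (smoothPart P m : ℝ) ≤ R),
        (f (smoothPart P m) : ℂ) :=
    Finset.sum_congr rfl fun m hm => by rw [hcong m (mem_filter.mp hm).1]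
  rw [e1, e2]
  refine h1.trans (mul_le_mul_of_nonneg_left ?_ (by norm_num))
  have h2 : ((⌊x⌋₊ / h : ℕ) : ℝ) - (1 : ℕ) ≤ x / h := by push_cast at hM ⊢; linarith
  have h3 : x / h ≤ Q / 2 := by
    rw [div_le_iff₀ hh']
    rw [div_lt_iff₀ hQ] at hhX
    linarith
  have h4 : ((⌊x⌋₊ / h : ℕ) : ℝ) - (1 : ℕ) ≤ Q / 2 := h2.trans h3
  gcongr

/-- The contribution of the common divisor `h` to `smoothForm`. -/
noncomputable def smoothBlock (a : ℕ → ℂ) (x Q P : ℝ) (h : ℕ) : ℂ :=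
  ∑ m ∈ Icc 1 (⌊x⌋₊ / h), ∑ n ∈ Icc 1 (⌊x⌋₊ / h), conj (a (h * m)) * a (h * n) *
    (gcdPiece Q h (smoothPart P m * smoothPart P n) m n : ℂ)

theorem smoothBlock_one (x Q P : ℝ) (h : ℕ) :
    smoothBlock (fun _ => 1) x Q P h = ∑ m ∈ Icc 1 (⌊x⌋₊ / h), ∑ n ∈ Icc 1 (⌊x⌋₊ / h),
      (gcdPiece Q h (smoothPart P m * smoothPart P n) m n : ℂ) := by
  simp [smoothBlock]

theorem norm_smoothBlock_sub_le (a : ℕ → ℂ) (x Q P R : ℝ) (h : ℕ) (α : ℂ) {D : ℕ → ℝ}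
    (hD : ∀ n ∈ Icc 1 (⌊x⌋₊ / h), ‖∑ m ∈ Icc 1 (⌊x⌋₊ / h),
          a (h * m) * (gcdPiece Q h (smoothPart P m * smoothPart P n) m n : ℂ) -
        α * ∑ m ∈ (Icc 1 (⌊x⌋₊ / h)).filter (fun m : ℕ => (smoothPart P m : ℝ) ≤ R),
          (gcdPiece Q h (smoothPart P m * smoothPart P n) m n : ℂ)‖ ≤ D n) :
    ‖smoothBlock a x Q P h - ((‖α‖ ^ 2 : ℝ) : ℂ) * smoothBlock (fun _ => 1) x Q P h‖ ≤
      ∑ m ∈ Icc 1 (⌊x⌋₊ / h), ‖a (h * m)‖ * D m + ‖α‖ * ∑ m ∈ Icc 1 (⌊x⌋₊ / h), D m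
        + 2 * ‖α‖ ^ 2 * ∑ m ∈ (Icc 1 (⌊x⌋₊ / h)).filter (fun m : ℕ => ¬ (smoothPart P m : ℝ) ≤ R),
          ∑ n ∈ Icc 1 (⌊x⌋₊ / h), |gcdPiece Q h (smoothPart P m * smoothPart P n) m n| := by
  rw [smoothBlock_one, smoothBlock]
  refine (norm_bilinear_sub_le (Icc 1 (⌊x⌋₊ / h)) (fun m => a (h * m))
    (w := fun m n => gcdPiece Q h (smoothPart P m * smoothPart P n) m n)
    (fun m n => by rw [gcdPiece_comm, mul_comm]) (fun m : ℕ => (smoothPart P m : ℝ) ≤ R) α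
    (fun n => rfl)).trans ?_
  gcongr with m hm m hm
  · exact hD m hm
  · exact hD m hm

theorem Resembles.norm_smoothBlock_sub_le {a : ℕ → ℂ} {x P Q R E₁ E₂ E₃ : ℝ} {α : ℂ}
    (H : Resembles a x P E₁ E₂ E₃ α) (hE₁ : 0 ≤ E₁) (hE₂ : 0 ≤ E₂) (hE₃ : 0 ≤ E₃)
    (hP : 3 ≤ P) (hR : 1 ≤ R) (hRP : R * P ≤ x) (hQ : 0 < Q) (hXQ : 2 * x / Q ≤ Q)
    (hX : 1 ≤ 2 * x / Q) {h : ℕ} (hh : 1 ≤ h) :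
    ‖smoothBlock a x Q P h - ((‖α‖ ^ 2 : ℝ) : ℂ) * smoothBlock (fun _ => 1) x Q P h‖ ≤
      72 * ((1 + Real.log (2 * x / Q)) * (2 + Real.log (2 * x / Q))) *
          (Q / 2 * E₁ * (smoothConst * Real.log P) ^ 2 + 2 * (R * P * (1 + Real.log x)) * E₂ +
            Q / 2 * E₃ * ((smoothConst * Real.log P) ^ 2 / R ^ (1 / Real.log P))) *
        (∑ m ∈ Icc 1 (⌊x⌋₊ / h), ‖a (h * m)‖ * tau (smoothPart P m) +
          ‖α‖ * x * (smoothConst * Real.log P) * (1 / h)) +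
      432 * ((1 + Real.log (2 * x / Q)) * (2 + Real.log (2 * x / Q))) * (‖α‖ ^ 2 * x) *
        (Q * (1 + Real.log x)) *
        ((smoothConst * Real.log P) ^ 2 / R ^ (1 / Real.log P)) * (1 / h) := by
  have hx : 1 ≤ x := by nlinarith
  have hx0 : 0 ≤ x := by linarith
  have hlogX : 0 ≤ Real.log (2 * x / Q) := Real.log_nonneg hX
  have hlogx : 0 ≤ Real.log x := Real.log_nonneg hx
  have hRp : 0 < R ^ (1 / Real.log P) := Real.rpow_pos_of_pos (by linarith) _
  have hG : 0 ≤ smoothConst * Real.log P :=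
    mul_nonneg (by linarith [one_le_smoothConst]) (Real.log_nonneg (by linarith))
  have hM : ((⌊x⌋₊ / h : ℕ) : ℝ) ≤ x / h := cast_floor_div_le hx0 h
  refine (_root_.norm_smoothBlock_sub_le a x Q P R h α fun n hn =>
    H.norm_linear_le hE₁ hE₂ hE₃ hP hR hRP hQ hXQ hX hh hn).trans ?_
  set Y := Real.log (2 * x / Q)
  set G := smoothConst * Real.log P
  set ρ := R ^ (1 / Real.log P)
  set B := Q / 2 * E₁ * G ^ 2 + 2 * (R * P * (1 + Real.log x)) * E₂ + Q / 2 * E₃ * (G ^ 2 / ρ)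
  have hB : 0 ≤ B := by
    have : 0 ≤ R * P := by nlinarith
    positivity
  have h1 : ∑ m ∈ Icc 1 (⌊x⌋₊ / h), (tau (smoothPart P m) : ℝ) ≤ x / h * G :=
    (sum_tau_smoothPart_le hP _).trans (by gcongr)
  have h2 : ∑ m ∈ (Icc 1 (⌊x⌋₊ / h)).filter (fun m : ℕ => ¬ (smoothPart P m : ℝ) ≤ R),
      ∑ n ∈ Icc 1 (⌊x⌋₊ / h), |gcdPiece Q h (smoothPart P m * smoothPart P n) m n| ≤
      x / h * (G ^ 2 / ρ) * (216 * (1 + Y) * (2 + Y) * (Q * (1 + Real.log x))) := by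
    calc _ ≤ ∑ m ∈ (Icc 1 (⌊x⌋₊ / h)).filter (fun m : ℕ => ¬ (smoothPart P m : ℝ) ≤ R),
        (tau (smoothPart P m) : ℝ) * (216 * (1 + Y) * (2 + Y) * (Q * (1 + Real.log x))) :=
          Finset.sum_le_sum fun m hm =>
            sum_abs_gcdPiece_le hQ hXQ hX hx hh (mem_filter.mp hm).1
      _ ≤ _ := by
          rw [← Finset.sum_mul]
          refine mul_le_mul_of_nonneg_right ?_ (by positivity)
          exact (sum_tau_smoothPart_tail_le hP (by linarith) _).trans (by gcongr)
  calc _ = 72 * ((1 + Y) * (2 + Y)) * B * (∑ m ∈ Icc 1 (⌊x⌋₊ / h), ‖a (h * m)‖ * tau (smoothPart P m))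
        + ‖α‖ * (72 * ((1 + Y) * (2 + Y)) * B) * ∑ m ∈ Icc 1 (⌊x⌋₊ / h), (tau (smoothPart P m) : ℝ)
        + 2 * ‖α‖ ^ 2 * ∑ m ∈ (Icc 1 (⌊x⌋₊ / h)).filter (fun m : ℕ => ¬ (smoothPart P m : ℝ) ≤ R),
          ∑ n ∈ Icc 1 (⌊x⌋₊ / h), |gcdPiece Q h (smoothPart P m * smoothPart P n) m n| := by
        congr 1
        simp only [Finset.mul_sum]
        congr 1
        · exact Finset.sum_congr rfl fun m _ => by ring
        · exact Finset.sum_congr rfl fun m _ => by ring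
    _ ≤ 72 * ((1 + Y) * (2 + Y)) * B * (∑ m ∈ Icc 1 (⌊x⌋₊ / h), ‖a (h * m)‖ * tau (smoothPart P m))
        + ‖α‖ * (72 * ((1 + Y) * (2 + Y)) * B) * (x / h * G)
        + 2 * ‖α‖ ^ 2 * (x / h * (G ^ 2 / ρ) * (216 * (1 + Y) * (2 + Y) * (Q * (1 + Real.log x)))) := by
        gcongr
    _ = _ := by ring

theorem Resembles.norm_smoothBlock_sub_le_of_lt {a : ℕ → ℂ} {x P Q R E₁ E₂ E₃ : ℝ} {α : ℂ}
    (H : Resembles a x P E₁ E₂ E₃ α) (hE₁ : 0 ≤ E₁) (hE₂ : 0 ≤ E₂) (hE₃ : 0 ≤ E₃)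
    (hP : 3 ≤ P) (hR : 1 ≤ R) (hRP : R * P ≤ x) (hQ : 0 < Q) (hx : 1 ≤ x) {h : ℕ}
    (hhX : 2 * x / Q < h) :
    ‖smoothBlock a x Q P h - ((‖α‖ ^ 2 : ℝ) : ℂ) * smoothBlock (fun _ => 1) x Q P h‖ ≤
      6 * (2 * (R * P * (1 + Real.log x)) * E₂ +
            Q / 2 * E₃ * ((smoothConst * Real.log P) ^ 2 / R ^ (1 / Real.log P))) *
        (∑ m ∈ Icc 1 (⌊x⌋₊ / h), ‖a (h * m)‖ + ‖α‖ * x * (1 / h)) +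
      6 * x * E₁ * (smoothConst * Real.log P) *
        ((1 / h) * ∑ m ∈ Icc 1 (⌊x⌋₊ / h), ‖a (h * m)‖ + ‖α‖ * x * (1 / (h : ℝ) ^ 2)) +
      12 * ‖α‖ ^ 2 * x ^ 2 * ((smoothConst * Real.log P) ^ 2 / R ^ (1 / Real.log P)) *
        (1 / (h : ℝ) ^ 2) := by
  have hx0 : 0 ≤ x := by linarith
  have hlogx : 0 ≤ Real.log x := Real.log_nonneg hx
  have hRp : 0 < R ^ (1 / Real.log P) := Real.rpow_pos_of_pos (by linarith) _
  have hG : 0 ≤ smoothConst * Real.log P :=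
    mul_nonneg (by linarith [one_le_smoothConst]) (Real.log_nonneg (by linarith))
  have hM : ((⌊x⌋₊ / h : ℕ) : ℝ) ≤ x / h := cast_floor_div_le hx0 h
  refine (_root_.norm_smoothBlock_sub_le a x Q P R h α fun n hn =>
    H.norm_linear_le_of_lt hE₁ hE₂ hE₃ hP hR hRP hQ hx hhX hn).trans ?_
  set G := smoothConst * Real.log P
  set ρ := R ^ (1 / Real.log P)
  set V := 2 * (R * P * (1 + Real.log x)) * E₂
  have hV : 0 ≤ V := by
    have : 0 ≤ R * P := by nlinarith
    positivity
  have h2 : ∑ m ∈ (Icc 1 (⌊x⌋₊ / h)).filter (fun m : ℕ => ¬ (smoothPart P m : ℝ) ≤ R),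
      ∑ n ∈ Icc 1 (⌊x⌋₊ / h), |gcdPiece Q h (smoothPart P m * smoothPart P n) m n| ≤
      x / h * (G ^ 2 / ρ) * (6 * (x / h)) := by
    calc _ ≤ ∑ m ∈ (Icc 1 (⌊x⌋₊ / h)).filter (fun m : ℕ => ¬ (smoothPart P m : ℝ) ≤ R),
        (tau (smoothPart P m) : ℝ) * (6 * (x / h)) := by
          refine Finset.sum_le_sum fun m hm => ?_
          have hm' := (mem_filter.mp hm).1
          calc ∑ n ∈ Icc 1 (⌊x⌋₊ / h), |gcdPiece Q h (smoothPart P m * smoothPart P n) m n|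
              ≤ ∑ n ∈ Icc 1 (⌊x⌋₊ / h), (6 : ℝ) := by
                refine Finset.sum_le_sum fun n hn => ?_
                rw [gcdPiece_eq_of_lt hQ hhX _ hm' hn, abs_neg,
                  abs_of_nonneg (copDyadic_nonneg _ _)]
                exact copDyadic_le _ _
            _ = 1 * (6 * ((⌊x⌋₊ / h : ℕ) : ℝ)) := by simp [mul_comm]
            _ ≤ (tau (smoothPart P m) : ℝ) * (6 * (x / h)) := by
                have : (1 : ℝ) ≤ tau (smoothPart P m) := by
                  exact_mod_cast tau_pos (smoothPart_ne_zero P m)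
                gcongr
      _ ≤ _ := by
          rw [← Finset.sum_mul]
          refine mul_le_mul_of_nonneg_right ?_ (by positivity)
          exact (sum_tau_smoothPart_tail_le hP (by linarith) _).trans (by gcongr)
  set B := x / h * E₁ * G + V + Q / 2 * E₃ * (G ^ 2 / ρ) with hBdef
  have hB : 0 ≤ B := by positivity
  calc _ = 6 * B * (∑ m ∈ Icc 1 (⌊x⌋₊ / h), ‖a (h * m)‖)
        + ‖α‖ * (6 * B) * ((⌊x⌋₊ / h : ℕ) : ℝ)
        + 2 * ‖α‖ ^ 2 * ∑ m ∈ (Icc 1 (⌊x⌋₊ / h)).filter (fun m : ℕ => ¬ (smoothPart P m : ℝ) ≤ R),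
          ∑ n ∈ Icc 1 (⌊x⌋₊ / h), |gcdPiece Q h (smoothPart P m * smoothPart P n) m n| := by
        congr 1
        rw [← Finset.sum_mul, Finset.sum_const, Nat.card_Icc, nsmul_eq_mul]
        simp only [Nat.add_sub_cancel]
        ring
    _ ≤ 6 * B * (∑ m ∈ Icc 1 (⌊x⌋₊ / h), ‖a (h * m)‖) + ‖α‖ * (6 * B) * (x / h)
        + 2 * ‖α‖ ^ 2 * (x / h * (G ^ 2 / ρ) * (6 * (x / h))) := by gcongr
    _ = _ := by rw [hBdef]; ring

theorem sum_sum_Icc_div_eq (s : Finset ℕ) (hs : 0 ∉ s) (f c : ℕ → ℝ) (N : ℕ) :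
    ∑ h ∈ s, ∑ m ∈ Icc 1 (N / h), f (h * m) * c m =
      ∑ n ∈ Icc 1 N, f n * ∑ h ∈ n.divisors.filter (· ∈ s), c (n / h) := by
  have h1 := sum_Icc_sum_divisors N (fun d l => if d ∈ s then f (d * l) * c l else 0)
  have h2 : ∑ h ∈ s, ∑ m ∈ Icc 1 (N / h), f (h * m) * c m =
      ∑ d ∈ Icc 1 N, ∑ l ∈ Icc 1 (N / d), (if d ∈ s then f (d * l) * c l else 0) := by
    have h3 : ∀ d, ∑ l ∈ Icc 1 (N / d), (if d ∈ s then f (d * l) * c l else 0) =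
        if d ∈ s then ∑ l ∈ Icc 1 (N / d), f (d * l) * c l else 0 := fun d => by
      split_ifs <;> simp
    simp only [h3]
    rw [← Finset.sum_filter]
    symm
    refine Finset.sum_subset (fun d hd => (mem_filter.mp hd).2) fun d hd hd' => ?_
    have : N < d := by
      by_contra hc
      exact hd' (mem_filter.mpr ⟨mem_Icc.mpr ⟨Nat.one_le_iff_ne_zero.mpr
        (fun h0 => hs (h0 ▸ hd)), not_lt.mp hc⟩, hd⟩)
    rw [Nat.div_eq_of_lt this]
    simp
  rw [h2, ← h1]
  refine Finset.sum_congr rfl fun n hn => ?_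
  rw [Finset.sum_filter, Finset.mul_sum]
  refine Finset.sum_congr rfl fun d hd => ?_
  rw [Nat.mul_div_cancel' (Nat.dvd_of_mem_divisors hd)]
  split_ifs <;> simp

theorem sum_small_tau3P_le (a : ℕ → ℂ) {P y : ℝ} (hPy : P ≤ y) (s : Finset ℕ) (hs : 0 ∉ s)
    (hsy : ∀ h ∈ s, (h : ℝ) ≤ y) (N : ℕ) :
    ∑ h ∈ s, ∑ m ∈ Icc 1 (N / h), ‖a (h * m)‖ * tau (smoothPart P m) ≤
      ∑ n ∈ Icc 1 N, ‖a n‖ * tau3P y n := by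
  rw [sum_sum_Icc_div_eq s hs (fun n => ‖a n‖) (fun m => (tau (smoothPart P m) : ℝ))]
  refine Finset.sum_le_sum fun n hn => mul_le_mul_of_nonneg_left ?_ (norm_nonneg _)
  have hn0 : n ≠ 0 := by have := (mem_Icc.mp hn).1; omega
  exact_mod_cast sum_tau_smoothPart_le_tau3P hPy hn0 _ (Finset.filter_subset _ _)
    (fun h hh => hsy h (mem_filter.mp hh).2)

theorem sum_small_tau3_le (a : ℕ → ℂ) (P : ℝ) (s : Finset ℕ) (hs : 0 ∉ s) (N : ℕ) :
    ∑ h ∈ s, ∑ m ∈ Icc 1 (N / h), ‖a (h * m)‖ * tau (smoothPart P m) ≤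
      ∑ n ∈ Icc 1 N, ‖a n‖ * tau3 n := by
  rw [sum_sum_Icc_div_eq s hs (fun n => ‖a n‖) (fun m => (tau (smoothPart P m) : ℝ))]
  refine Finset.sum_le_sum fun n hn => mul_le_mul_of_nonneg_left ?_ (norm_nonneg _)
  have hn0 : n ≠ 0 := by have := (mem_Icc.mp hn).1; omega
  exact_mod_cast sum_tau_smoothPart_le_tau3 P hn0 _ (Finset.filter_subset _ _)

theorem sum_sum_norm_le_tau3 (a : ℕ → ℂ) (s : Finset ℕ) (hs : 0 ∉ s) (N : ℕ) :
    ∑ h ∈ s, ∑ m ∈ Icc 1 (N / h), ‖a (h * m)‖ ≤ ∑ n ∈ Icc 1 N, ‖a n‖ * tau3 n := by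
  refine le_trans (Finset.sum_le_sum fun h _ => Finset.sum_le_sum fun m _ => ?_)
    (sum_small_tau3_le a 0 s hs N)
  have : (1 : ℝ) ≤ tau (smoothPart 0 m) := by exact_mod_cast tau_pos (smoothPart_ne_zero 0 m)
  nlinarith [norm_nonneg (a (h * m))]

theorem sum_inv_mul_le_sqrt (a : ℕ → ℂ) {x Q X : ℝ} (hX : 0 < X) :
    ∑ h ∈ (Icc 1 ⌊Q⌋₊).filter (fun h : ℕ => ¬ (h : ℝ) ≤ X),
        1 / (h : ℝ) * ∑ m ∈ Icc 1 (⌊x⌋₊ / h), ‖a (h * m)‖ ≤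
      √(2 / X) * √(concLHS a x Q X) := by
  refine (Real.sum_mul_le_sqrt_mul_sqrt _ _ _).trans ?_
  gcongr
  · refine le_trans (le_of_eq ?_) (sum_Icc_inv_sq_tail_le ⌊Q⌋₊ hX)
    simp [not_le, one_div]
  · rw [concLHS_eq]
    refine Finset.sum_le_sum_of_subset_of_nonneg ?_ fun _ _ _ => sq_nonneg _
    intro h hh
    rw [mem_filter] at hh ⊢
    exact ⟨hh.1, (not_le.mp hh.2).le⟩

theorem Resembles.sum_norm_smoothBlock_sub_small_le {a : ℕ → ℂ} {x P Q R E₁ E₂ E₃ : ℝ} {α : ℂ}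
    (H : Resembles a x P E₁ E₂ E₃ α) (hE₁ : 0 ≤ E₁) (hE₂ : 0 ≤ E₂) (hE₃ : 0 ≤ E₃)
    (hP : 3 ≤ P) (hR : 1 ≤ R) (hRP : R * P ≤ x) (hQ : 0 < Q) (hXQ : 2 * x / Q ≤ Q)
    (hX : 1 ≤ 2 * x / Q) {y : ℝ} (hPy : P ≤ y) (hXy : 2 * x / Q ≤ y) :
    ∑ h ∈ (Icc 1 ⌊Q⌋₊).filter (fun h : ℕ => (h : ℝ) ≤ 2 * x / Q),
      ‖smoothBlock a x Q P h - ((‖α‖ ^ 2 : ℝ) : ℂ) * smoothBlock (fun _ => 1) x Q P h‖ ≤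
      72 * ((1 + Real.log (2 * x / Q)) * (2 + Real.log (2 * x / Q))) *
          (Q / 2 * E₁ * (smoothConst * Real.log P) ^ 2 *
            (∑ n ∈ Icc 1 ⌊x⌋₊, ‖a n‖ * tau3P y n +
              ‖α‖ * x * (smoothConst * Real.log P) * (1 + Real.log (2 * x / Q))) +
          (2 * (R * P * (1 + Real.log x)) * E₂ +
            Q / 2 * E₃ * ((smoothConst * Real.log P) ^ 2 / R ^ (1 / Real.log P))) *
            (∑ n ∈ Icc 1 ⌊x⌋₊, ‖a n‖ * tau3 n +
              ‖α‖ * x * (smoothConst * Real.log P) * (1 + Real.log (2 * x / Q)))) +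
      432 * ((1 + Real.log (2 * x / Q)) * (2 + Real.log (2 * x / Q))) * (‖α‖ ^ 2 * x) *
        (Q * (1 + Real.log x)) *
        ((smoothConst * Real.log P) ^ 2 / R ^ (1 / Real.log P)) * (1 + Real.log (2 * x / Q)) := by
  have hx : 1 ≤ x := by nlinarith
  have hx0 : 0 ≤ x := by linarith
  have hlogX : 0 ≤ Real.log (2 * x / Q) := Real.log_nonneg hX
  have hlogx : 0 ≤ Real.log x := Real.log_nonneg hx
  have hRp : 0 < R ^ (1 / Real.log P) := Real.rpow_pos_of_pos (by linarith) _
  have hG : 0 ≤ smoothConst * Real.log P :=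
    mul_nonneg (by linarith [one_le_smoothConst]) (Real.log_nonneg (by linarith))
  have hs0 : 0 ∉ (Icc 1 ⌊Q⌋₊).filter (fun h : ℕ => (h : ℝ) ≤ 2 * x / Q) := by simp
  have hi : ∑ h ∈ (Icc 1 ⌊Q⌋₊).filter (fun h : ℕ => (h : ℝ) ≤ 2 * x / Q), 1 / (h : ℝ) ≤
      1 + Real.log (2 * x / Q) := by
    have h3 : Real.log ⌊2 * x / Q⌋₊ ≤ Real.log (2 * x / Q) :=
      Real.log_le_log (by exact_mod_cast Nat.floor_pos.mpr hX) (Nat.floor_le (by linarith))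
    refine le_trans (Finset.sum_le_sum_of_subset_of_nonneg ?_ fun _ _ _ => by positivity)
      ((sum_Icc_inv_le ⌊2 * x / Q⌋₊).trans (by linarith))
    intro h hh
    rw [mem_filter, mem_Icc] at hh
    exact mem_Icc.mpr ⟨hh.1.1, Nat.le_floor hh.2⟩
  have hT1 := sum_small_tau3P_le a hPy _ hs0 (fun h hh => ((mem_filter.mp hh).2).trans hXy) ⌊x⌋₊
  have hT2 := sum_small_tau3_le a P _ hs0 ⌊x⌋₊
  refine (Finset.sum_le_sum fun h hh => H.norm_smoothBlock_sub_le hE₁ hE₂ hE₃ hP hR hRP hQ hXQ hX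
    (mem_Icc.mp (mem_filter.mp hh).1).1).trans ?_
  rw [Finset.sum_add_distrib, ← Finset.mul_sum, ← Finset.mul_sum, Finset.sum_add_distrib,
    ← Finset.mul_sum]
  have hRP0 : 0 ≤ R * P := by nlinarith
  set Y := Real.log (2 * x / Q)
  set G := smoothConst * Real.log P
  set ρ := R ^ (1 / Real.log P)
  set I := ∑ h ∈ (Icc 1 ⌊Q⌋₊).filter (fun h : ℕ => (h : ℝ) ≤ 2 * x / Q), 1 / (h : ℝ)
  set J := ∑ h ∈ (Icc 1 ⌊Q⌋₊).filter (fun h : ℕ => (h : ℝ) ≤ 2 * x / Q),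
    ∑ m ∈ Icc 1 (⌊x⌋₊ / h), ‖a (h * m)‖ * tau (smoothPart P m)
  set U := 2 * (R * P * (1 + Real.log x)) * E₂ + Q / 2 * E₃ * (G ^ 2 / ρ) with hU
  have hU0 : 0 ≤ U := by positivity
  calc 72 * ((1 + Y) * (2 + Y)) * (Q / 2 * E₁ * G ^ 2 + 2 * (R * P * (1 + Real.log x)) * E₂ +
          Q / 2 * E₃ * (G ^ 2 / ρ)) * (J + ‖α‖ * x * G * I) +
        432 * ((1 + Y) * (2 + Y)) * (‖α‖ ^ 2 * x) * (Q * (1 + Real.log x)) * (G ^ 2 / ρ) * I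
      = 72 * ((1 + Y) * (2 + Y)) * (Q / 2 * E₁ * G ^ 2 * (J + ‖α‖ * x * G * I) +
          U * (J + ‖α‖ * x * G * I)) +
        432 * ((1 + Y) * (2 + Y)) * (‖α‖ ^ 2 * x) * (Q * (1 + Real.log x)) * (G ^ 2 / ρ) * I := by
        rw [hU]; ring
    _ ≤ _ := by gcongr

theorem Resembles.sum_norm_smoothBlock_sub_large_le {a : ℕ → ℂ} {x P Q R E₁ E₂ E₃ : ℝ} {α : ℂ}
    (H : Resembles a x P E₁ E₂ E₃ α) (hE₁ : 0 ≤ E₁) (hE₂ : 0 ≤ E₂) (hE₃ : 0 ≤ E₃)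
    (hP : 3 ≤ P) (hR : 1 ≤ R) (hRP : R * P ≤ x) (hQ : 0 < Q) (hx : 1 ≤ x) (hQx : Q ≤ x) :
    ∑ h ∈ (Icc 1 ⌊Q⌋₊).filter (fun h : ℕ => ¬ (h : ℝ) ≤ 2 * x / Q),
      ‖smoothBlock a x Q P h - ((‖α‖ ^ 2 : ℝ) : ℂ) * smoothBlock (fun _ => 1) x Q P h‖ ≤
      6 * (2 * (R * P * (1 + Real.log x)) * E₂ +
            Q / 2 * E₃ * ((smoothConst * Real.log P) ^ 2 / R ^ (1 / Real.log P))) *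
        (∑ n ∈ Icc 1 ⌊x⌋₊, ‖a n‖ * tau3 n + ‖α‖ * x * (1 + Real.log x)) +
      6 * x * E₁ * (smoothConst * Real.log P) *
        (√(Q / x) * √(concLHS a x Q (2 * x / Q)) + ‖α‖ * x * (Q / x)) +
      12 * ‖α‖ ^ 2 * x ^ 2 * ((smoothConst * Real.log P) ^ 2 / R ^ (1 / Real.log P)) * (Q / x) := by
  have hx0 : 0 < x := by linarith
  have hX : 0 < 2 * x / Q := by positivity
  have hlogx : 0 ≤ Real.log x := Real.log_nonneg hx
  have hRp : 0 < R ^ (1 / Real.log P) := Real.rpow_pos_of_pos (by linarith) _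
  have hG : 0 ≤ smoothConst * Real.log P :=
    mul_nonneg (by linarith [one_le_smoothConst]) (Real.log_nonneg (by linarith))
  have hRP0 : 0 ≤ R * P := by nlinarith
  have hs0 : 0 ∉ (Icc 1 ⌊Q⌋₊).filter (fun h : ℕ => ¬ (h : ℝ) ≤ 2 * x / Q) := by simp
  have h2X : 2 / (2 * x / Q) = Q / x := by field_simp
  have hi : ∑ h ∈ (Icc 1 ⌊Q⌋₊).filter (fun h : ℕ => ¬ (h : ℝ) ≤ 2 * x / Q), 1 / (h : ℝ) ≤
      1 + Real.log x := by
    have h3 : Real.log ⌊Q⌋₊ ≤ Real.log x := by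
      rcases Nat.eq_zero_or_pos ⌊Q⌋₊ with h0 | h0
      · rw [h0]; simpa using hlogx
      · exact Real.log_le_log (by exact_mod_cast h0) ((Nat.floor_le hQ.le).trans hQx)
    exact le_trans (Finset.sum_le_sum_of_subset_of_nonneg (Finset.filter_subset _ _)
      fun _ _ _ => by positivity) ((sum_Icc_inv_le ⌊Q⌋₊).trans (by linarith))
  have hi2 : ∑ h ∈ (Icc 1 ⌊Q⌋₊).filter (fun h : ℕ => ¬ (h : ℝ) ≤ 2 * x / Q), 1 / (h : ℝ) ^ 2 ≤
      Q / x := by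
    rw [← h2X]
    refine le_trans (le_of_eq ?_) (sum_Icc_inv_sq_tail_le ⌊Q⌋₊ hX)
    simp only [not_le]
  have hC := sum_inv_mul_le_sqrt a (x := x) (Q := Q) hX
  rw [h2X] at hC
  have hT := sum_sum_norm_le_tau3 a _ hs0 ⌊x⌋₊
  refine (Finset.sum_le_sum fun h hh => H.norm_smoothBlock_sub_le_of_lt hE₁ hE₂ hE₃ hP hR hRP hQ hx
    (not_le.mp (mem_filter.mp hh).2)).trans ?_
  simp only [Finset.sum_add_distrib, ← Finset.mul_sum]
  gcongr

set_option maxHeartbeats 1000000 in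
theorem smoothForm_error_le {x Q P R E₁ E₂ E₃ L c p Y ρ l V β T₁ T₂ : ℝ} (hx0 : 0 < x) (hQ : 0 < Q)
    (hRP0 : 0 ≤ R * P) (hE₁ : 0 ≤ E₁) (hE₂ : 0 ≤ E₂) (hα0 : 0 ≤ β) (hE₃ : β ≤ E₃) (hc : 1 ≤ c)
    (hp : 1 < p) (hPL : p ≤ L) (hY : 0 ≤ Y) (hXL : Y ≤ L) (hρ : 0 < ρ) (hlogx : 1 ≤ l) (hV : 0 ≤ V)
    (hα1 : β * x ≤ T₁) (hα2 : β * x ≤ T₂) :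
    72 * ((1 + Y) * (2 + Y)) * (Q / 2 * E₁ * (c * p) ^ 2 * (T₁ + β * x * (c * p) * (1 + Y)) +
          (2 * (R * P * (1 + l)) * E₂ + Q / 2 * E₃ * ((c * p) ^ 2 / ρ)) *
            (T₂ + β * x * (c * p) * (1 + Y))) +
        432 * ((1 + Y) * (2 + Y)) * (β ^ 2 * x) * (Q * (1 + l)) * ((c * p) ^ 2 / ρ) * (1 + Y) +
      (6 * (2 * (R * P * (1 + l)) * E₂ + Q / 2 * E₃ * ((c * p) ^ 2 / ρ)) * (T₂ + β * x * (1 + l)) +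
        6 * x * E₁ * (c * p) * (V + β * x * (Q / x)) +
        12 * β ^ 2 * x ^ 2 * ((c * p) ^ 2 / ρ) * (Q / x)) ≤
      20000 * c ^ 3 * (x * E₁ * p * V + L ^ 6 * (Q * E₁ * T₁ +
        l ^ 3 * (R * P * E₂ + Q * E₃ / ρ) * T₂)) := by
  have hE₃0 : 0 ≤ E₃ := hα0.trans hE₃
  have hβx : 0 ≤ β * x := by positivity
  have hT₁0 : 0 ≤ T₁ := hβx.trans hα1
  have hT₂0 : 0 ≤ T₂ := hβx.trans hα2
  set e₂ := R * P * E₂ with he₂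
  have he₂0 : 0 ≤ e₂ := mul_nonneg hRP0 hE₂
  set e₃ := Q * E₃ / ρ with he₃
  have he₃0 : 0 ≤ e₃ := by positivity
  have hL : 1 ≤ L := by linarith
  have hZ : (1 + Y) * (2 + Y) ≤ 6 * L ^ 2 := by nlinarith
  have hG : c * p ≤ c * L := by gcongr
  have hG0 : 0 ≤ c * p := by positivity
  have hββ : β ^ 2 * x * Q / ρ ≤ e₃ * T₂ := by
    calc β ^ 2 * x * Q / ρ = β * (β * x) * (Q / ρ) := by ring
      _ ≤ E₃ * T₂ * (Q / ρ) := by gcongr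
      _ = e₃ * T₂ := by rw [he₃]; ring
  have hL1 : ∀ {i j : ℕ}, i ≤ j → L ^ i ≤ L ^ j := fun h => pow_le_pow_right₀ hL h
  have hl1 : ∀ {i j : ℕ}, i ≤ j → l ^ i ≤ l ^ j := fun h => pow_le_pow_right₀ hlogx h
  have hc1 : ∀ {i j : ℕ}, i ≤ j → c ^ i ≤ c ^ j := fun h => pow_le_pow_right₀ hc h
  have hll : 1 + l ≤ 2 * l := by linarith
  -- the two bracketed factors
  have hb : ∀ T : ℝ, 0 ≤ T → β * x ≤ T → T + β * x * (c * p) * (1 + Y) ≤ 3 * c * L ^ 2 * T := by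
    intro T hT0 hT
    have h1 : β * x * (c * p) * (1 + Y) ≤ T * (c * L) * (2 * L) := by
      have : 1 + Y ≤ 2 * L := by linarith
      gcongr
    have h2 := mul_le_mul_of_nonneg_right
      (one_le_mul_of_one_le_of_one_le hc (one_le_pow₀ hL (n := 2))) hT0
    linarith
  have hu : 2 * (R * P * (1 + l)) * E₂ + Q / 2 * E₃ * ((c * p) ^ 2 / ρ) ≤
      4 * c ^ 2 * L ^ 2 * l * (e₂ + e₃) := by
    have h1 : 2 * (R * P * (1 + l)) * E₂ ≤ 4 * l * e₂ := by
      rw [he₂]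
      calc 2 * (R * P * (1 + l)) * E₂ = 2 * (1 + l) * (R * P * E₂) := by ring
        _ ≤ 2 * (2 * l) * (R * P * E₂) := by gcongr
        _ = _ := by ring
    have h2 : Q / 2 * E₃ * ((c * p) ^ 2 / ρ) ≤ c ^ 2 * L ^ 2 * e₃ := by
      calc Q / 2 * E₃ * ((c * p) ^ 2 / ρ) = (c * p) ^ 2 * e₃ / 2 := by rw [he₃]; ring
        _ ≤ (c * L) ^ 2 * e₃ := by
          have : (c * p) ^ 2 ≤ (c * L) ^ 2 := by gcongr
          have := mul_le_mul_of_nonneg_right this he₃0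
          have := mul_nonneg (sq_nonneg (c * p)) he₃0
          linarith
        _ = _ := by ring
    have h3 : 4 * l * e₂ ≤ 4 * c ^ 2 * L ^ 2 * l * e₂ := by
      have : 1 ≤ c ^ 2 * L ^ 2 := one_le_mul_of_one_le_of_one_le (one_le_pow₀ hc) (one_le_pow₀ hL)
      have := mul_le_mul_of_nonneg_right this (mul_nonneg (by linarith : 0 ≤ l) he₂0)
      linarith
    have h4 : c ^ 2 * L ^ 2 * e₃ ≤ 4 * c ^ 2 * L ^ 2 * l * e₃ := by
      have h5 : 0 ≤ c ^ 2 * L ^ 2 * e₃ := by positivity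
      have := mul_le_mul_of_nonneg_left hlogx h5
      linarith
    linarith
  have hl0 : 0 ≤ l := by linarith
  have hL0 : 0 ≤ L := by linarith
  have hc0 : 0 ≤ c := by linarith
  have hp0 : 0 ≤ p := by linarith
  -- each error in turn
  have t1 : 72 * ((1 + Y) * (2 + Y)) * (Q / 2 * E₁ * (c * p) ^ 2 *
      (T₁ + β * x * (c * p) * (1 + Y))) ≤ 648 * c ^ 3 * (L ^ 6 * (Q * E₁ * T₁)) := by
    calc _ ≤ 72 * (6 * L ^ 2) * (Q / 2 * E₁ * (c * L) ^ 2 * (3 * c * L ^ 2 * T₁)) := by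
          have := hb T₁ hT₁0 hα1
          gcongr
      _ = _ := by ring
  set W := L ^ 6 * (l ^ 3 * (e₂ + e₃) * T₂) with hW
  have hW0 : 0 ≤ W := by positivity
  have t2 : 72 * ((1 + Y) * (2 + Y)) * ((2 * (R * P * (1 + l)) * E₂ +
      Q / 2 * E₃ * ((c * p) ^ 2 / ρ)) * (T₂ + β * x * (c * p) * (1 + Y))) ≤ 5184 * c ^ 3 * W := by
    calc _ ≤ 72 * (6 * L ^ 2) * ((4 * c ^ 2 * L ^ 2 * l * (e₂ + e₃)) * (3 * c * L ^ 2 * T₂)) := by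
          have := hb T₂ hT₂0 hα2
          gcongr
      _ = 5184 * c ^ 3 * (L ^ 6 * (l ^ 1 * (e₂ + e₃) * T₂)) := by ring
      _ ≤ _ := by
          have := hl1 (show 1 ≤ 3 by norm_num)
          rw [hW]; gcongr
  have t3 : 432 * ((1 + Y) * (2 + Y)) * (β ^ 2 * x) * (Q * (1 + l)) * ((c * p) ^ 2 / ρ) * (1 + Y) ≤
      10368 * c ^ 3 * W := by
    calc _ = 432 * ((1 + Y) * (2 + Y)) * (β ^ 2 * x * Q / ρ) * (1 + l) * (c * p) ^ 2 * (1 + Y) := by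
          ring
      _ ≤ 432 * (6 * L ^ 2) * (e₃ * T₂) * (2 * l) * (c * L) ^ 2 * (2 * L) := by
          have : 1 + Y ≤ 2 * L := by linarith
          gcongr
      _ = 10368 * c ^ 2 * (L ^ 5 * (l ^ 1 * e₃ * T₂)) := by ring
      _ ≤ _ := by
          have := hl1 (show 1 ≤ 3 by norm_num)
          have := hL1 (show 5 ≤ 6 by norm_num)
          have := hc1 (show 2 ≤ 3 by norm_num)
          have : e₃ ≤ e₂ + e₃ := by linarith
          rw [hW]; gcongr
  have t4 : 6 * (2 * (R * P * (1 + l)) * E₂ + Q / 2 * E₃ * ((c * p) ^ 2 / ρ)) *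
      (T₂ + β * x * (1 + l)) ≤ 72 * c ^ 3 * W := by
    have h1 : T₂ + β * x * (1 + l) ≤ 3 * l * T₂ := by
      have : β * x * (1 + l) ≤ T₂ * (2 * l) := by gcongr
      have := mul_le_mul_of_nonneg_left hlogx hT₂0
      linarith
    calc _ ≤ 6 * (4 * c ^ 2 * L ^ 2 * l * (e₂ + e₃)) * (3 * l * T₂) := by gcongr
      _ = 72 * c ^ 2 * (L ^ 2 * (l ^ 2 * (e₂ + e₃) * T₂)) := by ring
      _ ≤ _ := by
          have := hl1 (show 2 ≤ 3 by norm_num)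
          have := hL1 (show 2 ≤ 6 by norm_num)
          have := hc1 (show 2 ≤ 3 by norm_num)
          rw [hW]; gcongr
  have t5 : 6 * x * E₁ * (c * p) * (V + β * x * (Q / x)) ≤
      6 * c ^ 3 * (x * E₁ * p * V) + 6 * c ^ 3 * (L ^ 6 * (Q * E₁ * T₁)) := by
    have hc13 := hc1 (show 1 ≤ 3 by norm_num)
    have h1 : 6 * c ^ 1 * (x * E₁ * p * V) ≤ 6 * c ^ 3 * (x * E₁ * p * V) := by gcongr
    have h2 : 6 * x * E₁ * (c * p) * (β * x * (Q / x)) ≤ 6 * c ^ 3 * (L ^ 6 * (Q * E₁ * T₁)) := by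
      calc _ = 6 * c ^ 1 * (p * (Q * E₁ * (β * x))) * (x / x) := by ring
        _ = 6 * c ^ 1 * (p * (Q * E₁ * (β * x))) := by rw [div_self hx0.ne', mul_one]
        _ ≤ _ := by
          have : p ≤ L ^ 6 := hPL.trans (by simpa using hL1 (show 1 ≤ 6 by norm_num))
          gcongr
    linarith
  have t6 : 12 * β ^ 2 * x ^ 2 * ((c * p) ^ 2 / ρ) * (Q / x) ≤ 12 * c ^ 3 * W := by
    calc _ = 12 * (β ^ 2 * x * Q / ρ) * (c * p) ^ 2 * (x / x) := by ring
      _ = 12 * (β ^ 2 * x * Q / ρ) * (c * p) ^ 2 := by rw [div_self hx0.ne', mul_one]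
      _ ≤ 12 * (e₃ * T₂) * (c * L) ^ 2 := by gcongr
      _ = 12 * c ^ 2 * (L ^ 2 * (l ^ 0 * e₃ * T₂)) := by ring
      _ ≤ _ := by
          have := hl1 (show 0 ≤ 3 by norm_num)
          have := hL1 (show 2 ≤ 6 by norm_num)
          have := hc1 (show 2 ≤ 3 by norm_num)
          have : e₃ ≤ e₂ + e₃ := by linarith
          rw [hW]; gcongr
  have hc3 : 0 ≤ c ^ 3 := by positivity
  have f1 : 0 ≤ c ^ 3 * (x * E₁ * p * V) := by positivity
  have f2 : 0 ≤ c ^ 3 * (L ^ 6 * (Q * E₁ * T₁)) := by positivity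
  have f3 : 0 ≤ c ^ 3 * W := by positivity
  have e : 20000 * c ^ 3 * (x * E₁ * p * V + L ^ 6 * (Q * E₁ * T₁ + l ^ 3 * (e₂ + e₃) * T₂)) =
      20000 * (c ^ 3 * (x * E₁ * p * V)) + 20000 * (c ^ 3 * (L ^ 6 * (Q * E₁ * T₁)))
        + 20000 * (c ^ 3 * W) := by rw [hW]; ring
  rw [e]
  linarith

/-- The smoothed form of a sequence resembling the integers is close to that of the constant
sequence with the same mean value. -/
theorem Resembles.norm_smoothForm_sub_le {a : ℕ → ℂ} {x P Q R E₁ E₂ E₃ L : ℝ} {α : ℂ}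
    (H : Resembles a x P E₁ E₂ E₃ α) (hE₁ : 0 ≤ E₁) (hE₂ : 0 ≤ E₂) (hE₃ : ‖α‖ ≤ E₃)
    (hP : 3 ≤ P) (hR : 1 ≤ R) (hRP : R * P ≤ x) (hQ : 0 < Q) (hXQ : 2 * x / Q ≤ Q)
    (hQx : Q ≤ x) (hlogx : 1 ≤ Real.log x) (hPL : Real.log P ≤ L) (hXL : Real.log (2 * x / Q) ≤ L)
    {y : ℝ} (hPy : P ≤ y) (hXy : 2 * x / Q ≤ y)
    (hα : ‖α‖ * x ≤ ∑ n ∈ Icc 1 ⌊x⌋₊, ‖a n‖) :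
    ‖smoothForm a x Q P - ((‖α‖ ^ 2 : ℝ) : ℂ) * smoothForm (fun _ => 1) x Q P‖ ≤
      20000 * smoothConst ^ 3 * (x * E₁ * Real.log P * (√(Q / x) * √(concLHS a x Q (2 * x / Q))) +
        L ^ 6 * (Q * E₁ * ∑ n ∈ Icc 1 ⌊x⌋₊, ‖a n‖ * tau3P y n +
          Real.log x ^ 3 * (R * P * E₂ + Q * E₃ / R ^ (1 / Real.log P)) *
            ∑ n ∈ Icc 1 ⌊x⌋₊, ‖a n‖ * tau3 n)) := by
  have hx : 1 ≤ x := by nlinarith [hP, hR, hRP]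
  have hx0 : 0 < x := by linarith
  have hX : 1 ≤ 2 * x / Q := by rw [le_div_iff₀ hQ]; linarith
  have hE₃0 : 0 ≤ E₃ := (norm_nonneg α).trans hE₃
  have hs := H.sum_norm_smoothBlock_sub_small_le hE₁ hE₂ hE₃0 hP hR hRP hQ hXQ hX hPy hXy
  have hl := H.sum_norm_smoothBlock_sub_large_le hE₁ hE₂ hE₃0 hP hR hRP hQ hx hQx
  have hsum : ‖smoothForm a x Q P - ((‖α‖ ^ 2 : ℝ) : ℂ) * smoothForm (fun _ => 1) x Q P‖ ≤
      ∑ h ∈ Icc 1 ⌊Q⌋₊,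
      ‖smoothBlock a x Q P h - ((‖α‖ ^ 2 : ℝ) : ℂ) * smoothBlock (fun _ => 1) x Q P h‖ := by
    have e : ∀ b : ℕ → ℂ, smoothForm b x Q P = ∑ h ∈ Icc 1 ⌊Q⌋₊, smoothBlock b x Q P h :=
      fun b => rfl
    rw [e, e, Finset.mul_sum, ← Finset.sum_sub_distrib]
    exact norm_sum_le _ _
  rw [← Finset.sum_filter_add_sum_filter_not (Icc 1 ⌊Q⌋₊)
    (fun h : ℕ => (h : ℝ) ≤ 2 * x / Q)] at hsum
  refine hsum.trans ((add_le_add hs hl).trans ?_)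
  have hT1 : ∑ n ∈ Icc 1 ⌊x⌋₊, ‖a n‖ ≤ ∑ n ∈ Icc 1 ⌊x⌋₊, ‖a n‖ * tau3P y n :=
    Finset.sum_le_sum fun n _ => by
      have : (1 : ℝ) ≤ tau3P y n := by exact_mod_cast one_le_tau3P y n
      nlinarith [norm_nonneg (a n)]
  have hT2 : ∑ n ∈ Icc 1 ⌊x⌋₊, ‖a n‖ ≤ ∑ n ∈ Icc 1 ⌊x⌋₊, ‖a n‖ * tau3 n :=
    Finset.sum_le_sum fun n hn => by
      have hn0 : n ≠ 0 := by have := (mem_Icc.mp hn).1; omega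
      have : (1 : ℝ) ≤ tau3 n := by exact_mod_cast (tau_pos hn0).trans (tau_le_tau3 hn0)
      nlinarith [norm_nonneg (a n)]
  have hα1 := hα.trans hT1
  have hα2 := hα.trans hT2
  exact smoothForm_error_le hx0 hQ (mul_nonneg (by linarith) (by linarith)) hE₁ hE₂ (norm_nonneg α)
    hE₃ one_le_smoothConst (one_lt_log_of_three_le hP) hPL (Real.log_nonneg hX) hXL
    (Real.rpow_pos_of_pos (by linarith) _) hlogx (by positivity) hα1 hα2

/-- The number of `n ≤ N` in a residue class. -/
noncomputable def resCount (N q b : ℕ) : ℕ := ((Icc 1 N).filter (fun n => n % q = b % q)).card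

theorem resCount_eq (N b : ℕ) {q : ℕ} (hq : 1 ≤ q) :
    resCount N q b = N / q ∨ resCount N q b = N / q + 1 := by
  have h1 : resCount N q b = N.count (· ≡ (b + (q - 1)) [MOD q]) := by
    rw [Nat.count_eq_card_filter_range, resCount]
    refine Finset.card_nbij' (fun n => n - 1) (fun n => n + 1) ?_ ?_ ?_ ?_
    · intro n hn
      simp only [coe_filter, mem_Icc, mem_range, Set.mem_ofPred_eq] at hn ⊢
      refine ⟨by omega, ?_⟩
      refine Nat.ModEq.add_right_cancel' 1 ?_
      rw [show n - 1 + 1 = n by omega, show b + (q - 1) + 1 = b + q by omega]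
      unfold Nat.ModEq
      simpa using hn.2
    · intro n hn
      simp only [coe_filter, mem_Icc, mem_range, Set.mem_ofPred_eq] at hn ⊢
      refine ⟨by omega, ?_⟩
      have := Nat.ModEq.add_right 1 hn.2
      rw [show b + (q - 1) + 1 = b + q by omega] at this
      unfold Nat.ModEq at this
      simpa using this
    · intro n hn
      simp only [coe_filter, mem_Icc, Set.mem_ofPred_eq] at hn
      exact Nat.sub_add_cancel hn.1.1
    · intro n _; simp
  rw [h1, Nat.count_modEq_card _ hq]
  split_ifs <;> simp

theorem sum_resCount (N : ℕ) {q : ℕ} (hq : 1 ≤ q) : ∑ b ∈ Icc 1 q, resCount N q b = N := by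
  have := sum_Icc_sum_residue hq (Icc 1 N) (fun _ _ => 1) (fun _ _ _ => rfl)
  simpa [resCount] using this

theorem sum_sq_resCount_sub (N : ℕ) {q : ℕ} (hq : 1 ≤ q) :
    ∑ b ∈ Icc 1 q, ((resCount N q b : ℝ) - (N : ℝ) / q) ^ 2 =
      q * (Int.fract ((N : ℝ) / q) * (1 - Int.fract ((N : ℝ) / q))) := by
  have hq0 : (0 : ℝ) < q := by exact_mod_cast hq
  set k : ℝ := ((N / q : ℕ) : ℝ) with hk
  have hfl : Int.fract ((N : ℝ) / q) = (N : ℝ) / q - k := by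
    rw [Int.fract, hk, ← Nat.floor_div_eq_div (K := ℝ), ← natCast_floor_eq_intCast_floor (by positivity)]
  have hsum : ∑ b ∈ Icc 1 q, (resCount N q b : ℝ) = N := by exact_mod_cast sum_resCount N hq
  have h1 : ∀ b ∈ Icc 1 q, ((resCount N q b : ℝ) - (N : ℝ) / q) ^ 2 =
      (2 * k + 1 - 2 * ((N : ℝ) / q)) * resCount N q b + (((N : ℝ) / q) ^ 2 - k * (k + 1)) := by
    intro b _
    rcases resCount_eq N b hq with h | h
    · rw [h]; rw [← hk]; ring
    · rw [h]; push_cast; rw [← hk]; ring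
  rw [Finset.sum_congr rfl h1, Finset.sum_add_distrib, ← Finset.mul_sum, hsum, Finset.sum_const,
    Nat.card_Icc, nsmul_eq_mul, hfl]
  simp only [Nat.add_sub_cancel]
  field_simp
  ring

/-- The average of the counting function over residues `b` with `(b, q) = h`. -/
noncomputable def classMean (N q h : ℕ) : ℝ :=
  1 / ((q / h).totient : ℝ) * ∑ b ∈ (Icc 1 q).filter (fun b => b.gcd q = h), (resCount N q b : ℝ)

theorem seqSum_one (z : ℝ) (q b : ℕ) : seqSum (fun _ => 1) z q b = (resCount ⌊z⌋₊ q b : ℂ) := by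
  simp [seqSum, resCount]

theorem seqAver_one (z : ℝ) (q h : ℕ) :
    seqAver (fun _ => 1) z q h = ((classMean ⌊z⌋₊ q h : ℝ) : ℂ) := by
  unfold seqAver classMean
  simp only [seqSum_one]
  push_cast
  rfl

theorem classMean_mem (N : ℕ) {q h : ℕ} (hq : 1 ≤ q) (hh : h ∣ q) :
    ((N / q : ℕ) : ℝ) ≤ classMean N q h ∧ classMean N q h ≤ (N / q : ℕ) + 1 := by
  have hφ : 0 < (q / h).totient :=
    Nat.totient_pos.mpr (Nat.div_pos (Nat.le_of_dvd hq hh) (Nat.pos_of_dvd_of_pos hh hq))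
  have hφ' : (0 : ℝ) < (q / h).totient := by exact_mod_cast hφ
  have hc := card_gcd_class hq hh
  unfold classMean
  rw [one_div_mul_eq_div, le_div_iff₀ hφ', div_le_iff₀ hφ']
  constructor
  · calc ((N / q : ℕ) : ℝ) * ((q / h).totient : ℝ) =
        ∑ b ∈ (Icc 1 q).filter (fun b => b.gcd q = h), ((N / q : ℕ) : ℝ) := by
          rw [Finset.sum_const, hc, nsmul_eq_mul, mul_comm]
      _ ≤ _ := Finset.sum_le_sum fun b _ => by
          rcases resCount_eq N b hq with h | h <;> rw [h]
          push_cast; linarith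
  · calc _ ≤ ∑ b ∈ (Icc 1 q).filter (fun b => b.gcd q = h), (((N / q : ℕ) : ℝ) + 1) :=
          Finset.sum_le_sum fun b _ => by
            rcases resCount_eq N b hq with h | h <;> rw [h] <;> push_cast <;> linarith
      _ = (((N / q : ℕ) : ℝ) + 1) * ((q / h).totient : ℝ) := by
          rw [Finset.sum_const, hc, nsmul_eq_mul, mul_comm]

theorem discrep_one (z : ℝ) (q m : ℕ) : discrep (fun _ => 1) z q m =
    (((resCount ⌊z⌋₊ q m : ℝ) - classMean ⌊z⌋₊ q (m.gcd q) : ℝ) : ℂ) := by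
  unfold discrep
  rw [seqSum_one, seqAver_one]
  push_cast
  rfl

theorem abs_resCount_sub_classMean_le (N m : ℕ) {q : ℕ} (hq : 1 ≤ q) :
    |(resCount N q m : ℝ) - classMean N q (m.gcd q)| ≤ 1 := by
  have h1 := classMean_mem N hq (Nat.gcd_dvd_right m q)
  rw [abs_le]
  rcases resCount_eq N m hq with h | h <;> rw [h] <;> push_cast <;> constructor <;> linarith

theorem progLHS_one_le {x Q : ℝ} (hx : 0 ≤ x) (hQ : 0 < Q) :
    progLHS (fun _ => 1) x Q ≤ 2 * x ^ 2 / Q := by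
  rw [progLHS_eq]
  calc _ ≤ ∑ r ∈ Icc 1 ⌊2 * x / Q⌋₊, ∑ n ∈ Icc 1 ⌊x⌋₊, (1 : ℝ) := by
        refine Finset.sum_le_sum fun r hr => Finset.sum_le_sum fun n _ => ?_
        rw [norm_one, one_mul]
        unfold discrepSup
        refine Real.iSup_le (fun z => Real.iSup_le (fun _ => ?_) zero_le_one) zero_le_one
        rw [discrep_one, Complex.norm_real]
        exact abs_resCount_sub_classMean_le _ _ (mem_Icc.mp hr).1
    _ = (⌊2 * x / Q⌋₊ : ℝ) * ⌊x⌋₊ := by simp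
    _ ≤ 2 * x / Q * x := by
        gcongr
        · exact Nat.floor_le (by positivity)
        · exact Nat.floor_le hx
    _ = _ := by ring

theorem card_coprime_eq_sum_moebius {k : ℕ} (hk : 1 ≤ k) (M : ℕ) :
    (((Icc 1 M).filter (fun n => n.Coprime k)).card : ℤ) =
      ∑ d ∈ k.divisors, ArithmeticFunction.moebius d * ((M / d : ℕ) : ℤ) := by
  have hμ : ∀ n ∈ Icc 1 M, (if n.Coprime k then (1 : ℤ) else 0) =
      ∑ d ∈ k.divisors, if d ∣ n then ArithmeticFunction.moebius d else 0 := by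
    intro n hn
    have h1 : ∑ d ∈ (n.gcd k).divisors, ArithmeticFunction.moebius d =
        if n.gcd k = 1 then (1 : ℤ) else 0 := by
      have := congrArg (fun f => f (n.gcd k)) ArithmeticFunction.moebius_mul_coe_zeta
      simp only [ArithmeticFunction.coe_mul_zeta_apply, ArithmeticFunction.one_apply] at this
      exact this
    rw [← Finset.sum_filter]
    rw [show (if n.Coprime k then (1 : ℤ) else 0) = if n.gcd k = 1 then (1 : ℤ) else 0 from rfl, ← h1]
    refine Finset.sum_congr ?_ fun _ _ => rfl
    ext d
    simp only [Nat.mem_divisors, mem_filter, Nat.dvd_gcd_iff]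
    have : n.gcd k ≠ 0 := (Nat.gcd_pos_of_pos_right _ hk).ne'
    have : k ≠ 0 := by omega
    tauto
  rw [Finset.card_filter]
  push_cast
  rw [Finset.sum_congr rfl hμ, Finset.sum_comm]
  refine Finset.sum_congr rfl fun d hd => ?_
  rw [← Finset.sum_filter, sum_Icc_filter_dvd M (Nat.pos_of_mem_divisors hd)
    (fun _ => ArithmeticFunction.moebius d)]
  simp [mul_comm]

theorem totient_eq_sum_moebius {k : ℕ} (hk : 1 ≤ k) :
    (k.totient : ℝ) = ∑ d ∈ k.divisors, (ArithmeticFunction.moebius d : ℝ) * ((k : ℝ) / d) := by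
  have h1 := card_gcd_class hk (one_dvd k)
  rw [Nat.div_one] at h1
  have h2 := card_coprime_eq_sum_moebius hk k
  rw [show ((Icc 1 k).filter (fun n => n.Coprime k)).card = k.totient from h1] at h2
  have h3 : (k.totient : ℝ) = ((k.totient : ℤ) : ℝ) := by simp
  rw [h3, h2, Int.cast_sum]
  refine Finset.sum_congr rfl fun d hd => ?_
  rw [Int.cast_mul, Int.cast_natCast, Nat.cast_div (Nat.dvd_of_mem_divisors hd)
    (by exact_mod_cast (Nat.pos_of_mem_divisors hd).ne')]

theorem abs_card_coprime_sub_le {k h : ℕ} (hk : 1 ≤ k) (hh : 1 ≤ h) (N : ℕ) :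
    |(((Icc 1 (N / h)).filter (fun n => n.Coprime k)).card : ℝ) -
      k.totient * ((N : ℝ) / (h * k : ℕ))| ≤ tau k := by
  have h1 := card_coprime_eq_sum_moebius hk (N / h)
  have h2 : (((Icc 1 (N / h)).filter (fun n => n.Coprime k)).card : ℝ) =
      ∑ d ∈ k.divisors, (ArithmeticFunction.moebius d : ℝ) * ((N / (h * d) : ℕ) : ℝ) := by
    have : (((Icc 1 (N / h)).filter (fun n => n.Coprime k)).card : ℝ) =
      ((((Icc 1 (N / h)).filter (fun n => n.Coprime k)).card : ℤ) : ℝ) := by simp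
    rw [this, h1, Int.cast_sum]
    refine Finset.sum_congr rfl fun d _ => ?_
    rw [Int.cast_mul, Int.cast_natCast, Nat.div_div_eq_div_mul]
  have hk0 : (0 : ℝ) < k := by exact_mod_cast hk
  have hh0 : (0 : ℝ) < h := by exact_mod_cast hh
  rw [h2, totient_eq_sum_moebius hk, Finset.sum_mul, ← Finset.sum_sub_distrib]
  refine (Finset.abs_sum_le_sum_abs _ _).trans ?_
  have : (tau k : ℝ) = ∑ d ∈ k.divisors, (1 : ℝ) := by simp [tau]
  rw [this]
  refine Finset.sum_le_sum fun d hd => ?_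
  have hd0 : (0 : ℝ) < d := by exact_mod_cast Nat.pos_of_mem_divisors hd
  have e : (k : ℝ) / d * ((N : ℝ) / (h * k : ℕ)) = (N : ℝ) / (h * d : ℕ) := by
    push_cast; field_simp
  rw [mul_assoc, e, ← mul_sub, abs_mul]
  have hμ : |(ArithmeticFunction.moebius d : ℝ)| ≤ 1 := by
    exact_mod_cast ArithmeticFunction.abs_moebius_le_one (n := d)
  refine mul_le_one₀ hμ (abs_nonneg _) ?_
  have f1 : ((N / (h * d) : ℕ) : ℝ) ≤ (N : ℝ) / (h * d : ℕ) := Nat.cast_div_le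
  have f2 : (N : ℝ) / (h * d : ℕ) < ((N / (h * d) : ℕ) : ℝ) + 1 := by
    rw [← Nat.floor_div_eq_div (K := ℝ)]
    exact Nat.lt_floor_add_one _
  rw [abs_le]
  constructor <;> linarith

theorem totient_mul_abs_classMean_sub_le (N : ℕ) {q h : ℕ} (hq : 1 ≤ q) (hh : h ∣ q) :
    ((q / h).totient : ℝ) * |classMean N q h - (N : ℝ) / q| ≤ tau (q / h) := by
  have hh1 : 1 ≤ h := Nat.pos_of_dvd_of_pos hh hq
  obtain ⟨k, rfl⟩ := hh
  have hk : 1 ≤ k := Nat.pos_of_mul_pos_left hq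
  rw [Nat.mul_div_cancel_left _ hh1]
  have hφ : (0 : ℝ) < k.totient := by exact_mod_cast Nat.totient_pos.mpr hk
  have h1 : (k.totient : ℝ) * classMean N (h * k) h =
      ((Icc 1 (N / h)).filter (fun n => n.Coprime k)).card := by
    unfold classMean
    rw [Nat.mul_div_cancel_left _ hh1, ← mul_assoc, mul_one_div_cancel hφ.ne', one_mul]
    have h2 := sum_Icc_sum_residue hq (Icc 1 N)
      (fun b _ => if b.gcd (h * k) = h then (1 : ℝ) else 0)
      (fun n b hb => by rw [gcd_eq_of_mod_eq hb])
    rw [Finset.sum_filter]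
    have h3 : ∀ b ∈ Icc 1 (h * k), (if b.gcd (h * k) = h then (resCount N (h * k) b : ℝ) else 0) =
        ∑ n ∈ (Icc 1 N).filter (fun n => n % (h * k) = b % (h * k)),
          (if b.gcd (h * k) = h then (1 : ℝ) else 0) := by
      intro b _
      split_ifs <;> simp [resCount]
    rw [Finset.sum_congr rfl h3, h2, Finset.card_filter]
    push_cast
    have h4 := sum_Icc_filter_dvd N hh1 (fun n => if n.gcd (h * k) = h then (1 : ℝ) else 0)
    have h5 : ∀ n, (h * n).gcd (h * k) = h ↔ n.Coprime k := by
      intro n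
      rw [Nat.gcd_mul_left]
      constructor
      · intro h6
        exact Nat.eq_of_mul_eq_mul_left hh1 (by rw [h6, mul_one])
      · intro h6
        rw [h6.gcd_eq_one, mul_one]
    simp only [h5] at h4
    rw [← h4, Finset.sum_filter]
    refine Finset.sum_congr rfl fun n _ => ?_
    split_ifs with h6 h7 h8
    · rfl
    · exact absurd (h6 ▸ Nat.gcd_dvd_left n (h * k)) h7
    all_goals rfl
  have h2 := abs_card_coprime_sub_le hk hh1 N
  rwa [← h1, ← mul_sub, abs_mul, abs_of_pos hφ] at h2

theorem abs_sum_sq_discrep_one_sub_le (N : ℕ) {q : ℕ} (hq : 1 ≤ q) :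
    |∑ b ∈ Icc 1 q, ((resCount N q b : ℝ) - classMean N q (b.gcd q)) ^ 2 -
      q * (Int.fract ((N : ℝ) / q) * (1 - Int.fract ((N : ℝ) / q)))| ≤
      2 * ∑ k ∈ q.divisors, (tau k : ℝ) := by
  rw [← sum_sq_resCount_sub N hq, ← Finset.sum_sub_distrib]
  refine (Finset.abs_sum_le_sum_abs _ _).trans ?_
  have hq0 : (0 : ℝ) < q := by exact_mod_cast hq
  have f1 : ((N / q : ℕ) : ℝ) ≤ (N : ℝ) / q := Nat.cast_div_le
  have f2 : (N : ℝ) / q < ((N / q : ℕ) : ℝ) + 1 := by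
    rw [← Nat.floor_div_eq_div (K := ℝ)]
    exact Nat.lt_floor_add_one _
  have h1 : ∀ b ∈ Icc 1 q, |((resCount N q b : ℝ) - classMean N q (b.gcd q)) ^ 2 -
      ((resCount N q b : ℝ) - (N : ℝ) / q) ^ 2| ≤ 2 * |classMean N q (b.gcd q) - (N : ℝ) / q| := by
    intro b _
    have h2 := abs_resCount_sub_classMean_le N b hq
    have h3 : |(resCount N q b : ℝ) - (N : ℝ) / q| ≤ 1 := by
      rw [abs_le]
      rcases resCount_eq N b hq with h | h <;> rw [h] <;> push_cast <;> constructor <;> linarith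
    rw [show ((resCount N q b : ℝ) - classMean N q (b.gcd q)) ^ 2 -
      ((resCount N q b : ℝ) - (N : ℝ) / q) ^ 2 =
      -(((resCount N q b : ℝ) - classMean N q (b.gcd q)) + ((resCount N q b : ℝ) - (N : ℝ) / q)) *
        (classMean N q (b.gcd q) - (N : ℝ) / q) by ring, abs_mul, abs_neg]
    gcongr
    exact (abs_add_le _ _).trans (by linarith)
  refine (Finset.sum_le_sum h1).trans ?_
  rw [← Finset.mul_sum]
  gcongr
  rw [← Finset.sum_fiberwise_of_maps_to (t := q.divisors) (g := fun b => b.gcd q)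
    (fun b _ => Nat.mem_divisors.mpr ⟨Nat.gcd_dvd_right b q, by omega⟩)]
  rw [← Nat.sum_div_divisors q (fun k => (tau k : ℝ))]
  refine Finset.sum_le_sum fun h hh => ?_
  have hd := Nat.dvd_of_mem_divisors hh
  calc ∑ b ∈ (Icc 1 q).filter (fun b => b.gcd q = h), |classMean N q (b.gcd q) - (N : ℝ) / q|
      = ∑ b ∈ (Icc 1 q).filter (fun b => b.gcd q = h), |classMean N q h - (N : ℝ) / q| :=
        Finset.sum_congr rfl fun b hb => by rw [(mem_filter.mp hb).2]
    _ = ((q / h).totient : ℝ) * |classMean N q h - (N : ℝ) / q| := by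
        rw [Finset.sum_const, card_gcd_class hq hd, nsmul_eq_mul]
    _ ≤ _ := totient_mul_abs_classMean_sub_le N hq hd

/-- The one-periodic function `{v}(1 - {v})`. -/
noncomputable def fractQuad (v : ℝ) : ℝ := Int.fract v * (1 - Int.fract v)

theorem fractQuad_nonneg (v : ℝ) : 0 ≤ fractQuad v :=
  mul_nonneg (Int.fract_nonneg v) (by linarith [Int.fract_lt_one v])

theorem fractQuad_le_one (v : ℝ) : fractQuad v ≤ 1 := by
  unfold fractQuad
  nlinarith [Int.fract_nonneg v, Int.fract_lt_one v]

theorem abs_fractQuad_sub_le_of_le {u v : ℝ} (h : u ≤ v) :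
    |fractQuad u - fractQuad v| ≤ v - u := by
  have hu := Int.floor_add_fract u
  have hv := Int.floor_add_fract v
  have hu0 := Int.fract_nonneg u
  have hv0 := Int.fract_nonneg v
  have hu1 := Int.fract_lt_one u
  have hv1 := Int.fract_lt_one v
  unfold fractQuad
  rcases (Int.floor_le_floor h).eq_or_lt with hf | hf
  · rw [hf] at hu
    rw [abs_le]
    constructor <;> nlinarith
  · have : (⌊u⌋ : ℝ) + 1 ≤ ⌊v⌋ := by exact_mod_cast hf
    rw [abs_le]
    constructor <;> nlinarith

theorem abs_fractQuad_sub_le (u v : ℝ) : |fractQuad u - fractQuad v| ≤ |u - v| := by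
  rcases le_total u v with h | h
  · rw [abs_sub_comm u v, abs_of_nonneg (sub_nonneg.2 h)]
    exact abs_fractQuad_sub_le_of_le h
  · rw [abs_sub_comm, abs_of_nonneg (sub_nonneg.2 h)]
    exact abs_fractQuad_sub_le_of_le h

theorem continuous_fractQuad : Continuous fractQuad :=
  (LipschitzWith.of_dist_le_mul (K := 1) fun u v => by
    simpa [Real.dist_eq] using abs_fractQuad_sub_le u v).continuous

theorem continuousOn_mul_fractQuad_div (x : ℝ) :
    ContinuousOn (fun t : ℝ => t * fractQuad (x / t)) (Set.Ioi 0) := by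
  refine continuousOn_id.mul (continuous_fractQuad.comp_continuousOn ?_)
  exact continuousOn_const.div continuousOn_id fun t ht => (Set.mem_Ioi.1 ht).ne'

theorem abs_mul_fractQuad_div_sub_le {x s t : ℝ} (hx : 0 ≤ x) (hs : 0 < s) (ht : 0 < t) :
    |t * fractQuad (x / t) - s * fractQuad (x / s)| ≤ |t - s| * (1 + x / t) := by
  have e : t * fractQuad (x / t) - s * fractQuad (x / s) =
      (t - s) * fractQuad (x / t) + s * (fractQuad (x / t) - fractQuad (x / s)) := by ring
  rw [e]
  refine (abs_add_le _ _).trans ?_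
  rw [abs_mul, abs_mul, abs_of_pos hs, mul_add]
  refine add_le_add ?_ ?_
  · refine mul_le_mul_of_nonneg_left ?_ (abs_nonneg _)
    rw [abs_of_nonneg (fractQuad_nonneg _)]
    exact fractQuad_le_one _
  · calc s * |fractQuad (x / t) - fractQuad (x / s)| ≤ s * |x / t - x / s| :=
        mul_le_mul_of_nonneg_left (abs_fractQuad_sub_le _ _) hs.le
      _ = |t - s| * (x / t) := by
        have : x / t - x / s = (s - t) * (x / t) / s := by field_simp
        rw [this, abs_div, abs_mul, abs_of_pos hs, abs_of_nonneg (div_nonneg hx ht.le),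
          abs_sub_comm]
        field_simp

theorem sq_mul_integral_fractQuad {x Q : ℝ} (hx : 0 < x) (hQ : 0 < Q) :
    x ^ 2 * ∫ v in (x / Q)..(2 * x / Q), fractQuad v / v ^ 3 =
      ∫ t in (Q / 2)..Q, t * fractQuad (x / t) := by
  have hpos : ∀ t ∈ Set.uIcc (Q / 2) Q, 0 < t := by
    intro t ht
    rw [Set.uIcc_of_le (by linarith)] at ht
    linarith [ht.1]
  have key := intervalIntegral.integral_comp_mul_deriv' (a := Q / 2) (b := Q)
    (f := fun t => x / t) (f' := fun t => -x / t ^ 2) (g := fun v => fractQuad v / v ^ 3)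
    (fun t ht => by
      have := (hasDerivAt_inv (hpos t ht).ne').const_mul x
      have e : (fun t : ℝ => x / t) = fun t => x * t⁻¹ := funext fun t => div_eq_mul_inv x t
      rw [e]
      exact this.congr_deriv (by field_simp))
    (by
      refine continuousOn_const.div (continuousOn_id.pow 2) fun t ht => ?_
      exact pow_ne_zero 2 (hpos t ht).ne')
    (by
      refine continuous_fractQuad.continuousOn.div (continuousOn_id.pow 3) ?_
      rintro v ⟨t, ht, rfl⟩
      exact pow_ne_zero 3 (div_pos hx (hpos t ht)).ne')
  have e1 : x / (Q / 2) = 2 * x / Q := by field_simp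
  simp only [e1] at key
  rw [intervalIntegral.integral_symm, ← key, ← intervalIntegral.integral_neg,
    ← intervalIntegral.integral_const_mul]
  refine intervalIntegral.integral_congr fun t ht => ?_
  have ht0 := hpos t ht
  simp only [Function.comp]
  field_simp

theorem abs_sum_mul_fractQuad_sub_integral_le {x Q : ℝ} (hQ : 4 ≤ Q) (hQx : Q ≤ x) :
    |(∑ q ∈ Ioc ⌊Q / 2⌋₊ ⌊Q⌋₊, (q : ℝ) * fractQuad (x / q)) -
      ∫ t in (Q / 2)..Q, t * fractQuad (x / t)| ≤ 7 * x := by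
  set F : ℝ → ℝ := fun t => t * fractQuad (x / t) with hF
  set m := ⌊Q / 2⌋₊
  set M := ⌊Q⌋₊
  have hx : 0 < x := by linarith
  have hm1 : (m : ℝ) ≤ Q / 2 := Nat.floor_le (by linarith)
  have hm2 : Q / 2 < m + 1 := Nat.lt_floor_add_one _
  have hM1 : (M : ℝ) ≤ Q := Nat.floor_le (by linarith)
  have hM2 : Q < M + 1 := Nat.lt_floor_add_one _
  have hmM : m ≤ M := Nat.floor_le_floor (by linarith)
  have hIntF : ∀ a b : ℝ, 0 < a → 0 < b → IntervalIntegrable F MeasureTheory.volume a b := by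
    intro a b ha hb
    refine ((continuousOn_mul_fractQuad_div x).mono ?_).intervalIntegrable
    intro t ht
    exact lt_of_lt_of_le (lt_min ha hb) ht.1
  have hFb : ∀ t, 0 < t → |F t| ≤ t := by
    intro t ht
    rw [hF]
    simp only
    rw [abs_of_nonneg (mul_nonneg ht.le (fractQuad_nonneg _))]
    exact mul_le_of_le_one_right ht.le (fractQuad_le_one _)
  have hpiece : ∀ a b : ℝ, 0 < a → a ≤ b → b ≤ Q → b - a ≤ 1 → |∫ t in a..b, F t| ≤ Q := by
    intro a b ha hab hbQ hba
    have := intervalIntegral.norm_integral_le_of_norm_le_const (a := a) (b := b) (f := F) (C := Q)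
      (fun t ht => by
        rw [Set.uIoc_of_le hab] at ht
        rw [Real.norm_eq_abs]
        exact (hFb t (ha.trans ht.1)).trans (ht.2.trans hbQ))
    rw [Real.norm_eq_abs, abs_of_nonneg (sub_nonneg.2 hab)] at this
    nlinarith
  have hmpos : (0 : ℝ) < m := by linarith
  have hMpos : (0 : ℝ) < M := by linarith
  have hadj := intervalIntegral.sum_integral_adjacent_intervals_Ico (f := F)
    (μ := MeasureTheory.volume) (a := fun k : ℕ => (k : ℝ)) hmM
    (fun k hk => by
      have : (m : ℝ) ≤ k := by exact_mod_cast hk.1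
      exact hIntF _ _ (by linarith) (by push_cast; linarith))
  have hshift : ∑ q ∈ Ioc m M, F q = ∑ k ∈ Ico m M, F ((k + 1 : ℕ) : ℝ) := by
    rw [Finset.sum_Ico_add' (fun k : ℕ => F k) m M 1]
    refine Finset.sum_congr ?_ fun _ _ => rfl
    ext k
    simp only [mem_Ioc, mem_Ico]
    omega
  have hunit : ∀ k ∈ Ico m M,
      |F ((k + 1 : ℕ) : ℝ) - ∫ t in ((k : ℕ) : ℝ)..((k + 1 : ℕ) : ℝ), F t| ≤ 1 + 4 * x / Q := by
    intro k hk
    have hkm : (m : ℝ) ≤ k := by exact_mod_cast (mem_Ico.1 hk).1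
    have hk0 : (0 : ℝ) < k := by linarith
    have hc : F ((k + 1 : ℕ) : ℝ) = ∫ _ in ((k : ℕ) : ℝ)..((k + 1 : ℕ) : ℝ), F ((k + 1 : ℕ) : ℝ) := by
      rw [intervalIntegral.integral_const]
      push_cast
      simp
    rw [hc, ← intervalIntegral.integral_sub (by simp)
      (hIntF _ _ hk0 (by push_cast; linarith))]
    have := intervalIntegral.norm_integral_le_of_norm_le_const (a := ((k : ℕ) : ℝ))
      (b := ((k + 1 : ℕ) : ℝ)) (f := fun t => F ((k + 1 : ℕ) : ℝ) - F t) (C := 1 + 4 * x / Q)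
      (fun t ht => by
        rw [Set.uIoc_of_le (by push_cast; linarith)] at ht
        have ht0 : 0 < t := hk0.trans ht.1
        have ht2 : t ≤ k + 1 := by have := ht.2; push_cast at this; exact this
        rw [Real.norm_eq_abs, abs_sub_comm]
        refine (abs_mul_fractQuad_div_sub_le hx.le (by push_cast; linarith) ht0).trans ?_
        have h1 : |t - ((k + 1 : ℕ) : ℝ)| ≤ 1 := by
          push_cast
          rw [abs_le]
          constructor <;> linarith [ht.1]
        have h2 : x / t ≤ 4 * x / Q := by
          rw [div_le_div_iff₀ ht0 (by linarith)]
          nlinarith [ht.1]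
        have h3 : 0 ≤ x / t := by positivity
        calc _ ≤ 1 * (1 + x / t) := mul_le_mul_of_nonneg_right h1 (by linarith)
          _ ≤ _ := by linarith)
    rw [Real.norm_eq_abs] at this
    refine this.trans (le_of_eq ?_)
    push_cast
    simp
  have hsum : |(∑ q ∈ Ioc m M, F q) - ∫ t in (m : ℝ)..(M : ℝ), F t| ≤ 5 * x := by
    rw [hshift, ← hadj, ← Finset.sum_sub_distrib]
    refine (Finset.abs_sum_le_sum_abs _ _).trans ((Finset.sum_le_sum hunit).trans ?_)
    rw [Finset.sum_const, Nat.card_Ico, nsmul_eq_mul, Nat.cast_sub hmM]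
    have h1 : (M : ℝ) - m ≤ Q := by linarith
    have h2 : 0 ≤ 1 + 4 * x / Q := by positivity
    calc _ ≤ Q * (1 + 4 * x / Q) := mul_le_mul_of_nonneg_right h1 h2
      _ = Q + 4 * x := by field_simp
      _ ≤ _ := by linarith
  have hsplit : ∫ t in (Q / 2)..Q, F t =
      (∫ t in (m : ℝ)..(M : ℝ), F t) - (∫ t in (m : ℝ)..(Q / 2), F t) + ∫ t in (M : ℝ)..Q, F t := by
    have h1 := intervalIntegral.integral_add_adjacent_intervals
      (hIntF m (Q / 2) hmpos (by linarith)) (hIntF (Q / 2) Q (by linarith) (by linarith))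
    have h2 := intervalIntegral.integral_add_adjacent_intervals
      (hIntF m M hmpos hMpos) (hIntF M Q hMpos (by linarith))
    linarith
  have p1 := hpiece m (Q / 2) hmpos hm1 (by linarith) (by linarith)
  have p2 := hpiece M Q hMpos hM1 le_rfl (by linarith)
  change |(∑ q ∈ Ioc m M, F q) - ∫ t in (Q / 2)..Q, F t| ≤ 7 * x
  rw [hsplit]
  rw [abs_le] at *
  constructor <;> linarith

theorem sum_sum_divisors_tau_le (M : ℕ) :
    ∑ q ∈ Icc 1 M, ∑ k ∈ q.divisors, (tau k : ℝ) ≤ M * (1 + Real.log M) ^ 2 := by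
  rcases Nat.eq_zero_or_pos M with rfl | hM
  · simp
  have hlog : 0 ≤ Real.log M := Real.log_natCast_nonneg M
  have h1 := sum_Icc_sum_divisors M (fun k _ => (tau k : ℝ))
  rw [h1]
  have h2 : ∑ d ∈ Icc 1 M, ∑ _l ∈ Icc 1 (M / d), (tau d : ℝ) =
      ∑ l ∈ Icc 1 M, ∑ d ∈ Icc 1 (M / l), (tau d : ℝ) := by
    rw [← sum_Icc_sum_divisors M (fun d _ => (tau d : ℝ)),
      ← sum_Icc_sum_divisors M (fun _ d => (tau d : ℝ))]
    refine Finset.sum_congr rfl fun k _ => ?_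
    exact (Nat.sum_div_divisors k (fun d => (tau d : ℝ))).symm
  rw [h2]
  calc _ ≤ ∑ l ∈ Icc 1 M, (M : ℝ) * (1 + Real.log M) * (1 / (l : ℝ)) := by
        refine Finset.sum_le_sum fun l hl => ?_
        have hl0 : (0 : ℝ) < l := by exact_mod_cast (mem_Icc.1 hl).1
        refine (sum_tau_le (M / l)).trans ?_
        have a1 : ((M / l : ℕ) : ℝ) ≤ (M : ℝ) / l := Nat.cast_div_le
        have hpos : (0 : ℝ) < ((M / l : ℕ) : ℝ) := by
          exact_mod_cast Nat.div_pos (mem_Icc.1 hl).2 (mem_Icc.1 hl).1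
        have a2 : Real.log ((M / l : ℕ) : ℝ) ≤ Real.log M :=
          Real.log_le_log hpos (by exact_mod_cast Nat.div_le_self M l)
        have a3 : 0 ≤ Real.log ((M / l : ℕ) : ℝ) := Real.log_natCast_nonneg _
        calc _ ≤ (M : ℝ) / l * (1 + Real.log M) :=
              mul_le_mul a1 (by linarith) (by linarith) (by positivity)
          _ = _ := by ring
    _ = M * (1 + Real.log M) * ∑ l ∈ Icc 1 M, 1 / (l : ℝ) := by rw [Finset.mul_sum]
    _ ≤ M * (1 + Real.log M) * (1 + Real.log M) :=
        mul_le_mul_of_nonneg_left (sum_Icc_inv_le M) (by positivity)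
    _ = _ := by ring

theorem varV_one (x Q : ℝ) :
    varV (fun _ => 1) x Q = ∑ q ∈ Ioc ⌊Q / 2⌋₊ ⌊Q⌋₊, ∑ b ∈ Icc 1 q,
      ((resCount ⌊x⌋₊ q b : ℝ) - classMean ⌊x⌋₊ q (b.gcd q)) ^ 2 := by
  unfold varV
  refine Finset.sum_congr rfl fun q _ => Finset.sum_congr rfl fun b _ => ?_
  have h := discrep_one x q b
  rw [discrep] at h
  rw [h, Complex.norm_real, Real.norm_eq_abs, sq_abs]

theorem abs_varV_one_sub_le {x Q : ℝ} (hQ : 4 ≤ Q) (hQx : Q ≤ x) (hlog : 1 ≤ Real.log x) :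
    |varV (fun _ => 1) x Q -
      x ^ 2 * ∫ v in (x / Q)..(2 * x / Q), Int.fract v * (1 - Int.fract v) / v ^ 3| ≤
      16 * (x * Real.log x ^ 2) := by
  have hx : 0 < x := by linarith
  have hI := sq_mul_integral_fractQuad hx (show 0 < Q by linarith)
  simp only [fractQuad] at hI
  have hS := abs_sum_mul_fractQuad_sub_integral_le hQ hQx
  simp only [fractQuad] at hS
  rw [hI]
  have hM1 : (⌊Q⌋₊ : ℝ) ≤ Q := Nat.floor_le (by linarith)
  have hsub : Ioc ⌊Q / 2⌋₊ ⌊Q⌋₊ ⊆ Icc 1 ⌊Q⌋₊ := by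
    intro k hk
    simp only [mem_Ioc, mem_Icc] at *
    omega
  have hV : |varV (fun _ => 1) x Q -
      ∑ q ∈ Ioc ⌊Q / 2⌋₊ ⌊Q⌋₊, (q : ℝ) * (Int.fract (x / q) * (1 - Int.fract (x / q)))| ≤
      8 * (x * Real.log x ^ 2) + x := by
    rw [varV_one, ← Finset.sum_sub_distrib]
    refine (Finset.abs_sum_le_sum_abs _ _).trans ?_
    have hterm : ∀ q ∈ Ioc ⌊Q / 2⌋₊ ⌊Q⌋₊,
        |∑ b ∈ Icc 1 q, ((resCount ⌊x⌋₊ q b : ℝ) - classMean ⌊x⌋₊ q (b.gcd q)) ^ 2 -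
          (q : ℝ) * (Int.fract (x / q) * (1 - Int.fract (x / q)))| ≤
        2 * ∑ k ∈ q.divisors, (tau k : ℝ) + 1 := by
      intro q hq
      have hq1 : 1 ≤ q := (mem_Icc.1 (hsub hq)).1
      have hq0 : (0 : ℝ) < q := by exact_mod_cast hq1
      have h1 := abs_sum_sq_discrep_one_sub_le ⌊x⌋₊ hq1
      have h2 := abs_fractQuad_sub_le ((⌊x⌋₊ : ℝ) / q) (x / q)
      have h3 : |(⌊x⌋₊ : ℝ) / q - x / q| ≤ 1 / q := by
        rw [← sub_div, abs_div, abs_of_pos hq0]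
        refine div_le_div_of_nonneg_right ?_ hq0.le
        rw [abs_le]
        constructor <;> linarith [Nat.floor_le hx.le, Nat.lt_floor_add_one x]
      have h4 : |(q : ℝ) * fractQuad ((⌊x⌋₊ : ℝ) / q) - q * fractQuad (x / q)| ≤ 1 := by
        rw [← mul_sub, abs_mul, abs_of_pos hq0]
        calc _ ≤ (q : ℝ) * (1 / q) := mul_le_mul_of_nonneg_left (h2.trans h3) hq0.le
          _ = 1 := by field_simp
      simp only [fractQuad] at h4
      refine (abs_sub_le _ _ _).trans (add_le_add h1 h4)
    refine (Finset.sum_le_sum hterm).trans ?_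
    rw [Finset.sum_add_distrib, ← Finset.mul_sum]
    have t1 : ∑ q ∈ Ioc ⌊Q / 2⌋₊ ⌊Q⌋₊, ∑ k ∈ q.divisors, (tau k : ℝ) ≤
        x * (2 * Real.log x) ^ 2 := by
      refine (Finset.sum_le_sum_of_subset_of_nonneg hsub
        fun _ _ _ => Finset.sum_nonneg fun _ _ => Nat.cast_nonneg _).trans ?_
      refine (sum_sum_divisors_tau_le _).trans ?_
      have hF1 : (0 : ℝ) < ⌊Q⌋₊ := by exact_mod_cast Nat.floor_pos.2 (by linarith)
      have l1 : Real.log ⌊Q⌋₊ ≤ Real.log x := Real.log_le_log hF1 (by linarith)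
      have l0 : 0 ≤ Real.log (⌊Q⌋₊ : ℝ) := Real.log_natCast_nonneg _
      exact mul_le_mul (by linarith) (pow_le_pow_left₀ (by linarith) (by linarith) 2)
        (by positivity) hx.le
    have t2 : ∑ _q ∈ Ioc ⌊Q / 2⌋₊ ⌊Q⌋₊, (1 : ℝ) ≤ x := by
      refine (Finset.sum_le_sum_of_subset_of_nonneg hsub fun _ _ _ => zero_le_one).trans ?_
      simp
      linarith
    nlinarith
  have hxl : x ≤ x * Real.log x ^ 2 := le_mul_of_one_le_right hx.le (one_le_pow₀ hlog)
  refine (abs_sub_le _ _ _).trans ((add_le_add hV hS).trans ?_)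
  linarith

theorem norm_mul_one_sub_le_discrepSup (a : ℕ → ℂ) {x : ℝ} {n r : ℕ} (hr : 1 ≤ r) (hn : 1 ≤ n)
    (hnx : (n : ℝ) ≤ x) : ‖a n‖ * (1 - gcdKernel r n n) ≤ 2 * discrepSup a x r n := by
  have h1 := norm_discrep_le_discrepSup a (z := n) (Nat.cast_nonneg n) hnx hr n
  have hn1 : (((n - 1 : ℕ) : ℕ) : ℝ) ≤ x :=
    (Nat.cast_le.2 (Nat.sub_le n 1)).trans hnx
  have h2 := norm_discrep_le_discrepSup a (z := ((n - 1 : ℕ) : ℝ)) (Nat.cast_nonneg _) hn1 hr n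
  have h3 : discrep a n r n - discrep a ((n - 1 : ℕ) : ℝ) r n =
      a n * ((1 - gcdKernel r n n : ℝ) : ℂ) := by
    rw [discrep_eq a _ hr, discrep_eq a _ hr, Nat.floor_natCast, Nat.floor_natCast]
    obtain ⟨k, rfl⟩ : ∃ k, n = k + 1 := ⟨n - 1, by omega⟩
    rw [Finset.sum_Icc_succ_top (by omega)]
    simp
  have h4 : ‖a n * ((1 - gcdKernel r n n : ℝ) : ℂ)‖ = ‖a n‖ * (1 - gcdKernel r n n) := by
    rw [norm_mul, Complex.norm_real, Real.norm_of_nonneg (by linarith [gcdKernel_le_one r n n])]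
  rw [← h4, ← h3]
  exact (norm_sub_le _ _).trans (by linarith)

theorem gcdKernel_self_le_half {r n : ℕ} (hr : 1 ≤ r) (h : ¬ r ∣ 2 * n) :
    gcdKernel r n n ≤ 1 / 2 := by
  unfold gcdKernel
  rw [if_pos rfl]
  have hg : n.gcd r ∣ r := Nat.gcd_dvd_right n r
  have hpos : 0 < r / n.gcd r := Nat.div_pos (Nat.le_of_dvd hr hg) (Nat.gcd_pos_of_pos_right _ hr)
  have h2 : 2 ≤ (r / n.gcd r).totient := by
    by_contra hlt
    have h1 : (r / n.gcd r).totient = 1 := by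
      have := Nat.totient_pos.2 hpos
      omega
    have hr' : r = n.gcd r * (r / n.gcd r) := (Nat.mul_div_cancel' hg).symm
    apply h
    rcases Nat.totient_eq_one_iff.1 h1 with h1 | h1
    · rw [h1, mul_one] at hr'
      rw [hr']
      exact (Nat.gcd_dvd_left n r).mul_left 2
    · rw [h1, mul_comm] at hr'
      rw [hr']
      exact Nat.mul_dvd_mul_left 2 (Nat.gcd_dvd_left n r)
  have : (2 : ℝ) ≤ (r / n.gcd r).totient := by exact_mod_cast h2
  exact one_div_le_one_div_of_le two_pos this

theorem sum_norm_sq_le_sum_norm_sq_tau (a : ℕ → ℂ) (N : ℕ) :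
    ∑ n ∈ Icc 1 N, ‖a n‖ ^ 2 ≤ ∑ n ∈ Icc 1 N, ‖a n‖ ^ 2 * (tau n : ℝ) := by
  refine Finset.sum_le_sum fun n hn => ?_
  refine le_mul_of_one_le_right (by positivity) ?_
  have : n ≠ 0 := by have := (mem_Icc.1 hn).1; omega
  exact_mod_cast tau_pos this

theorem mul_sum_norm_sq_le (a : ℕ → ℂ) {x Q : ℝ} (hx : 0 ≤ x) :
    2 * x / Q * ∑ n ∈ Icc 1 ⌊x⌋₊, ‖a n‖ ^ 2 ≤
      4 * progLHS a x Q + 3 * ∑ n ∈ Icc 1 ⌊x⌋₊, ‖a n‖ ^ 2 * (tau n : ℝ) := by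
  have hpt : ∀ n ∈ Icc 1 ⌊x⌋₊, ∀ r ∈ Icc 1 ⌊2 * x / Q⌋₊,
      ‖a n‖ ^ 2 ≤ 4 * (‖a n‖ * discrepSup a x r n) + ‖a n‖ ^ 2 * (if r ∣ 2 * n then 1 else 0) := by
    intro n hn r hr
    have hr1 := (mem_Icc.1 hr).1
    have hnx : (n : ℝ) ≤ x := (Nat.le_floor_iff hx).1 (mem_Icc.1 hn).2
    have h0 := discrepSup_nonneg a x r n
    split_ifs with h
    · have : 0 ≤ ‖a n‖ * discrepSup a x r n := by positivity
      linarith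
    · have h1 := norm_mul_one_sub_le_discrepSup a hr1 (mem_Icc.1 hn).1 hnx
      have h2 := gcdKernel_self_le_half hr1 h
      have h3 : ‖a n‖ ≤ 4 * discrepSup a x r n := by nlinarith [norm_nonneg (a n)]
      nlinarith [norm_nonneg (a n)]
  have hcount : ∀ n ∈ Icc 1 ⌊x⌋₊,
      ∑ r ∈ Icc 1 ⌊2 * x / Q⌋₊, (if r ∣ 2 * n then (1 : ℝ) else 0) ≤ 2 * tau n := by
    intro n hn
    have hn0 : 2 * n ≠ 0 := by have := (mem_Icc.1 hn).1; omega
    rw [← Finset.sum_filter, Finset.sum_const, nsmul_eq_mul, mul_one]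
    have h1 : ((Icc 1 ⌊2 * x / Q⌋₊).filter (fun r => r ∣ 2 * n)).card ≤ tau (2 * n) := by
      refine Finset.card_le_card fun r hr => ?_
      exact Nat.mem_divisors.2 ⟨(mem_filter.1 hr).2, hn0⟩
    have h2 : tau (2 * n) ≤ 2 * tau n := by
      have h := tau_mul_le 2 n
      have : tau 2 = 2 := by decide
      rwa [this] at h
    exact_mod_cast h1.trans h2
  have hfl : 2 * x / Q ≤ ⌊2 * x / Q⌋₊ + 1 := (Nat.lt_floor_add_one _).le
  have hN0 : 0 ≤ ∑ n ∈ Icc 1 ⌊x⌋₊, ‖a n‖ ^ 2 := Finset.sum_nonneg fun _ _ => by positivity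
  have hT := sum_norm_sq_le_sum_norm_sq_tau a ⌊x⌋₊
  have hmain : (⌊2 * x / Q⌋₊ : ℝ) * ∑ n ∈ Icc 1 ⌊x⌋₊, ‖a n‖ ^ 2 ≤
      4 * progLHS a x Q + 2 * ∑ n ∈ Icc 1 ⌊x⌋₊, ‖a n‖ ^ 2 * (tau n : ℝ) := by
    rw [progLHS_eq]
    calc (⌊2 * x / Q⌋₊ : ℝ) * ∑ n ∈ Icc 1 ⌊x⌋₊, ‖a n‖ ^ 2
        = ∑ n ∈ Icc 1 ⌊x⌋₊, ∑ _r ∈ Icc 1 ⌊2 * x / Q⌋₊, ‖a n‖ ^ 2 := by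
          rw [Finset.mul_sum]
          refine Finset.sum_congr rfl fun n _ => ?_
          simp
      _ ≤ ∑ n ∈ Icc 1 ⌊x⌋₊, ∑ r ∈ Icc 1 ⌊2 * x / Q⌋₊,
          (4 * (‖a n‖ * discrepSup a x r n) + ‖a n‖ ^ 2 * (if r ∣ 2 * n then 1 else 0)) :=
          Finset.sum_le_sum fun n hn => Finset.sum_le_sum fun r hr => hpt n hn r hr
      _ = 4 * (∑ r ∈ Icc 1 ⌊2 * x / Q⌋₊, ∑ n ∈ Icc 1 ⌊x⌋₊, ‖a n‖ * discrepSup a x r n) +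
          ∑ n ∈ Icc 1 ⌊x⌋₊, ‖a n‖ ^ 2 *
            ∑ r ∈ Icc 1 ⌊2 * x / Q⌋₊, (if r ∣ 2 * n then (1 : ℝ) else 0) := by
          simp only [Finset.sum_add_distrib, Finset.mul_sum]
          rw [Finset.sum_comm]
      _ ≤ _ := by
          refine add_le_add le_rfl ?_
          rw [Finset.mul_sum]
          refine Finset.sum_le_sum fun n hn => ?_
          refine (mul_le_mul_of_nonneg_left (hcount n hn) (by positivity)).trans (le_of_eq ?_)
          ring
  have := mul_le_mul_of_nonneg_right hfl hN0
  linarith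

theorem norm_sum_sq_le_mul (a : ℕ → ℂ) {x : ℝ} (hx : 0 ≤ x) :
    ‖∑ n ∈ Icc 1 ⌊x⌋₊, a n‖ ^ 2 ≤ x * ∑ n ∈ Icc 1 ⌊x⌋₊, ‖a n‖ ^ 2 := by
  have h1 : ‖∑ n ∈ Icc 1 ⌊x⌋₊, a n‖ ^ 2 ≤ (∑ n ∈ Icc 1 ⌊x⌋₊, ‖a n‖) ^ 2 :=
    pow_le_pow_left₀ (norm_nonneg _) (norm_sum_le _ _) 2
  have h2 := sq_sum_le_card_mul_sum_sq (s := Icc 1 ⌊x⌋₊) (f := fun n => ‖a n‖)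
  rw [Nat.card_Icc, Nat.add_sub_cancel] at h2
  refine h1.trans (h2.trans ?_)
  exact mul_le_mul_of_nonneg_right (Nat.floor_le hx) (Finset.sum_nonneg fun _ _ => by positivity)

theorem sq_sum_norm_le_concLHS_one (a : ℕ → ℂ) (x : ℝ) {Q : ℝ} (hQ : 1 ≤ Q) :
    (∑ n ∈ Icc 1 ⌊x⌋₊, ‖a n‖) ^ 2 ≤ concLHS a x Q 1 := by
  rw [concLHS_eq]
  have h1 : 1 ∈ (Icc 1 ⌊Q⌋₊).filter (fun h : ℕ => (1 : ℝ) ≤ h) := by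
    simp [hQ]
  have := Finset.single_le_sum (f := fun h : ℕ => (∑ m ∈ Icc 1 (⌊x⌋₊ / h), ‖a (h * m)‖) ^ 2)
    (fun _ _ => sq_nonneg _) h1
  simpa using this

theorem concLHS_one_one_le {x : ℝ} (hx : 0 ≤ x) (Q : ℝ) :
    concLHS (fun _ => 1) x Q 1 ≤ 5 * x ^ 2 := by
  rw [concLHS_eq]
  have hterm : ∀ h ∈ (Icc 1 ⌊Q⌋₊).filter (fun h : ℕ => (1 : ℝ) ≤ h),
      (∑ _m ∈ Icc 1 (⌊x⌋₊ / h), ‖(1 : ℂ)‖) ^ 2 ≤ x ^ 2 * (1 / (h : ℝ) ^ 2) := by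
    intro h hh
    have h1 := cast_floor_div_le hx h
    have : x ^ 2 * (1 / (h : ℝ) ^ 2) = (x / h) ^ 2 := by ring
    rw [this]
    refine pow_le_pow_left₀ (Finset.sum_nonneg fun _ _ => norm_nonneg _) ?_ 2
    simpa using h1
  refine (Finset.sum_le_sum hterm).trans ?_
  rw [← Finset.mul_sum, mul_comm]
  refine mul_le_mul_of_nonneg_right ?_ (by positivity)
  refine (Finset.sum_le_sum_of_subset_of_nonneg (t := (Icc 1 ⌊Q⌋₊).filter
    (fun l : ℕ => (1 / 2 : ℝ) < l)) ?_ fun _ _ _ => by positivity).trans ?_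
  · intro h hh
    rw [mem_filter] at hh ⊢
    exact ⟨hh.1, by linarith [hh.2]⟩
  · refine (sum_Icc_inv_sq_tail_le ⌊Q⌋₊ (y := 1 / 2) (by norm_num)).trans ?_
    norm_num

theorem abs_varV_sub_mul_varV_one_le (a : ℕ → ℂ) {x Q P w D : ℝ} (hx : 0 ≤ x) (hQ : 0 < Q)
    (hXQ : 2 * x / Q ≤ Q) (hP : 3 ≤ P) (hlog : 0 ≤ Real.log x) (hw : 0 ≤ w)
    (hD : ‖smoothForm a x Q P - (w : ℂ) * smoothForm (fun _ => 1) x Q P‖ ≤ D) :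
    |varV a x Q - ((⌊Q⌋₊ - ⌊Q / 2⌋₊ : ℕ) : ℝ) * (∑ n ∈ Icc 1 ⌊x⌋₊, ‖a n‖ ^ 2) -
      w * (varV (fun _ => 1) x Q - ((⌊Q⌋₊ - ⌊Q / 2⌋₊ : ℕ) : ℝ) * ⌊x⌋₊)| ≤
      4 * progLHS a x Q + w * (8 * x ^ 2 / Q) +
        36 * (Real.log x / (P * Real.log P)) * (concLHS a x Q 1 + w * (5 * x ^ 2)) + D := by
  have hlP := one_lt_log_of_three_le hP
  have hZ : 0 ≤ Real.log x / (P * Real.log P) := by positivity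
  have h1 := norm_varV_sub_le a hx hQ
  have h2 := norm_varV_sub_le (fun _ => 1) hx hQ
  have h3 := norm_offForm_sub_smoothForm_le a hP hQ hXQ
  have h4 := norm_offForm_sub_smoothForm_le (fun _ => 1) hP hQ hXQ
  have h5 := progLHS_one_le hx hQ
  have h6 := concLHS_one_one_le hx Q
  have hN : ∑ n ∈ Icc 1 ⌊x⌋₊, ‖(1 : ℂ)‖ ^ 2 = (⌊x⌋₊ : ℝ) := by simp
  rw [hN] at h2
  have h2' : ‖((varV (fun _ => 1) x Q : ℝ) : ℂ) -
      (((⌊Q⌋₊ - ⌊Q / 2⌋₊ : ℕ) * (⌊x⌋₊ : ℝ) : ℝ) : ℂ) - offForm (fun _ => 1) x Q‖ ≤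
      8 * x ^ 2 / Q := by
    refine h2.trans ((mul_le_mul_of_nonneg_left h5 (by norm_num)).trans (le_of_eq ?_))
    ring
  have h4' : ‖offForm (fun _ => 1) x Q - smoothForm (fun _ => 1) x Q P‖ ≤
      36 * (Real.log x / (P * Real.log P)) * (5 * x ^ 2) :=
    h4.trans (mul_le_mul_of_nonneg_left h6 (by positivity))
  have hwn : ‖(w : ℂ)‖ = w := by rw [Complex.norm_real, Real.norm_of_nonneg hw]
  rw [← Real.norm_eq_abs, ← Complex.norm_real]
  have e : ((varV a x Q - ((⌊Q⌋₊ - ⌊Q / 2⌋₊ : ℕ) : ℝ) * (∑ n ∈ Icc 1 ⌊x⌋₊, ‖a n‖ ^ 2) -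
      w * (varV (fun _ => 1) x Q - ((⌊Q⌋₊ - ⌊Q / 2⌋₊ : ℕ) : ℝ) * ⌊x⌋₊) : ℝ) : ℂ) =
      ((varV a x Q : ℂ) -
        (((⌊Q⌋₊ - ⌊Q / 2⌋₊ : ℕ) * ∑ n ∈ Icc 1 ⌊x⌋₊, ‖a n‖ ^ 2 : ℝ) : ℂ) - offForm a x Q) +
      (offForm a x Q - smoothForm a x Q P) +
      (smoothForm a x Q P - (w : ℂ) * smoothForm (fun _ => 1) x Q P) -
      (w : ℂ) * (offForm (fun _ => 1) x Q - smoothForm (fun _ => 1) x Q P) -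
      (w : ℂ) * (((varV (fun _ => 1) x Q : ℝ) : ℂ) -
        (((⌊Q⌋₊ - ⌊Q / 2⌋₊ : ℕ) * (⌊x⌋₊ : ℝ) : ℝ) : ℂ) - offForm (fun _ => 1) x Q) := by
    simp only [Complex.ofReal_sub, Complex.ofReal_mul]
    ring
  rw [e]
  refine (norm_sub_le _ _).trans ?_
  refine (add_le_add (norm_sub_le _ _) le_rfl).trans ?_
  refine (add_le_add (add_le_add (norm_add_le _ _) le_rfl) le_rfl).trans ?_
  refine (add_le_add (add_le_add (add_le_add (norm_add_le _ _) le_rfl) le_rfl) le_rfl).trans ?_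
  rw [norm_mul, norm_mul, hwn]
  have k1 := mul_le_mul_of_nonneg_left h2' hw
  have k2 := mul_le_mul_of_nonneg_left h4' hw
  linarith

theorem abs_varV_sub_main_le (a : ℕ → ℂ) {x Q P w D I : ℝ} (hQ : 4 ≤ Q) (hQx : Q ≤ x)
    (hXQ : 2 * x / Q ≤ Q) (hP : 3 ≤ P) (hlog : 1 ≤ Real.log x)
    (hw : w = ‖∑ n ∈ Icc 1 ⌊x⌋₊, a n‖ ^ 2 / x ^ 2)
    (hI : I = ∫ v in (x / Q)..(2 * x / Q), Int.fract v * (1 - Int.fract v) / v ^ 3)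
    (hD : ‖smoothForm a x Q P - (w : ℂ) * smoothForm (fun _ => 1) x Q P‖ ≤ D) :
    |varV a x Q - (Q / 2 * ∑ n ∈ Icc 1 ⌊x⌋₊, ‖a n‖ ^ 2
        - Q / 2 * ‖∑ n ∈ Icc 1 ⌊x⌋₊, a n‖ ^ 2 / x + ‖∑ n ∈ Icc 1 ⌊x⌋₊, a n‖ ^ 2 * I)| ≤
      20 * progLHS a x Q + 15 * ∑ n ∈ Icc 1 ⌊x⌋₊, ‖a n‖ ^ 2 * (tau n : ℝ) +
        216 * (Real.log x / (P * Real.log P)) * concLHS a x Q 1 + D +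
        16 * (w * x * Real.log x ^ 2) := by
  have hx : 0 < x := by linarith
  have hQ0 : 0 < Q := by linarith
  have hw0 : 0 ≤ w := by rw [hw]; positivity
  have hA : ‖∑ n ∈ Icc 1 ⌊x⌋₊, a n‖ ^ 2 = w * x ^ 2 := by rw [hw]; field_simp
  have hlP := one_lt_log_of_three_le hP
  have hZ : 0 ≤ Real.log x / (P * Real.log P) := by positivity
  have h1 := abs_varV_sub_mul_varV_one_le a hx.le hQ0 hXQ hP (by linarith) hw0 hD
  have h2 := abs_varV_one_sub_le hQ hQx hlog
  rw [← hI] at h2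
  have h3 := mul_sum_norm_sq_le a (Q := Q) hx.le
  have h4 := norm_sum_sq_le_mul a hx.le
  have h5 := sq_sum_norm_le_concLHS_one a x (Q := Q) (by linarith)
  have h6 : w * x ^ 2 ≤ concLHS a x Q 1 := by
    rw [← hA]
    exact (pow_le_pow_left₀ (norm_nonneg _) (norm_sum_le _ _) 2).trans h5
  have h7 := sum_norm_sq_le_sum_norm_sq_tau a ⌊x⌋₊
  rw [hA] at h4 ⊢
  set n2 := ∑ n ∈ Icc 1 ⌊x⌋₊, ‖a n‖ ^ 2
  set T := ∑ n ∈ Icc 1 ⌊x⌋₊, ‖a n‖ ^ 2 * (tau n : ℝ)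
  set Z := Real.log x / (P * Real.log P)
  set V1 := varV (fun _ => 1) x Q
  have hmM : ⌊Q / 2⌋₊ ≤ ⌊Q⌋₊ := Nat.floor_le_floor (by linarith)
  rw [Nat.cast_sub hmM] at h1
  set kq : ℝ := (⌊Q⌋₊ : ℝ) - ⌊Q / 2⌋₊
  have hkq : |kq - Q / 2| ≤ 1 := by
    have a1 := Nat.floor_le hQ0.le
    have a2 := Nat.lt_floor_add_one Q
    have a3 := Nat.floor_le (show 0 ≤ Q / 2 by linarith)
    have a4 := Nat.lt_floor_add_one (Q / 2)
    rw [abs_le]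
    constructor <;> simp only [kq] <;> linarith
  have hwx : w * x ≤ n2 := by nlinarith
  have hn20 : 0 ≤ n2 := Finset.sum_nonneg fun _ _ => by positivity
  have b1 : |(kq - Q / 2) * n2| ≤ n2 := by
    rw [abs_mul, abs_of_nonneg hn20]
    exact mul_le_of_le_one_left hn20 hkq
  have b2 : |w * (kq * ⌊x⌋₊ - Q / 2 * x)| ≤ 2 * n2 := by
    rw [abs_mul, abs_of_nonneg hw0]
    have c : |kq * ⌊x⌋₊ - Q / 2 * x| ≤ 2 * x := by
      have e : kq * ⌊x⌋₊ - Q / 2 * x = (kq - Q / 2) * ⌊x⌋₊ + Q / 2 * (⌊x⌋₊ - x) := by ring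
      rw [e]
      refine (abs_add_le _ _).trans ?_
      rw [abs_mul, abs_mul, abs_of_pos (show 0 < Q / 2 by linarith),
        Nat.abs_cast]
      have c1 := Nat.floor_le hx.le
      have c2 : |(⌊x⌋₊ : ℝ) - x| ≤ 1 := by
        rw [abs_le]
        constructor <;> linarith [Nat.lt_floor_add_one x]
      have c3 : |kq - Q / 2| * (⌊x⌋₊ : ℝ) ≤ ⌊x⌋₊ :=
        mul_le_of_le_one_left (Nat.cast_nonneg _) hkq
      nlinarith
    nlinarith
  have b3 : |w * (V1 - x ^ 2 * I)| ≤ 16 * (w * x * Real.log x ^ 2) := by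
    rw [abs_mul, abs_of_nonneg hw0]
    refine (mul_le_mul_of_nonneg_left h2 hw0).trans (le_of_eq ?_)
    ring
  have b4 : w * (8 * x ^ 2 / Q) ≤ 4 * (4 * progLHS a x Q + 3 * T) := by
    refine le_trans ?_ (mul_le_mul_of_nonneg_left h3 (by norm_num))
    have : w * (8 * x ^ 2 / Q) = 4 * (2 * x / Q * (w * x)) := by ring
    rw [this]
    refine mul_le_mul_of_nonneg_left ?_ (by norm_num)
    exact mul_le_mul_of_nonneg_left hwx (by positivity)
  have b5 : 36 * Z * (concLHS a x Q 1 + w * (5 * x ^ 2)) ≤ 216 * Z * concLHS a x Q 1 := by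
    have := mul_le_mul_of_nonneg_left h6 (show 0 ≤ 180 * Z by positivity)
    linarith
  have e : varV a x Q - (Q / 2 * n2 - Q / 2 * (w * x ^ 2) / x + w * x ^ 2 * I) =
      (varV a x Q - kq * n2 - w * (V1 - kq * ⌊x⌋₊)) + (kq - Q / 2) * n2 -
        w * (kq * ⌊x⌋₊ - Q / 2 * x) + w * (V1 - x ^ 2 * I) := by
    field_simp
    ring
  rw [e]
  refine (abs_add_le _ _).trans ?_
  refine (add_le_add (abs_sub _ _) le_rfl).trans ?_
  refine (add_le_add (add_le_add (abs_add_le _ _) le_rfl) le_rfl).trans ?_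
  linarith

theorem norm_le_of_divisor_bound {a : ℕ → ℂ} {x P E₁ E₂ E₃ : ℝ} {α : ℂ}
    (H : Resembles a x P E₁ E₂ E₃ α) {n : ℕ} (hn : 1 ≤ n) (hnx : (n : ℝ) ≤ x) : ‖a n‖ ≤ E₂ := by
  have hn0 : (0 : ℝ) < n := by exact_mod_cast hn
  have hx1 : 1 ≤ x := le_trans (by exact_mod_cast hn) hnx
  have h := H.divisor n hn 1 1 le_rfl le_rfl ((one_le_div hn0).2 hnx)
  have hs : (Icc 1 ⌊x⌋₊).filter (fun m : ℕ => (1 : ℝ) ≤ m ∧ (m : ℝ) ≤ 1) = {1} := by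
    ext m
    simp only [mem_filter, mem_Icc, mem_singleton, Nat.one_le_cast, Nat.cast_le_one]
    have := Nat.floor_pos.2 hx1
    omega
  rw [hs] at h
  simpa [tau] using h

theorem sum_norm_le_mul {a : ℕ → ℂ} {x P E₁ E₂ E₃ : ℝ} {α : ℂ}
    (H : Resembles a x P E₁ E₂ E₃ α) (hx : 0 ≤ x) (hE₂ : 0 ≤ E₂) :
    ∑ n ∈ Icc 1 ⌊x⌋₊, ‖a n‖ ≤ x * E₂ := by
  calc _ ≤ ∑ _n ∈ Icc 1 ⌊x⌋₊, E₂ := Finset.sum_le_sum fun n hn =>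
        norm_le_of_divisor_bound H (mem_Icc.1 hn).1 ((Nat.le_floor_iff hx).1 (mem_Icc.1 hn).2)
    _ = ⌊x⌋₊ * E₂ := by simp
    _ ≤ _ := mul_le_mul_of_nonneg_right (Nat.floor_le hx) hE₂

theorem sum_norm_le_sum_norm_mul_tau3 (a : ℕ → ℂ) (N : ℕ) :
    ∑ n ∈ Icc 1 N, ‖a n‖ ≤ ∑ n ∈ Icc 1 N, ‖a n‖ * (tau3 n : ℝ) := by
  refine Finset.sum_le_sum fun n hn => ?_
  have hn0 : n ≠ 0 := by have := (mem_Icc.1 hn).1; omega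
  refine le_mul_of_one_le_right (norm_nonneg _) ?_
  exact_mod_cast (tau_pos hn0).trans (tau_le_tau3 hn0)

theorem sq_div_mul_sq_le {A S x l L M K U V T : ℝ} (hx : 0 < x) (hA : 0 ≤ A) (hAS : A ≤ S)
    (hK : 0 < K) (hSx : S ≤ x * (S / K)) (hST : S ≤ T) (hl : 1 ≤ l) (hL : 1 ≤ L) (hM : 1 ≤ M)
    (hU : 0 ≤ U) (hV : 0 ≤ V) :
    (A / x) ^ 2 * x * l ^ 2 ≤ S * L ^ 6 * (U + l ^ 3 * (M / K + V) * T) := by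
  have hS0 : 0 ≤ S := hA.trans hAS
  have hT0 : 0 ≤ T := hS0.trans hST
  have hl0 : 0 < l := by linarith
  have hL0 : 0 < L := by linarith
  have hM0 : 0 < M := by linarith
  have h1 : (A / x) ^ 2 * x ≤ S * (T / K) := by
    have h2 : S / x ≤ T / K := by
      refine le_trans ?_ (div_le_div_of_nonneg_right hST hK.le)
      rw [div_le_iff₀ hx]
      linarith
    calc (A / x) ^ 2 * x = A ^ 2 / x := by field_simp
      _ ≤ S ^ 2 / x := by gcongr
      _ = S * (S / x) := by ring
      _ ≤ _ := mul_le_mul_of_nonneg_left h2 hS0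
  calc (A / x) ^ 2 * x * l ^ 2 ≤ S * (T / K) * l ^ 3 :=
        mul_le_mul h1 (pow_le_pow_right₀ hl (by norm_num)) (by positivity) (by positivity)
    _ = S * 1 * (l ^ 3 * (1 / K) * T) := by ring
    _ ≤ S * L ^ 6 * (l ^ 3 * (M / K) * T) := by
        have := one_le_pow₀ (n := 6) hL
        gcongr
    _ ≤ S * L ^ 6 * (U + l ^ 3 * (M / K + V) * T) := by
        refine mul_le_mul_of_nonneg_left ?_ (by positivity)
        have : 0 ≤ l ^ 3 * V * T := by positivity
        linarith

theorem sqrt_mul_sqrt_le_mul_sqrt {u c S x Q K : ℝ} (hu : u = Q / x) (hQ : 0 ≤ Q) (hx : 0 < x)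
    (hS : 0 ≤ S) (hc : c ≤ S ^ 2 / K) : √u * √c ≤ S * √(Q / (x * K)) := by
  have hu0 : 0 ≤ u := by rw [hu]; positivity
  rw [← Real.sqrt_mul hu0]
  calc √(u * c) ≤ √(S ^ 2 * (Q / (x * K))) := by
        refine Real.sqrt_le_sqrt ((mul_le_mul_of_nonneg_left hc hu0).trans (le_of_eq ?_))
        rw [hu, div_mul_div_comm, mul_div_assoc', mul_comm Q]
    _ = S * √(Q / (x * K)) := by rw [Real.sqrt_mul (sq_nonneg S), Real.sqrt_sq hS]

theorem error_terms_le {A S T T3 T3P L ρ x Q P R K1 K2 K3 Kp Kc KX lP lx prog conc concX c : ℝ}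
    (hx : 0 < x) (hQ : 0 < Q) (hP : 0 < P) (hRP : 1 ≤ R * P) (hρ : 0 < ρ)
    (hK1 : 0 < K1) (hK2 : 0 < K2) (hK3 : 0 < K3) (hKp : 0 < Kp) (hKc : 0 < Kc)
    (hlP : 0 < lP) (hlx : 1 ≤ lx) (hL : 1 ≤ L) (hA : 0 ≤ A) (hAS : A ≤ S) (hT : 0 ≤ T)
    (hST3 : S ≤ T3) (hT3P : 0 ≤ T3P) (hSx : S ≤ x * (S / K2)) (hprog : prog ≤ S ^ 2 / Kp)
    (hconc : conc ≤ S ^ 2 / Kc) (hconcX : concX ≤ S ^ 2 / KX) (hc : 0 ≤ c) :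
    20 * prog + 15 * T + 216 * (lx / (P * lP)) * conc +
        c * (x * (S / (x * K1)) * lP * (√(Q / x) * √concX) +
          L ^ 6 * (Q * (S / (x * K1)) * T3P +
            lx ^ 3 * (R * P * (S / K2) + Q * (K3 * S / x) / ρ) * T3)) +
        16 * ((A / x) ^ 2 * x * lx ^ 2) ≤
      (c + 1000) * (T + S ^ 2 * (1 / Kp + lx / (P * lP * Kc) + lP / K1 * √(Q / (x * KX))) +
        S * L ^ 6 * (Q / (x * K1) * T3P + lx ^ 3 * (R * P / K2 + Q * K3 / (x * ρ)) * T3)) := by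
  have hS : 0 ≤ S := hA.trans hAS
  have hT3 : 0 ≤ T3 := hS.trans hST3
  have hlx0 : 0 < lx := by linarith
  have hL0 : 0 < L := by linarith
  have bconc : lx / (P * lP) * conc ≤ S ^ 2 * (lx / (P * lP * Kc)) := by
    refine (mul_le_mul_of_nonneg_left hconc (by positivity)).trans (le_of_eq ?_)
    field_simp
  have bsqrt : x * (S / (x * K1)) * lP * (√(Q / x) * √concX) ≤
      S ^ 2 * (lP / K1 * √(Q / (x * KX))) := by
    have h1 := sqrt_mul_sqrt_le_mul_sqrt rfl hQ.le hx hS hconcX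
    have h2 : x * (S / (x * K1)) * lP = S * lP / K1 := by field_simp
    rw [h2]
    refine (mul_le_mul_of_nonneg_left h1 (by positivity)).trans (le_of_eq ?_)
    ring
  have bres : L ^ 6 * (Q * (S / (x * K1)) * T3P +
        lx ^ 3 * (R * P * (S / K2) + Q * (K3 * S / x) / ρ) * T3) =
      S * L ^ 6 * (Q / (x * K1) * T3P + lx ^ 3 * (R * P / K2 + Q * K3 / (x * ρ)) * T3) := by
    field_simp
  have bint := sq_div_mul_sq_le (U := Q / (x * K1) * T3P) (V := Q * K3 / (x * ρ))
    hx hA hAS hK2 hSx hST3 hlx hL hRP (by positivity) (by positivity)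
  rw [bres]
  set W := S * L ^ 6 * (Q / (x * K1) * T3P + lx ^ 3 * (R * P / K2 + Q * K3 / (x * ρ)) * T3)
  have hW0 : 0 ≤ W := le_trans (by positivity) bint
  have hprog' : prog ≤ S ^ 2 * (1 / Kp) := by
    refine hprog.trans (le_of_eq ?_)
    ring
  have q2 : 0 ≤ S ^ 2 * (1 / Kp) := by positivity
  have q3 : 0 ≤ S ^ 2 * (lx / (P * lP * Kc)) := by positivity
  have q4 : 0 ≤ S ^ 2 * (lP / K1 * √(Q / (x * KX))) := by positivity
  have d1 := mul_le_mul_of_nonneg_left bsqrt hc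
  have d2 : 0 ≤ c * (T + S ^ 2 * (1 / Kp) + S ^ 2 * (lx / (P * lP * Kc))) := by positivity
  linarith

end

/-- Theorem 2 of the paper. Suppose `√(2x) < Q ≤ x` are large and the complex sequence
`(a_n)_{n ≤ x}` satisfies the Progressions Condition (parameter `K_prog`), the
Non-concentration on Multiples condition (parameters `K_conc[H]`), and, for some
`3 ≤ P ≤ R ≤ x^{1/10}`, `K_int¹, K_int² > 0`, `K_int³ ≥ 1`, the Resembles the Integers
conditions I and II (for every `h ∈ ℕ` and every interval `I ⊆ [1, x/h]`). Then
`V(𝒜,x,Q) = (Q/2)Σ|a_n|² − (Q/2)|Σa_n|²/x + |Σa_n|² ∫_{x/Q}^{2x/Q} {v}(1−{v})dv/v³ + (error terms)`,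
with absolute implied constants (here combined into a single constant `C`). -/
theorem statement_1 :
    ∃ C : ℝ, 0 < C ∧
      ∀ (x Q P R Kprog K1 K2 K3 : ℝ) (Kconc : ℝ → ℝ) (a : ℕ → ℂ),
      C ≤ x → Real.sqrt (2 * x) < Q → Q ≤ x →
      (∀ n : ℕ, x < n → a n = 0) →
      3 ≤ P → P ≤ R → R ≤ x ^ ((1 : ℝ) / 10) →
      0 < K1 → 0 < K2 → 1 ≤ K3 →
      -- Progressions Condition
      0 < Kprog →
      progLHS a x Q ≤ (∑ n ∈ Finset.Icc 1 ⌊x⌋₊, ‖a n‖) ^ 2 / Kprog →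
      -- Non-concentration on Multiples condition
      (∀ H : ℝ, H ≤ Q → 0 < Kconc H ∧
        concLHS a x Q H ≤ (∑ n ∈ Finset.Icc 1 ⌊x⌋₊, ‖a n‖) ^ 2 / Kconc H) →
      -- Resembles the Integers I
      (∀ h : ℕ, 1 ≤ h → ∀ y₁ y₂ : ℝ, 1 ≤ y₁ → y₁ ≤ y₂ → y₂ ≤ x / h →
        ‖(∑ n ∈ (Finset.Icc 1 ⌊x⌋₊).filter
              (fun n : ℕ => y₁ ≤ (n : ℝ) ∧ (n : ℝ) ≤ y₂ ∧
                ∀ p ∈ n.primeFactors, P < (p : ℝ)), a (n * h))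
            - (∑ n ∈ Finset.Icc 1 ⌊x⌋₊, a n) / (x : ℂ) *
              (((Finset.Icc 1 ⌊x⌋₊).filter
                (fun n : ℕ => y₁ ≤ (n : ℝ) ∧ (n : ℝ) ≤ y₂ ∧
                  ∀ p ∈ n.primeFactors, P < (p : ℝ))).card : ℂ)‖
          ≤ (y₂ - y₁) / K1 * ((∑ n ∈ Finset.Icc 1 ⌊x⌋₊, ‖a n‖) / x)
            + (∑ n ∈ Finset.Icc 1 ⌊x⌋₊, ‖a n‖) / K2) →
      -- Resembles the Integers II
      (∀ h : ℕ, 1 ≤ h → ∀ y₁ y₂ : ℝ, 1 ≤ y₁ → y₁ ≤ y₂ → y₂ ≤ x / h →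
        ∑ n ∈ (Finset.Icc 1 ⌊x⌋₊).filter
            (fun n : ℕ => y₁ ≤ (n : ℝ) ∧ (n : ℝ) ≤ y₂),
            ‖a (n * h)‖ * (tau n : ℝ)
          ≤ K3 * (y₂ - y₁) * ((∑ n ∈ Finset.Icc 1 ⌊x⌋₊, ‖a n‖) / x)
            + (∑ n ∈ Finset.Icc 1 ⌊x⌋₊, ‖a n‖) / K2) →
      |varV a x Q -
          (Q / 2 * ∑ n ∈ Finset.Icc 1 ⌊x⌋₊, ‖a n‖ ^ 2
            - Q / 2 * ‖∑ n ∈ Finset.Icc 1 ⌊x⌋₊, a n‖ ^ 2 / x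
            + ‖∑ n ∈ Finset.Icc 1 ⌊x⌋₊, a n‖ ^ 2 *
                ∫ v in (x / Q)..(2 * x / Q), Int.fract v * (1 - Int.fract v) / v ^ 3)|
        ≤ C * ((∑ n ∈ Finset.Icc 1 ⌊x⌋₊, ‖a n‖ ^ 2 * (tau n : ℝ))
            + (∑ n ∈ Finset.Icc 1 ⌊x⌋₊, ‖a n‖) ^ 2 *
                (1 / Kprog + Real.log x / (P * Real.log P * Kconc 1)
                  + Real.log P / K1 * Real.sqrt (Q / (x * Kconc (2 * x / Q))))
            + (∑ n ∈ Finset.Icc 1 ⌊x⌋₊, ‖a n‖) * (Real.log (P * x / Q)) ^ 6 *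
                (Q / (x * K1) * ∑ n ∈ Finset.Icc 1 ⌊x⌋₊, ‖a n‖ * (tau3P (P * x / Q) n : ℝ)
                  + (Real.log x) ^ 3 * (R * P / K2 + Q * K3 / (x * R ^ (1 / Real.log P))) *
                      ∑ n ∈ Finset.Icc 1 ⌊x⌋₊, ‖a n‖ * (tau3 n : ℝ))) := by
  have hc : (1 : ℝ) ≤ smoothConst ^ 3 := one_le_pow₀ one_le_smoothConst
  refine ⟨20000 * smoothConst ^ 3 + 1000, by linarith [hc], ?_⟩
  intro x Q P R Kprog K1 K2 K3 Kconc a hCx hQ hQx _ hP hPR hR hK1 hK2 hK3 hKprog hprog hconc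
    hRI hRII
  have hx : 1000 ≤ x := by linarith
  have hx0 : 0 < x := by linarith
  have hQ4 : 4 ≤ Q := by
    refine le_trans (Real.le_sqrt_of_sq_le ?_) hQ.le
    linarith
  have hQ0 : 0 < Q := by linarith
  have hlog : 1 ≤ Real.log x := (one_lt_log_of_three_le (by linarith)).le
  have hXQ : 2 * x / Q ≤ Q := by
    rw [div_le_iff₀ hQ0]
    have := Real.lt_sq_of_sqrt_lt hQ
    linarith
  have hR3 : 3 ≤ R := hP.trans hPR
  have hRP1 : 1 ≤ R * P := one_le_mul_of_one_le_of_one_le (by linarith) (by linarith)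
  have hRP : R * P ≤ x := by
    have h1 : R * P ≤ (x ^ ((1 : ℝ) / 10)) ^ 2 := by nlinarith
    refine h1.trans ?_
    rw [← Real.rpow_natCast, ← Real.rpow_mul hx0.le]
    calc x ^ ((1 : ℝ) / 10 * (2 : ℕ)) ≤ x ^ (1 : ℝ) :=
          Real.rpow_le_rpow_of_exponent_le (by linarith) (by norm_num)
      _ = x := Real.rpow_one x
  have hxQ : 1 ≤ x / Q := (one_le_div hQ0).2 hQx
  have hy : P * x / Q = P * (x / Q) := by ring
  have hPy : P ≤ P * x / Q := by rw [hy]; nlinarith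
  have hXy : 2 * x / Q ≤ P * x / Q := by
    refine div_le_div_of_nonneg_right ?_ hQ0.le
    nlinarith
  have hX0 : 0 < 2 * x / Q := by positivity
  have hPL : Real.log P ≤ Real.log (P * x / Q) := Real.log_le_log (by linarith) hPy
  have hXL : Real.log (2 * x / Q) ≤ Real.log (P * x / Q) := Real.log_le_log hX0 hXy
  have hlP := one_lt_log_of_three_le hP
  obtain ⟨hKc1, hconc1⟩ := hconc 1 (by linarith)
  obtain ⟨hKcX, hconcX⟩ := hconc (2 * x / Q) hXQ
  set S := ∑ n ∈ Finset.Icc 1 ⌊x⌋₊, ‖a n‖ with hS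
  set A := ∑ n ∈ Finset.Icc 1 ⌊x⌋₊, a n with hA
  have hS0 : 0 ≤ S := Finset.sum_nonneg fun _ _ => norm_nonneg _
  have hAS : ‖A‖ ≤ S := norm_sum_le _ _
  have hα : ‖A / (x : ℂ)‖ = ‖A‖ / x := by
    rw [norm_div, Complex.norm_real, Real.norm_of_nonneg hx0.le]
  have hRes : Resembles a x P (S / (x * K1)) (S / K2) (K3 * S / x) (A / (x : ℂ)) := by
    constructor
    · intro h hh y₁ y₂ h1 h2 h3
      have h4 : (y₂ - y₁) / K1 * (S / x) = (y₂ - y₁) * (S / (x * K1)) := by field_simp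
      rw [← h4]
      refine le_of_eq_of_le ?_ (hRI h hh y₁ y₂ h1 h2 h3)
      unfold IsRough
      congr!
    · intro h hh y₁ y₂ h1 h2 h3
      refine (hRII h hh y₁ y₂ h1 h2 h3).trans (le_of_eq ?_)
      ring
  have hD := hRes.norm_smoothForm_sub_le (R := R) (L := Real.log (P * x / Q))
    (y := P * x / Q) (by positivity) (by positivity)
    (by
      rw [hα]
      refine div_le_div_of_nonneg_right (hAS.trans ?_) hx0.le
      exact le_mul_of_one_le_left hS0 hK3)
    hP (by linarith) hRP hQ0 hXQ hQx hlog hPL hXL hPy hXy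
    (by rw [hα, div_mul_cancel₀ _ hx0.ne']; exact hAS)
  have hmain := abs_varV_sub_main_le a hQ4 hQx hXQ hP hlog
    (w := ‖A / (x : ℂ)‖ ^ 2) (by rw [hα, div_pow]) rfl hD
  refine hmain.trans ?_
  have hST3 := sum_norm_le_sum_norm_mul_tau3 a ⌊x⌋₊
  have hSx := sum_norm_le_mul hRes hx0.le (by positivity)
  rw [hα]
  exact error_terms_le hx0 hQ0 (by linarith) hRP1
    (Real.rpow_pos_of_pos (by linarith) _) hK1 hK2 (by linarith) hKprog hKc1 (by linarith) hlog
    (by linarith) (norm_nonneg A) hAS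
    (Finset.sum_nonneg fun _ _ => by positivity) hST3
    (Finset.sum_nonneg fun _ _ => by positivity) hSx hprog hconc1 hconcX (by positivity)
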